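/- Let K ⊆ ℂ be a number field of degree d over ℚ, and let α∈(0,1), δ, ε > 0, β∈[0, ε/(1+ε)), y ≥ β, z_1 ≥ −y, and z_2 > 0. Let {a_n}_{n≥1} and {b_n}_{n≥1} be sequences of nonzero elements of 𝒪_K such that for all n: (i) n^{1+ε} ≤ |a_n| ≤ |a_{n+1}|; (ii) |b_n| < |a_n|^β · 2^{(log₂|a_n|)^α}; (iii) house(b_n) ≤ |a_n|^{y} · 2^{(log₂|a_n|)^α}; (iv) house(a_n^{−1}) ≤ |a_n|^{z_1} · 2^{(log₂|a_n|)^α}; (v) there is a positive integer r_n dividing a_n in 𝒪_K with r_n · |norm(a_n/r_n)| ≤ |a_n|^{z_2} · 2^{(log₂|a_n|)^α}. If limsup_{n→∞} |a_n|^{( (d(y + z_1 + z_2) + z_2 + δ)/(1−β) + 1 )^{−n}} = ∞, then the infinite product ∏_{n=1}^∞ (1 + b_n/a_n) converges to a complex number that is either transcendental over ℚ or an element of K. -/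

import Mathlib

open Filter

noncomputable def house (a : ℂ) : ℝ :=
  sSup {r : ℝ | ∃ z : ℂ, Polynomial.aeval z (minpoly ℚ a) = 0 ∧ r = ‖z‖}

/-- The product of the algebraic conjugates of `a`, i.e. the field norm of `a`
from `ℚ(a)` to `ℚ` (viewed in `ℂ`). -/
noncomputable def conjNorm (a : ℂ) : ℂ :=
  ((minpoly ℚ a).aroots ℂ).prod

section PolynomialMethod

open MvPolynomial

section WeightedNorm
variable {σ R : Type*} [NormedCommRing R]

/-- The weighted `ℓ¹`-norm of the coefficients of a polynomial. -/
noncomputable def wnorm (w : σ → ℝ) (f : MvPolynomial σ R) : ℝ :=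
  ∑ I ∈ f.support, ‖coeff I f‖ * I.prod fun i k => w i ^ k

lemma wnorm_eq_of_subset (w : σ → ℝ) (f : MvPolynomial σ R) {s : Finset (σ →₀ ℕ)}
    (hs : f.support ⊆ s) : wnorm w f = ∑ I ∈ s, ‖coeff I f‖ * I.prod fun i k => w i ^ k := by
  refine Finset.sum_subset hs fun I _ hI => ?_
  rw [notMem_support_iff.mp hI]; simp

lemma weight_nonneg {w : σ → ℝ} (hw : ∀ i, 0 ≤ w i) (I : σ →₀ ℕ) :
    0 ≤ I.prod fun i k => w i ^ k :=
  Finset.prod_nonneg fun i _ => pow_nonneg (hw i) _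

lemma weight_add (w : σ → ℝ) (I J : σ →₀ ℕ) :
    ((I + J).prod fun i k => w i ^ k) =
      (I.prod fun i k => w i ^ k) * J.prod fun i k => w i ^ k := by
  classical
  exact Finsupp.prod_add_index (by simp) (fun i _ a b => pow_add _ _ _)

lemma wnorm_nonneg {w : σ → ℝ} (hw : ∀ i, 0 ≤ w i) (f : MvPolynomial σ R) : 0 ≤ wnorm w f :=
  Finset.sum_nonneg fun I _ => mul_nonneg (norm_nonneg _) (weight_nonneg hw I)

@[simp] lemma wnorm_zero (w : σ → ℝ) : wnorm w (0 : MvPolynomial σ R) = 0 := by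
  simp [wnorm]

lemma wnorm_monomial (w : σ → ℝ) (I : σ →₀ ℕ) (a : R) :
    wnorm w (monomial I a) = ‖a‖ * I.prod fun i k => w i ^ k := by
  classical
  rw [wnorm_eq_of_subset w _ (s := {I}) support_monomial_subset]
  simp

lemma wnorm_add_le {w : σ → ℝ} (hw : ∀ i, 0 ≤ w i) (f g : MvPolynomial σ R) :
    wnorm w (f + g) ≤ wnorm w f + wnorm w g := by
  classical
  rw [wnorm_eq_of_subset w f (Finset.subset_union_left (s₂ := g.support)),
    wnorm_eq_of_subset w g (Finset.subset_union_right (s₁ := f.support)),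
    wnorm_eq_of_subset w (f + g) support_add, ← Finset.sum_add_distrib]
  refine Finset.sum_le_sum fun I _ => ?_
  rw [coeff_add, ← add_mul]
  exact mul_le_mul_of_nonneg_right (norm_add_le _ _) (weight_nonneg hw I)

lemma wnorm_sum_le {ι : Type*} {w : σ → ℝ} (hw : ∀ i, 0 ≤ w i) (s : Finset ι)
    (f : ι → MvPolynomial σ R) : wnorm w (∑ j ∈ s, f j) ≤ ∑ j ∈ s, wnorm w (f j) :=
  Finset.le_sum_of_subadditive _ (wnorm_zero w).le (wnorm_add_le hw) s f

lemma wnorm_mul_le {w : σ → ℝ} (hw : ∀ i, 0 ≤ w i) (f g : MvPolynomial σ R) :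
    wnorm w (f * g) ≤ wnorm w f * wnorm w g := by
  conv_lhs => rw [f.as_sum, g.as_sum, Finset.sum_mul_sum]
  refine (wnorm_sum_le hw _ _).trans ?_
  rw [wnorm, wnorm, Finset.sum_mul_sum]
  refine Finset.sum_le_sum fun I _ => (wnorm_sum_le hw _ _).trans (Finset.sum_le_sum fun J _ => ?_)
  rw [monomial_mul, wnorm_monomial, weight_add]
  have h1 := norm_mul_le (coeff I f) (coeff J g)
  have h2 := mul_nonneg (weight_nonneg hw I) (weight_nonneg hw J)
  nlinarith [mul_le_mul_of_nonneg_right h1 h2]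

lemma wnorm_C (w : σ → ℝ) (a : R) : wnorm w (C a : MvPolynomial σ R) = ‖a‖ := by
  rw [← monomial_zero', wnorm_monomial]; simp

lemma wnorm_one_le [NormOneClass R] (w : σ → ℝ) : wnorm w (1 : MvPolynomial σ R) ≤ 1 := by
  rw [← C_1, wnorm_C, norm_one]

lemma wnorm_X [NormOneClass R] (w : σ → ℝ) (i : σ) :
    wnorm w (X i : MvPolynomial σ R) = w i := by
  rw [X, wnorm_monomial]; simp

lemma wnorm_prod_le [NormOneClass R] {ι : Type*} {w : σ → ℝ} (hw : ∀ i, 0 ≤ w i) (s : Finset ι)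
    (f : ι → MvPolynomial σ R) : wnorm w (∏ j ∈ s, f j) ≤ ∏ j ∈ s, wnorm w (f j) := by
  classical
  induction s using Finset.induction_on with
  | empty => simpa using wnorm_one_le w
  | insert a s ha ih =>
    rw [Finset.prod_insert ha, Finset.prod_insert ha]
    exact (wnorm_mul_le hw _ _).trans (mul_le_mul_of_nonneg_left ih (wnorm_nonneg hw _))

lemma wnorm_pow_le [NormOneClass R] {w : σ → ℝ} (hw : ∀ i, 0 ≤ w i) (f : MvPolynomial σ R)
    (n : ℕ) : wnorm w (f ^ n) ≤ wnorm w f ^ n := by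
  simpa using wnorm_prod_le hw (Finset.range n) (fun _ => f)

lemma norm_coeff_mul_weight_le {w : σ → ℝ} (hw : ∀ i, 0 ≤ w i) (f : MvPolynomial σ R)
    (I : σ →₀ ℕ) : ‖coeff I f‖ * (I.prod fun i k => w i ^ k) ≤ wnorm w f := by
  classical
  rw [wnorm_eq_of_subset w f (Finset.subset_insert I f.support)]
  exact Finset.single_le_sum (f := fun I : σ →₀ ℕ => ‖coeff I f‖ * I.prod fun i k => w i ^ k)
    (fun J _ => mul_nonneg (norm_nonneg _) (weight_nonneg hw J)) (Finset.mem_insert_self I _)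

lemma norm_coeff_le_wnorm_one (f : MvPolynomial σ R) (I : σ →₀ ℕ) :
    ‖coeff I f‖ ≤ wnorm (fun _ => 1) f := by
  simpa using norm_coeff_mul_weight_le (w := fun _ : σ => (1 : ℝ)) (fun _ => zero_le_one) f I

end WeightedNorm

section Hasse
variable {σ R : Type*} [Fintype σ] [CommRing R]

/-- The Hasse derivative of multi-index `Δ` of a multivariate polynomial. -/
noncomputable def mvHasse (Δ : σ →₀ ℕ) : MvPolynomial σ R →ₗ[R] MvPolynomial σ R :=
  (basisMonomials σ R).constr R fun I => monomial (I - Δ) ((∏ i, (I i).choose (Δ i) : ℕ) : R)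

lemma mvHasse_monomial (Δ I : σ →₀ ℕ) (a : R) :
    mvHasse Δ (monomial I a) = monomial (I - Δ) (a * ((∏ i, (I i).choose (Δ i) : ℕ) : R)) := by
  have h : monomial I a = a • basisMonomials σ R I := by simp [smul_monomial]
  rw [h, map_smul, mvHasse, Module.Basis.constr_basis, smul_monomial, smul_eq_mul]

lemma coeff_mvHasse (Δ I : σ →₀ ℕ) (f : MvPolynomial σ R) :
    coeff I (mvHasse Δ f) = coeff (I + Δ) f * ((∏ i, (I i + Δ i).choose (Δ i) : ℕ) : R) := by
  classical
  induction f using MvPolynomial.induction_on' with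
  | add p q hp hq => rw [map_add, coeff_add, hp, hq, coeff_add, add_mul]
  | monomial J a =>
    rw [mvHasse_monomial, coeff_monomial, coeff_monomial]
    by_cases h : J = I + Δ
    · subst h; simp
    · rw [if_neg h, zero_mul]
      split_ifs with h2
      · have : ∃ i, J i < Δ i := by
          by_contra! hc
          apply h
          ext i
          have := DFunLike.congr_fun h2 i
          have := hc i
          simp at *
          omega
        obtain ⟨i, hi⟩ := this
        rw [Finset.prod_eq_zero (Finset.mem_univ i) (Nat.choose_eq_zero_of_lt hi)]
        simp
      · rfl

lemma pderiv_mvHasse (Δ : σ →₀ ℕ) (h : σ) (f : MvPolynomial σ R) :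
    pderiv h (mvHasse Δ f) = (Δ h + 1) * mvHasse (Δ + Finsupp.single h 1) f := by
  classical
  set S : σ →₀ ℕ := Finsupp.single h 1 with hS
  ext I
  have e : ((Δ h + 1 : MvPolynomial σ R)) = C ((Δ h : R) + 1) := by simp
  rw [coeff_pderiv, coeff_mvHasse, e, coeff_C_mul, coeff_mvHasse,
    show I + S + Δ = I + (Δ + S) by abel]
  have key : (∏ i, ((I + S) i + Δ i).choose (Δ i)) * (I h + 1) =
      (Δ h + 1) * ∏ i, (I i + (Δ + S) i).choose ((Δ + S) i) := by
    rw [← Finset.mul_prod_erase _ _ (Finset.mem_univ h),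
      ← Finset.mul_prod_erase _ (fun i => (I i + (Δ + S) i).choose _)
        (Finset.mem_univ h)]
    have : ∀ i ∈ Finset.univ.erase h, ((I + S) i + Δ i).choose (Δ i) =
        (I i + (Δ + S) i).choose ((Δ + S) i) := by
      intro i hi
      have : h ≠ i := (Finset.ne_of_mem_erase hi).symm
      simp [hS, this]
    rw [Finset.prod_congr rfl this]
    have h3 := Nat.choose_succ_right_eq (I h + 1 + Δ h) (Δ h)
    rw [show I h + 1 + Δ h - Δ h = I h + 1 by omega] at h3
    simp only [hS, Finsupp.add_apply, Finsupp.single_eq_same]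
    rw [show I h + (Δ h + 1) = I h + 1 + Δ h by ring]
    rw [mul_right_comm, ← h3]
    ring
  have key' := congrArg (Nat.cast : ℕ → R) key
  push_cast at key' ⊢
  rw [mul_assoc, key']
  ring

lemma degreeOf_mvHasse_le (Δ : σ →₀ ℕ) (f : MvPolynomial σ R) (i : σ) :
    degreeOf i (mvHasse Δ f) ≤ degreeOf i f := by
  rw [degreeOf_le_iff]
  intro I hI
  rw [mem_support_iff, coeff_mvHasse] at hI
  have : I + Δ ∈ f.support := by
    rw [mem_support_iff]; intro h; rw [h, zero_mul] at hI; exact hI rfl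
  have := (degreeOf_le_iff (n := i)).mp le_rfl _ this
  simp at this
  omega

lemma wnorm_mvHasse_le (Δ : σ →₀ ℕ) (f : MvPolynomial σ ℤ) (r : σ → ℕ)
    (hr : ∀ i, degreeOf i f ≤ r i) :
    wnorm (fun _ => 1) (mvHasse Δ f) ≤ 2 ^ (∑ i, r i) * wnorm (fun _ => 1) f := by
  conv_lhs => rw [f.as_sum, map_sum]
  refine (wnorm_sum_le (fun _ => zero_le_one) _ _).trans ?_
  rw [wnorm, Finset.mul_sum]
  refine Finset.sum_le_sum fun I hI => ?_
  rw [mvHasse_monomial, wnorm_monomial]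
  simp only [one_pow, Finsupp.prod, Finset.prod_const_one, mul_one]
  rw [mul_comm, norm_mul]
  refine mul_le_mul_of_nonneg_right ?_ (norm_nonneg _)
  rw [Int.norm_natCast]
  have : ∏ i, (I i).choose (Δ i) ≤ 2 ^ (∑ i, r i) := by
    rw [← Finset.prod_pow_eq_pow_sum]
    refine Finset.prod_le_prod' fun i _ => ?_
    exact (Nat.choose_le_two_pow _ _).trans
      (Nat.pow_le_pow_right (by norm_num) ((degreeOf_le_iff.mp le_rfl _ hI).trans (hr i)))
  exact_mod_cast this

lemma map_mvHasse {S : Type*} [CommRing S] (φ : R →+* S) (Δ : σ →₀ ℕ) (f : MvPolynomial σ R) :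
    map φ (mvHasse Δ f) = mvHasse Δ (map φ f) := by
  ext I
  rw [coeff_map, coeff_mvHasse, coeff_mvHasse, coeff_map, map_mul, map_natCast]

end Hasse

section Translate
variable {σ : Type*}

/-- Translation of the variables by `ξ`. -/
noncomputable def transl (ξ : σ → ℚ) : MvPolynomial σ ℚ →ₐ[ℚ] MvPolynomial σ ℚ :=
  aeval fun i => X i + C (ξ i)

lemma pderiv_transl (ξ : σ → ℚ) (h : σ) (f : MvPolynomial σ ℚ) :
    pderiv h (transl ξ f) = transl ξ (pderiv h f) := by
  classical
  induction f using MvPolynomial.induction_on with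
  | C a => simp [transl, algebraMap_eq]
  | add p q hp hq => simp only [map_add, hp, hq]
  | mul_X p n hp =>
    have hX : pderiv h (transl ξ (X n)) = transl ξ (pderiv h (X n)) := by
      simp only [transl, aeval_X, map_add, pderiv_C, pderiv_X, add_zero]
      rcases eq_or_ne n h with rfl | hn
      · simp
      · simp [hn]
    rw [map_mul, pderiv_mul, pderiv_mul, hp, hX, map_add, map_mul, map_mul]

lemma mvHasse_transl [Fintype σ] (ξ : σ → ℚ) (Δ : σ →₀ ℕ) (f : MvPolynomial σ ℚ) :
    mvHasse Δ (transl ξ f) = transl ξ (mvHasse Δ f) := by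
  classical
  have h0 : ∀ g : MvPolynomial σ ℚ, mvHasse 0 g = g := by
    intro g; ext I; rw [coeff_mvHasse]; simp
  induction hn : Δ.degree generalizing Δ with
  | zero =>
    rw [Finsupp.degree_eq_zero_iff] at hn
    rw [hn, h0, h0]
  | succ n ih =>
    have : Δ ≠ 0 := by rintro rfl; simp at hn
    obtain ⟨h, hh⟩ := Finsupp.ne_iff.mp this
    obtain ⟨Δ', rfl⟩ : ∃ Δ', Δ = Δ' + Finsupp.single h 1 := by
      refine ⟨Δ - Finsupp.single h 1, (tsub_add_cancel_of_le ?_).symm⟩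
      rw [Finsupp.single_le_iff]
      exact Nat.one_le_iff_ne_zero.mpr hh
    have ih' := ih Δ' (by simpa using hn)
    have e1 := pderiv_mvHasse Δ' h (transl ξ f)
    have e2 := congrArg (transl ξ) (pderiv_mvHasse Δ' h f)
    rw [ih', pderiv_transl, e2, map_mul] at e1
    have hc : transl ξ (Δ' h + 1 : MvPolynomial σ ℚ) = (Δ' h + 1 : MvPolynomial σ ℚ) := by
      simp
    rw [hc] at e1
    refine (mul_left_cancel₀ ?_ e1).symm
    exact Nat.cast_add_one_ne_zero _

end Translate

lemma exists_det_ne_zero_of_ker_trivial {P D : Type*} [CommRing P] [IsDomain P] {k : ℕ}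
    (A : D → Fin k → P)
    (hA : ∀ f : Fin k → P, (∀ x, ∑ j, f j * A x j = 0) → f = 0) :
    ∃ a : Fin k → D, (Matrix.of fun i j => A (a i) j).det ≠ 0 := by
  classical
  let F := FractionRing P
  let v : D → Fin k → F := fun x j => algebraMap P F (A x j)
  have hspan : Submodule.span F (Set.range v) = ⊤ := by
    by_contra hne
    obtain ⟨φ, hφ, hle⟩ := Submodule.exists_le_ker_of_lt_top _ (lt_top_iff_ne_top.mpr hne)
    obtain ⟨b, hb⟩ := IsLocalization.exist_integer_multiples (nonZeroDivisors P) Finset.univ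
      (fun j : Fin k => φ (Pi.single j 1))
    choose f hf using fun j => hb j (Finset.mem_univ j)
    have hb0 : algebraMap P F b ≠ 0 := by
      simp
    have hφv : ∀ w : Fin k → F, φ w = ∑ j, w j * φ (Pi.single j 1) := by
      intro w
      conv_lhs => rw [← Finset.univ_sum_single w]
      rw [map_sum]
      refine Finset.sum_congr rfl fun j _ => ?_
      rw [← smul_eq_mul, ← map_smul, ← Pi.single_smul, smul_eq_mul, mul_one]
    have hf0 := hA f (fun x => by
      apply IsFractionRing.injective P F
      rw [map_sum, map_zero]
      have h1 : φ (v x) = 0 := hle (Submodule.subset_span ⟨x, rfl⟩)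
      rw [hφv] at h1
      calc _ = ∑ j, algebraMap P F b * (v x j * φ (Pi.single j 1)) := by
            refine Finset.sum_congr rfl fun j _ => ?_
            rw [map_mul, hf j, Algebra.smul_def]
            simp only [v]; ring
        _ = 0 := by rw [← Finset.mul_sum, h1, mul_zero])
    apply hφ
    ext j
    have := hf j
    rw [hf0, Pi.zero_apply, map_zero, Algebra.smul_def] at this
    have h0 := (mul_eq_zero.mp this.symm).resolve_left hb0
    simpa using h0
  obtain ⟨κ, a, -, h2, h3⟩ := exists_linearIndependent' F v
  rw [hspan] at h2
  let B := Module.Basis.mk h3 h2.ge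
  have : Fintype κ := FiniteDimensional.fintypeBasisIndex B
  have hc : Fintype.card κ = k := by
    rw [← Module.finrank_eq_card_basis B, Module.finrank_fin_fun]
  let e : Fin k ≃ κ := (Fintype.equivFinOfCardEq hc).symm
  refine ⟨fun i => a (e i), fun h => ?_⟩
  have hli : LinearIndependent F ((Matrix.of fun i j => v (a (e i)) j).row) :=
    h3.comp e e.injective
  rw [Matrix.linearIndependent_rows_iff_isUnit, Matrix.isUnit_iff_isUnit_det, isUnit_iff_ne_zero] at hli
  apply hli
  have h4 := congrArg (algebraMap P F) h
  rw [RingHom.map_det, map_zero] at h4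
  exact h4

lemma eq_C_mul_of_forall_pderiv {m : ℕ} (f g : MvPolynomial (Fin m) ℚ) (hg : g ≠ 0)
    (h : ∀ i, f * pderiv i g = g * pderiv i f) : ∃ c : ℚ, f = C c * g := by
  classical
  let M : MonomialOrder (Fin m) := MonomialOrder.lex
  set I := M.degree g with hI
  have hgI : coeff I g ≠ 0 := by
    rw [hI]; exact MonomialOrder.coeff_degree_ne_zero_iff.mpr hg
  refine ⟨coeff I f / coeff I g, ?_⟩
  set c := coeff I f / coeff I g with hc
  set p := f - C c * g with hp
  suffices p = 0 from sub_eq_zero.mp this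
  by_contra hp0
  have hpi : ∀ i, p * (X i * pderiv i g) = g * (X i * pderiv i p) := by
    intro i
    rw [hp, map_sub, pderiv_C_mul]
    linear_combination X i * h i
  set J := M.degree p with hJ
  have hpJ : coeff J p ≠ 0 := by
    rw [hJ]; exact MonomialOrder.coeff_degree_ne_zero_iff.mpr hp0
  have hθ : ∀ (q : MvPolynomial (Fin m) ℚ) (i : Fin m) (K : Fin m →₀ ℕ),
      coeff K (X i * pderiv i q) = K i * coeff K q := by
    intro q i K
    rw [coeff_X_mul']
    split_ifs with hK
    · rw [coeff_pderiv]
      have h1 : 1 ≤ K i := Nat.one_le_iff_ne_zero.mpr (Finsupp.mem_support_iff.mp hK)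
      rw [tsub_add_cancel_of_le (Finsupp.single_le_iff.mpr h1), Finsupp.tsub_apply,
        Finsupp.single_eq_same, Nat.cast_sub h1]
      push_cast; ring
    · rw [Finsupp.notMem_support_iff.mp hK]; simp
  have hdeg : ∀ (q : MvPolynomial (Fin m) ℚ) (i : Fin m),
      M.toSyn (M.degree (X i * pderiv i q)) ≤ M.toSyn (M.degree q) := by
    intro q i
    rw [MonomialOrder.degree_le_iff]
    intro K hK
    apply MonomialOrder.le_degree
    rw [mem_support_iff, hθ] at hK
    rw [mem_support_iff]
    exact right_ne_zero_of_mul hK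
  have hIJ : I = J := by
    ext i
    have h1 := congrArg (coeff (J + I)) (hpi i)
    rw [MonomialOrder.coeff_mul_of_add_of_degree_le (m := M) le_rfl (hdeg g i), add_comm J I,
      MonomialOrder.coeff_mul_of_add_of_degree_le (m := M) le_rfl (hdeg p i), hθ, hθ] at h1
    have h2 : ((I i : ℚ) - J i) * (coeff J p * coeff I g) = 0 := by linear_combination h1
    have h3 := (mul_eq_zero.mp h2).resolve_right (mul_ne_zero hpJ hgI)
    exact_mod_cast sub_eq_zero.mp h3
  apply hpJ
  rw [← hIJ, hp, coeff_sub, coeff_C_mul, hc, div_mul_cancel₀ _ hgI, sub_self]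

lemma wronskian_ker_trivial {m : ℕ} {ι : Type*} (φ : ι → MvPolynomial (Fin m) ℚ)
    (k : ℕ) : ∀ (s : Finset ι), s.card = k → LinearIndepOn ℚ φ (s : Set ι) →
    ∀ f : ι → MvPolynomial (Fin m) ℚ,
      (∀ Δ : Fin m →₀ ℕ, Δ.degree < k → ∑ j ∈ s, f j * mvHasse Δ (φ j) = 0) →
      ∀ j ∈ s, f j = 0 := by
  classical
  induction k with
  | zero =>
    intro s hs _ f _ j hj
    rw [Finset.card_eq_zero.mp hs] at hj
    simp at hj
  | succ k ih =>
    intro s hs hli f hf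
    by_contra! hcon
    obtain ⟨j0, hj0, hfj0⟩ := hcon
    have hcard : (s.erase j0).card = k := by rw [Finset.card_erase_of_mem hj0, hs]; rfl
    have hder : ∀ (i : Fin m) (Δ : Fin m →₀ ℕ), Δ.degree < k →
        ∑ j ∈ s, pderiv i (f j) * mvHasse Δ (φ j) = 0 := by
      intro i Δ hΔ
      have h1 := congrArg (pderiv i) (hf Δ (by omega))
      rw [map_sum, map_zero] at h1
      have h2 := hf (Δ + Finsupp.single i 1) (by simpa using hΔ)
      have h3 : ∑ j ∈ s, f j * pderiv i (mvHasse Δ (φ j)) = 0 := by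
        have : ∀ j ∈ s, f j * pderiv i (mvHasse Δ (φ j)) =
            (Δ i + 1) * (f j * mvHasse (Δ + Finsupp.single i 1) (φ j)) := by
          intro j _; rw [pderiv_mvHasse]; ring
        rw [Finset.sum_congr rfl this, ← Finset.mul_sum, h2, mul_zero]
      have h4 : ∑ j ∈ s, pderiv i (f j * mvHasse Δ (φ j)) =
          ∑ j ∈ s, pderiv i (f j) * mvHasse Δ (φ j) +
            ∑ j ∈ s, f j * pderiv i (mvHasse Δ (φ j)) := by
        rw [← Finset.sum_add_distrib]
        refine Finset.sum_congr rfl fun j _ => ?_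
        rw [pderiv_mul]
      rw [h4, h3, add_zero] at h1
      exact h1
    have hprop : ∀ j ∈ s, ∃ c : ℚ, f j = C c * f j0 := by
      intro j hj
      refine eq_C_mul_of_forall_pderiv _ _ hfj0 fun i => ?_
      rcases eq_or_ne j j0 with rfl | hne
      · rfl
      have := ih (s.erase j0) hcard (hli.mono (by simp))
        (fun j => f j * pderiv i (f j0) - f j0 * pderiv i (f j)) (fun Δ hΔ => by
          have e : ∑ j ∈ s.erase j0, (f j * pderiv i (f j0) - f j0 * pderiv i (f j)) *
              mvHasse Δ (φ j) = ∑ j ∈ s, (f j * pderiv i (f j0) - f j0 * pderiv i (f j)) *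
              mvHasse Δ (φ j) := by
            refine Finset.sum_erase _ ?_
            ring
          rw [e]
          have e2 : ∑ j ∈ s, (f j * pderiv i (f j0) - f j0 * pderiv i (f j)) *
              mvHasse Δ (φ j) = pderiv i (f j0) * ∑ j ∈ s, f j * mvHasse Δ (φ j) -
                f j0 * ∑ j ∈ s, pderiv i (f j) * mvHasse Δ (φ j) := by
            rw [Finset.mul_sum, Finset.mul_sum, ← Finset.sum_sub_distrib]
            exact Finset.sum_congr rfl fun j _ => by ring
          rw [e2, hder i Δ hΔ, hf Δ (by omega)]; ring) j (Finset.mem_erase.mpr ⟨hne, hj⟩)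
      exact sub_eq_zero.mp this
    choose! c hc using hprop
    have h0 := hf 0 (by simp)
    have hH0 : ∀ g : MvPolynomial (Fin m) ℚ, mvHasse 0 g = g := by
      intro g; ext I; rw [coeff_mvHasse]; simp
    have h1 : f j0 * ∑ j ∈ s, c j • φ j = 0 := by
      rw [← h0, Finset.mul_sum]
      refine Finset.sum_congr rfl fun j hj => ?_
      rw [hH0, hc j hj, smul_eq_C_mul]; ring
    have h2 := (mul_eq_zero.mp h1).resolve_left hfj0
    have h3 := linearIndepOn_finset_iff.mp hli c h2 j0 hj0
    have h4 := hc j0 hj0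
    rw [h3] at h4
    simp at h4
    exact hfj0 h4

lemma exists_wronskian_ne_zero {m k : ℕ} (φ : Fin k → MvPolynomial (Fin m) ℚ)
    (hφ : LinearIndependent ℚ φ) :
    ∃ Δ : Fin k → Fin m →₀ ℕ, (∀ i, (Δ i).degree < k) ∧
      (Matrix.of fun i j => mvHasse (Δ i) (φ j)).det ≠ 0 := by
  obtain ⟨a, ha⟩ := exists_det_ne_zero_of_ker_trivial
    (D := {Δ : Fin m →₀ ℕ // Δ.degree < k}) (fun Δ j => mvHasse Δ.1 (φ j)) (by
      intro f hf
      funext j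
      refine wronskian_ker_trivial φ k Finset.univ (by simp) ?_ f (fun Δ hΔ => hf ⟨Δ, hΔ⟩) j
        (Finset.mem_univ j)
      simpa using hφ)
  exact ⟨fun i => (a i).1, fun i => (a i).2, ha⟩

section Index
variable {σ : Type*} [Fintype σ]

/-- The index of `f` at the origin with respect to the weights `w` is at least `t`. -/
def IndexGE (w : σ → ℝ) (t : ℝ) (f : MvPolynomial σ ℚ) : Prop :=
  ∀ I, coeff I f ≠ 0 → t ≤ ∑ i, (I i : ℝ) * w i

lemma IndexGE.add {w : σ → ℝ} {t : ℝ} {f g : MvPolynomial σ ℚ} (hf : IndexGE w t f)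
    (hg : IndexGE w t g) : IndexGE w t (f + g) := by
  intro I hI
  by_cases h : coeff I f = 0
  · exact hg I (by rwa [coeff_add, h, zero_add] at hI)
  · exact hf I h

lemma IndexGE.sum {ι : Type*} {w : σ → ℝ} {t : ℝ} (s : Finset ι) {f : ι → MvPolynomial σ ℚ}
    (hf : ∀ j ∈ s, IndexGE w t (f j)) : IndexGE w t (∑ j ∈ s, f j) := by
  intro I hI
  rw [coeff_sum] at hI
  obtain ⟨j, hj, h⟩ := Finset.exists_ne_zero_of_sum_ne_zero hI
  exact hf j hj I h

lemma IndexGE.mul {w : σ → ℝ} {t s : ℝ} {f g : MvPolynomial σ ℚ} (hf : IndexGE w t f)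
    (hg : IndexGE w s g) : IndexGE w (t + s) (f * g) := by
  classical
  intro I hI
  rw [coeff_mul] at hI
  obtain ⟨⟨J, K⟩, hJK, h⟩ := Finset.exists_ne_zero_of_sum_ne_zero hI
  rw [← Finset.HasAntidiagonal.mem_antidiagonal.mp hJK]
  have h1 := hf J (left_ne_zero_of_mul h)
  have h2 := hg K (right_ne_zero_of_mul h)
  simp only [Finsupp.add_apply, Nat.cast_add, add_mul, Finset.sum_add_distrib]
  linarith

lemma IndexGE.of_nonpos {w : σ → ℝ} {t : ℝ} (hw : ∀ i, 0 ≤ w i) (ht : t ≤ 0)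
    (f : MvPolynomial σ ℚ) : IndexGE w t f := fun _ _ =>
  ht.trans (Finset.sum_nonneg fun i _ => mul_nonneg (Nat.cast_nonneg _) (hw i))

lemma IndexGE.mono {w : σ → ℝ} {s t : ℝ} {f : MvPolynomial σ ℚ} (hf : IndexGE w t f)
    (h : s ≤ t) : IndexGE w s f := fun I hI => h.trans (hf I hI)

lemma IndexGE.prod {ι : Type*} {w : σ → ℝ} (hw : ∀ i, 0 ≤ w i) (s : Finset ι) {t : ι → ℝ}
    {f : ι → MvPolynomial σ ℚ} (hf : ∀ j ∈ s, IndexGE w (t j) (f j)) :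
    IndexGE w (∑ j ∈ s, t j) (∏ j ∈ s, f j) := by
  classical
  induction s using Finset.induction_on with
  | empty => exact IndexGE.of_nonpos hw (by simp) _
  | insert a s ha ih =>
    rw [Finset.sum_insert ha, Finset.prod_insert ha]
    exact (hf a (Finset.mem_insert_self a s)).mul
      (ih fun j hj => hf j (Finset.mem_insert_of_mem hj))

lemma IndexGE.det {k : ℕ} {w : σ → ℝ} (hw : ∀ i, 0 ≤ w i) {t : Fin k → ℝ}
    {M : Matrix (Fin k) (Fin k) (MvPolynomial σ ℚ)} (hM : ∀ i j, IndexGE w (t j) (M i j)) :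
    IndexGE w (∑ j, t j) M.det := by
  rw [Matrix.det_apply]
  refine IndexGE.sum _ fun p _ => ?_
  have h := IndexGE.prod hw Finset.univ (t := t) (f := fun i => M (p i) i) fun j _ => hM _ _
  intro I hI
  refine h I fun h0 => hI ?_
  rw [coeff_smul, h0, smul_zero]

lemma IndexGE.mvHasse {w : σ → ℝ} {t : ℝ} {f : MvPolynomial σ ℚ} (hf : IndexGE w t f)
    (Δ : σ →₀ ℕ) : IndexGE w (t - ∑ i, (Δ i : ℝ) * w i) (mvHasse Δ f) := by
  intro I hI
  rw [coeff_mvHasse] at hI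
  have := hf _ (left_ne_zero_of_mul hI)
  simp only [Finsupp.add_apply, Nat.cast_add, add_mul, Finset.sum_add_distrib] at this
  linarith

end Index

section Det
variable {σ : Type*}

lemma wnorm_det_le {k : ℕ} {M : Matrix (Fin k) (Fin k) (MvPolynomial σ ℤ)} {B : ℝ}
    (hM : ∀ i j, wnorm (fun _ => 1) (M i j) ≤ B) :
    wnorm (fun _ => 1) M.det ≤ k.factorial * B ^ k := by
  rw [Matrix.det_apply']
  refine (wnorm_sum_le (fun _ => zero_le_one) _ _).trans ?_
  have : ∀ p ∈ (Finset.univ : Finset (Equiv.Perm (Fin k))),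
      wnorm (fun _ => 1) ((((Equiv.Perm.sign p : ℤ) : ℤ) : MvPolynomial σ ℤ) *
        ∏ i, M (p i) i) ≤ B ^ k := by
    intro p _
    refine (wnorm_mul_le (fun _ => zero_le_one) _ _).trans ?_
    have h1 : wnorm (fun _ => 1) ((((Equiv.Perm.sign p : ℤ) : ℤ) : MvPolynomial σ ℤ)) = 1 := by
      rw [← map_intCast (C : ℤ →+* MvPolynomial σ ℤ), wnorm_C]
      rcases Int.units_eq_one_or (Equiv.Perm.sign p) with h | h <;> simp [h]
    rw [h1, one_mul]
    refine (wnorm_prod_le (fun _ => zero_le_one) _ _).trans ?_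
    calc _ ≤ ∏ _i : Fin k, B := Finset.prod_le_prod
          (fun i _ => wnorm_nonneg (fun _ => zero_le_one) _) (fun i _ => hM _ _)
      _ = B ^ k := by simp
  refine (Finset.sum_le_sum this).trans ?_
  simp [Fintype.card_perm]

lemma degreeOf_det_le {R : Type*} [CommRing R] {k : ℕ}
    {M : Matrix (Fin k) (Fin k) (MvPolynomial σ R)} {i : σ} {r : ℕ}
    (hM : ∀ a b, degreeOf i (M a b) ≤ r) : degreeOf i M.det ≤ k * r := by
  rw [Matrix.det_apply]
  refine (degreeOf_sum_le _ _ _).trans (Finset.sup_le fun p _ => ?_)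
  have h : degreeOf i (∏ a, M (p a) a) ≤ k * r := by
    refine (degreeOf_prod_le _ _ _).trans ?_
    calc _ ≤ ∑ _a : Fin k, r := Finset.sum_le_sum fun a _ => hM _ _
      _ = k * r := by simp
  rcases Int.units_eq_one_or (Equiv.Perm.sign p) with hp | hp
  · rwa [hp, one_smul]
  · rw [hp, Units.neg_smul, one_smul, degreeOf_neg]; exact h

end Det

section Separated
variable {m : ℕ} {R : Type*} [CommRing R]

/-- The polynomial in the first variable `x₀` viewed in `m + 1` variables. -/
noncomputable def headVar : MvPolynomial (Fin 1) R →ₐ[R] MvPolynomial (Fin (m + 1)) R :=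
  rename fun _ => 0

/-- The polynomial in the last `m` variables viewed in `m + 1` variables. -/
noncomputable def tailVars : MvPolynomial (Fin m) R →ₐ[R] MvPolynomial (Fin (m + 1)) R :=
  rename Fin.succ

lemma coeff_separated (φ : MvPolynomial (Fin m) R) (ψ : MvPolynomial (Fin 1) R)
    (K : Fin (m + 1) →₀ ℕ) : coeff K (tailVars φ * headVar ψ) =
      coeff K.tail φ * coeff (Finsupp.single 0 (K 0)) ψ := by
  classical
  induction φ using MvPolynomial.induction_on' with
  | add p q hp hq => rw [map_add, add_mul, coeff_add, hp, hq, coeff_add, add_mul]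
  | monomial I a =>
    induction ψ using MvPolynomial.induction_on' with
    | add p q hp hq => rw [map_add, mul_add, coeff_add, hp, hq, coeff_add, mul_add]
    | monomial A b =>
      rw [tailVars, headVar, rename_monomial, rename_monomial, monomial_mul, coeff_monomial,
        coeff_monomial, coeff_monomial]
      have hA : A = Finsupp.single 0 (A 0) := by
        ext; simp
      have e : Finsupp.mapDomain Fin.succ I + Finsupp.mapDomain (fun _ => (0 : Fin (m + 1))) A =
          Finsupp.cons (A 0) I := by
        ext i
        rw [hA, Finsupp.mapDomain_single]
        refine Fin.cases ?_ (fun j => ?_) i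
        · rw [Finsupp.add_apply, Finsupp.mapDomain_of_notMem_range _ _ (by simp)]; simp
        · rw [Finsupp.add_apply, Finsupp.mapDomain_apply (Fin.succ_injective m)]; simp
      rw [e]
      by_cases h1 : I = K.tail
      · by_cases h2 : A = Finsupp.single 0 (K 0)
        · rw [if_pos h1, if_pos h2, if_pos]
          rw [h2, h1, Finsupp.single_eq_same, Finsupp.cons_tail]
        · rw [if_pos h1, if_neg h2, if_neg, mul_zero]
          rintro rfl
          exact h2 (by rw [Finsupp.cons_zero]; exact hA)
      · rw [if_neg h1, if_neg, zero_mul]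
        rintro rfl
        exact h1 (Finsupp.tail_cons _ _).symm

lemma mvHasse_separated (φ : MvPolynomial (Fin m) R) (ψ : MvPolynomial (Fin 1) R)
    (Δ : Fin m →₀ ℕ) (a : ℕ) : mvHasse (Finsupp.cons a Δ) (tailVars φ * headVar ψ) =
      tailVars (mvHasse Δ φ) * headVar (mvHasse (Finsupp.single 0 a) ψ) := by
  ext K
  rw [coeff_mvHasse, coeff_separated, coeff_separated, coeff_mvHasse, coeff_mvHasse]
  have h1 : (K + Finsupp.cons a Δ).tail = K.tail + Δ := by
    ext i; simp [Finsupp.tail_apply]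
  rw [h1, Fin.prod_univ_succ, ← Finsupp.single_add]
  simp only [Finsupp.add_apply, Finsupp.cons_zero, Finsupp.cons_succ, Finsupp.tail_apply,
    Finset.univ_unique, Finset.prod_singleton, Fin.default_eq_zero, Finsupp.single_eq_same]
  push_cast; ring

lemma transl_separated (ξ : Fin (m + 1) → ℚ) (φ : MvPolynomial (Fin m) ℚ)
    (ψ : MvPolynomial (Fin 1) ℚ) : transl ξ (tailVars φ * headVar ψ) =
      tailVars (transl (fun i => ξ i.succ) φ) * headVar (transl (fun _ => ξ 0) ψ) := by
  rw [map_mul]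
  congr 1
  · have : (transl ξ).comp tailVars = tailVars.comp (transl fun i => ξ i.succ) := by
      apply MvPolynomial.algHom_ext; intro i
      simp [transl, tailVars, algHom_C]
    exact DFunLike.congr_fun this φ
  · have : (transl ξ).comp headVar = headVar.comp (transl fun _ => ξ 0) := by
      apply MvPolynomial.algHom_ext; intro i
      simp [transl, headVar, algHom_C]
    exact DFunLike.congr_fun this ψ

end Separated

lemma max_pow_le_of_pow_dvd (V : Polynomial ℤ) (hV : V ≠ 0) (p q : ℤ) (hpq : IsCoprime p q)
    (hq : q ≠ 0) (μ : ℕ) (B : ℝ) (hB : ∀ i, |(V.coeff i : ℝ)| ≤ B)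
    (h : (Polynomial.X - Polynomial.C ((p : ℚ) / q)) ^ μ ∣ V.map (Int.castRingHom ℚ)) :
    (max |(p : ℝ)| |(q : ℝ)|) ^ μ ≤ B := by
  set L : Polynomial ℤ := Polynomial.C q * Polynomial.X - Polynomial.C p with hL
  have hdeg : ∀ r : Polynomial ℤ, r = L → r.coeff 1 = q ∧ r.coeff 0 = -p := by
    rintro r rfl
    constructor <;> simp only [hL, Polynomial.coeff_sub, Polynomial.coeff_C_mul, Polynomial.coeff_X,
      Polynomial.coeff_C] <;> norm_num
  have hLdeg : L.natDegree = 1 := by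
    rw [hL, sub_eq_add_neg, ← Polynomial.C_neg]
    exact Polynomial.natDegree_linear hq
  have hprim : L.IsPrimitive := by
    intro r hr
    rw [Polynomial.C_dvd_iff_dvd_coeff] at hr
    have h1 := hr 1
    have h0 := hr 0
    rw [(hdeg L rfl).1] at h1
    rw [(hdeg L rfl).2, dvd_neg] at h0
    exact hpq.isUnit_of_dvd' h0 h1
  have hdvd : L ^ μ ∣ V := by
    rw [Polynomial.IsPrimitive.Int.dvd_iff_map_cast_dvd_map_cast]
    · refine dvd_trans ?_ h
      rw [Polynomial.map_pow]
      refine pow_dvd_pow_of_dvd ?_ μ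
      refine ⟨Polynomial.C ((q : ℚ)⁻¹), ?_⟩
      have hq' : (q : ℚ) ≠ 0 := by exact_mod_cast hq
      have hmap : L.map (Int.castRingHom ℚ) =
          Polynomial.C (q : ℚ) * Polynomial.X - Polynomial.C (p : ℚ) := by
        simp [hL]
      rw [hmap, div_eq_mul_inv, Polynomial.C_mul]
      have h1 : Polynomial.C (q : ℚ) * Polynomial.C ((q : ℚ)⁻¹) = 1 := by
        rw [← Polynomial.C_mul, mul_inv_cancel₀ hq', Polynomial.C_1]
      linear_combination (-Polynomial.X) * h1
    · clear h
      induction μ with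
      | zero => simp
      | succ n ih => rw [pow_succ]; exact ih.mul hprim
  obtain ⟨Q, rfl⟩ := hdvd
  have hQ : Q ≠ 0 := right_ne_zero_of_mul hV
  have hInt : ∀ a b : ℤ, b ≠ 0 → |(a : ℝ)| ≤ |((a * b : ℤ) : ℝ)| := by
    intro a b hb
    have : (1 : ℝ) ≤ |(b : ℝ)| := by exact_mod_cast Int.one_le_abs hb
    rw [Int.cast_mul, abs_mul]
    nlinarith [abs_nonneg (a : ℝ)]
  have h1 : |((q ^ μ : ℤ) : ℝ)| ≤ B := by
    refine (hInt (q ^ μ) Q.leadingCoeff (by simpa using hQ)).trans ?_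
    have : q ^ μ * Q.leadingCoeff = (L ^ μ * Q).leadingCoeff := by
      rw [Polynomial.leadingCoeff_mul, Polynomial.leadingCoeff_pow]
      congr 2
      rw [Polynomial.leadingCoeff, hLdeg, (hdeg L rfl).1]
    rw [this]
    exact hB _
  have h2 : |((p ^ μ : ℤ) : ℝ)| ≤ B := by
    rcases eq_or_ne p 0 with rfl | hp
    · rcases Nat.eq_zero_or_pos μ with rfl | hμ
      · refine le_trans ?_ h1; simp
      · rw [zero_pow hμ.ne']
        simpa using (abs_nonneg _).trans (hB 0)
    have htr : L.trailingCoeff = -p := by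
      have : L.natTrailingDegree = 0 := by
        rw [Polynomial.natTrailingDegree_eq_zero]
        right
        rw [(hdeg L rfl).2]; simpa using hp
      rw [Polynomial.trailingCoeff, this, (hdeg L rfl).2]
    have : (-p) ^ μ * Q.trailingCoeff = (L ^ μ * Q).trailingCoeff := by
      have hpow : ∀ n, (L ^ n).trailingCoeff = (-p) ^ n := by
        intro n
        induction n with
        | zero => simp [Polynomial.trailingCoeff]
        | succ n ih => rw [pow_succ, Polynomial.trailingCoeff_mul, ih, htr, pow_succ]
      rw [Polynomial.trailingCoeff_mul, hpow]
    have h3 := hInt ((-p) ^ μ) Q.trailingCoeff (by simpa using hQ)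
    rw [this] at h3
    refine le_trans (le_of_eq ?_) (h3.trans (hB _))
    push_cast
    simp [abs_pow]
  rcases max_choice |(p : ℝ)| |(q : ℝ)| with h | h <;> rw [h]
  · simpa [abs_pow] using h2
  · simpa [abs_pow] using h1

lemma exists_coeff_transl_head (ψ : MvPolynomial (Fin 1) ℚ) (hψ : ψ ≠ 0) (p q : ℤ)
    (hpq : IsCoprime p q) (hq : q ≠ 0) (c : ℚ) (hc : c ≠ 0) (z : ℕ → ℤ) (B : ℝ)
    (hz : ∀ i, (z i : ℚ) = c * coeff (Finsupp.single 0 i) ψ) (hB : ∀ i, |(z i : ℝ)| ≤ B) :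
    ∃ i : ℕ, coeff (Finsupp.single 0 i) (transl (fun _ => (p : ℚ) / q) ψ) ≠ 0 ∧
      (max |(p : ℝ)| |(q : ℝ)|) ^ i ≤ B := by
  let τ : MvPolynomial (Fin 1) ℚ →ₐ[ℚ] Polynomial ℚ := aeval fun _ => Polynomial.X
  have hτ : ∀ (f : MvPolynomial (Fin 1) ℚ) (i : ℕ),
      (τ f).coeff i = coeff (Finsupp.single 0 i) f := by
    classical
    intro f i
    induction f using MvPolynomial.induction_on' with
    | add f g hf hg => rw [map_add, Polynomial.coeff_add, hf, hg, coeff_add]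
    | monomial A a =>
      have hA : A = Finsupp.single 0 (A 0) := by ext; simp
      rw [hA, aeval_monomial, coeff_monomial, Finsupp.prod_single_index (by simp)]
      simp [Polynomial.coeff_X_pow, eq_comm]
  have hP : τ ψ ≠ 0 := by
    obtain ⟨A, hA⟩ := MvPolynomial.ne_zero_iff.mp hψ
    intro h0
    apply hA
    have h1 := hτ ψ (A 0)
    rw [h0, Polynomial.coeff_zero] at h1
    rw [show A = Finsupp.single 0 (A 0) by ext; simp, ← h1]
  set ξ : ℚ := (p : ℚ) / q with hξ
  refine ⟨(τ ψ).rootMultiplicity ξ, ?_, ?_⟩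
  · rw [← hτ]
    have : τ (transl (fun _ => ξ) ψ) = (τ ψ).comp (Polynomial.X + Polynomial.C ξ) := by
      have h1 : τ.comp (transl fun _ => ξ) =
          (Polynomial.aeval (Polynomial.X + Polynomial.C ξ)).comp τ := by
        apply MvPolynomial.algHom_ext; intro i
        simp [τ, transl]
      exact DFunLike.congr_fun h1 ψ
    rw [this, Polynomial.rootMultiplicity_eq_natTrailingDegree]
    have hne : (τ ψ).comp (Polynomial.X + Polynomial.C ξ) ≠ 0 := by
      rwa [Ne, Polynomial.comp_X_add_C_eq_zero_iff]
    exact Polynomial.trailingCoeff_nonzero_iff_nonzero.mpr hne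
  · let V : Polynomial ℤ := ∑ i ∈ (τ ψ).support, Polynomial.monomial i (z i)
    have hVc : ∀ i, V.coeff i = z i := by
      intro i
      simp only [V, Polynomial.finsetSum_coeff, Polynomial.coeff_monomial]
      rw [Finset.sum_ite_eq' (τ ψ).support i]
      split_ifs with h
      · rfl
      · have h1 := hz i
        rw [← hτ, Polynomial.notMem_support_iff.mp h, mul_zero] at h1
        exact_mod_cast h1.symm
    have hVm : V.map (Int.castRingHom ℚ) = Polynomial.C c * τ ψ := by
      ext i
      rw [Polynomial.coeff_map, hVc, Polynomial.coeff_C_mul, hτ, ← hz]; rfl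
    refine max_pow_le_of_pow_dvd V ?_ p q hpq hq _ B (fun i => by rw [hVc]; exact hB i) ?_
    · rintro h0
      rw [h0, Polynomial.map_zero] at hVm
      exact mul_ne_zero (by simpa using hc) hP hVm.symm
    · rw [hVm]
      exact Dvd.dvd.mul_left (Polynomial.pow_rootMultiplicity_dvd _ _) _

section Separate
variable {m : ℕ}

lemma wnorm_coeff_finSuccEquiv_le (G : MvPolynomial (Fin (m + 1)) ℤ) (i : ℕ) :
    wnorm (fun _ => 1) ((finSuccEquiv ℤ m G).coeff i) ≤ wnorm (fun _ => 1) G := by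
  classical
  simp only [wnorm, one_pow, Finsupp.prod, Finset.prod_const_one, mul_one]
  rw [Finset.sum_congr rfl fun I _ => by rw [finSuccEquiv_coeff_coeff]]
  rw [← Finset.sum_image (g := fun I : Fin m →₀ ℕ => Finsupp.cons i I)
    (f := fun K => ‖coeff K G‖) (fun I _ J _ h => Finsupp.cons_right_injective _ h)]
  refine Finset.sum_le_sum_of_subset_of_nonneg ?_ fun _ _ _ => norm_nonneg _
  intro K hK
  obtain ⟨I, hI, rfl⟩ := Finset.mem_image.mp hK
  rw [mem_support_iff, finSuccEquiv_coeff_coeff] at hI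
  rwa [mem_support_iff]

lemma exists_separated (G : MvPolynomial (Fin (m + 1)) ℤ) (r : Fin (m + 1) → ℕ)
    (hr : ∀ h, degreeOf h G ≤ r h) :
    ∃ (k : ℕ) (φ : Fin k → MvPolynomial (Fin m) ℤ) (ψ : Fin k → MvPolynomial (Fin 1) ℚ),
      k ≤ r 0 + 1 ∧ (∀ l h, degreeOf h (φ l) ≤ r h.succ) ∧
      (∀ l, wnorm (fun _ => 1) (φ l) ≤ wnorm (fun _ => 1) G) ∧
      LinearIndependent ℚ (fun l => map (Int.castRingHom ℚ) (φ l)) ∧ LinearIndependent ℚ ψ ∧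
      map (Int.castRingHom ℚ) G =
        ∑ l, tailVars (map (Int.castRingHom ℚ) (φ l)) * headVar (ψ l) := by
  classical
  let g : ℕ → MvPolynomial (Fin m) ℤ := fun i => (finSuccEquiv ℤ m G).coeff i
  let v : Fin (r 0 + 1) → MvPolynomial (Fin m) ℚ := fun i => map (Int.castRingHom ℚ) (g i)
  obtain ⟨κ, a, ha, hspan, hli⟩ := exists_linearIndependent' ℚ v
  have : Finite κ := Finite.of_injective a ha
  obtain ⟨k, ⟨e⟩⟩ := Finite.exists_equiv_fin κ
  let b : Fin k → Fin (r 0 + 1) := a ∘ e.symm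
  have hb : Function.Injective b := ha.comp e.symm.injective
  have hlib : LinearIndependent ℚ (v ∘ b) := hli.comp _ e.symm.injective
  have hspb : Submodule.span ℚ (Set.range (v ∘ b)) = Submodule.span ℚ (Set.range v) := by
    rw [← hspan]; congr 1
    exact e.symm.surjective.range_comp (v ∘ a)
  have hex : ∀ i, ∃ c : Fin k → ℚ, ∑ l, c l • v (b l) = v i := by
    intro i
    have : v i ∈ Submodule.span ℚ (Set.range (v ∘ b)) := by
      rw [hspb]; exact Submodule.subset_span ⟨i, rfl⟩
    exact (Submodule.mem_span_range_iff_exists_fun ℚ).mp this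
  choose c hc using hex
  have hδ : ∀ l l', c (b l) l' = if l' = l then 1 else 0 := by
    intro l l'
    have h1 : ∑ l', (c (b l) l' - if l' = l then 1 else 0) • v (b l') = 0 := by
      simp only [sub_smul, Finset.sum_sub_distrib, hc, ite_smul, one_smul, zero_smul]
      simp
    have := Fintype.linearIndependent_iff.mp hlib _ h1 l'
    linarith
  let ψ : Fin k → MvPolynomial (Fin 1) ℚ := fun l =>
    ∑ i : Fin (r 0 + 1), monomial (Finsupp.single 0 (i : ℕ)) (c i l)
  have hψc : ∀ (l) (i : ℕ), coeff (Finsupp.single 0 i) (ψ l) =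
      if h : i < r 0 + 1 then c ⟨i, h⟩ l else 0 := by
    intro l i
    simp only [ψ, coeff_sum, coeff_monomial, (Finsupp.single_injective (0 : Fin 1)).eq_iff]
    split_ifs with h
    · rw [Finset.sum_eq_single ⟨i, h⟩]
      · simp
      · intro j _ hj; rw [if_neg]; intro h2; exact hj (Fin.ext h2)
      · simp
    · refine Finset.sum_eq_zero fun j _ => ?_
      rw [if_neg]; intro h2; exact h (h2 ▸ j.2)
  refine ⟨k, fun l => g (b l), ψ, ?_, ?_, ?_, hlib, ?_, ?_⟩
  · simpa using Fintype.card_le_of_injective b hb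
  · intro l h
    exact (degreeOf_coeff_finSuccEquiv G h _).trans (hr _)
  · intro l; exact wnorm_coeff_finSuccEquiv_le G _
  · rw [Fintype.linearIndependent_iff]
    intro s hs l
    have := congrArg (coeff (Finsupp.single 0 (b l : ℕ))) hs
    simp only [coeff_sum, coeff_smul, hψc, coeff_zero, (b l).2, dite_true, Fin.eta, hδ,
      smul_eq_mul, mul_ite, mul_one, mul_zero] at this
    simpa using this
  · ext K
    rw [coeff_sum, coeff_map]
    simp only [coeff_separated, hψc]
    split_ifs with h
    · have h1 := congrArg (coeff K.tail) (hc ⟨K 0, h⟩)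
      simp only [coeff_sum, coeff_smul, smul_eq_mul, v] at h1
      rw [coeff_map, finSuccEquiv_coeff_coeff, Finsupp.cons_tail] at h1
      rw [← h1]
      exact Finset.sum_congr rfl fun l _ => mul_comm _ _
    · simp only [mul_zero, Finset.sum_const_zero]
      have : coeff K G = 0 := by
        by_contra h2
        have := (degreeOf_le_iff.mp (hr 0)) K (mem_support_iff.mpr h2)
        omega
      rw [this, map_zero]

end Separate

lemma sum_max_ge {k : ℕ} (δ : Fin k → ℕ) (hδ : ∀ j, δ j < k) (hinj : Function.Injective δ)
    (θ r : ℝ) (hθ : 0 < θ) (hθ1 : θ ≤ 1) (hr : 0 < r) (hk : (k : ℝ) ≤ 2 * r) :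
    θ ^ 2 * k / 8 ≤ ∑ j, max 0 (θ - δ j * (1 / r)) := by
  classical
  rcases Nat.eq_zero_or_pos k with rfl | hk0
  · simp
  have hk0' : (0 : ℝ) < k := by exact_mod_cast hk0
  have himg : Finset.univ.image δ = Finset.range k := by
    apply Finset.eq_of_subset_of_card_le
    · intro x hx
      obtain ⟨j, _, rfl⟩ := Finset.mem_image.mp hx
      exact Finset.mem_range.mpr (hδ j)
    · rw [Finset.card_image_of_injective _ hinj]; simp
  have h1 : ∑ j, max 0 (θ - δ j * (1 / r)) =
      ∑ i ∈ Finset.range k, max 0 (θ - (i : ℝ) * (1 / r)) := by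
    rw [← himg, Finset.sum_image fun a _ b _ h => hinj h]
  rw [h1]
  set q := ⌊θ * k / 4⌋₊ with hq
  have hqle : (q : ℝ) ≤ θ * k / 4 := Nat.floor_le (by positivity)
  have hqlt : θ * k / 4 < q + 1 := Nat.lt_floor_add_one _
  have hqk : q + 1 ≤ k := by
    have : (q : ℝ) < k := by nlinarith
    exact_mod_cast this
  calc θ ^ 2 * k / 8 ≤ ∑ i ∈ Finset.range (q + 1), θ / 2 := by
        simp only [Finset.sum_const, Finset.card_range, nsmul_eq_mul]; push_cast; nlinarith
    _ ≤ ∑ i ∈ Finset.range (q + 1), max 0 (θ - (i : ℝ) * (1 / r)) := by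
        refine Finset.sum_le_sum fun i hi => le_max_of_le_right ?_
        have hi' : (i : ℝ) ≤ q := by
          have := Finset.mem_range.mp hi
          exact_mod_cast Nat.lt_succ_iff.mp this
        have : (i : ℝ) * (1 / r) ≤ θ / 2 := by
          rw [mul_one_div, div_le_iff₀ hr]; nlinarith
        linarith
    _ ≤ _ := Finset.sum_le_sum_of_subset_of_nonneg
        (Finset.range_subset_range.mpr hqk) fun _ _ _ => le_max_left _ _

lemma wnorm_pos {σ : Type*} {f : MvPolynomial σ ℤ} (hf : f ≠ 0) :
    1 ≤ wnorm (fun _ => 1) f := by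
  obtain ⟨I, hI⟩ := MvPolynomial.ne_zero_iff.mp hf
  refine le_trans ?_ (norm_coeff_le_wnorm_one f I)
  rw [Int.norm_eq_abs]
  exact_mod_cast Int.one_le_abs hI

lemma log_wnorm_wronskian_le {σ : Type*} [Fintype σ] {k : ℕ}
    {M : Matrix (Fin k) (Fin k) (MvPolynomial σ ℤ)} (hM : M.det ≠ 0) (s : ℕ) {B T : ℝ} (hB : 1 ≤ B)
    (hMB : ∀ i j, wnorm (fun _ => 1) (M i j) ≤ 2 ^ s * B) (hT : Real.log k + s + Real.log B ≤ T) :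
    Real.log (wnorm (fun _ => 1) M.det) ≤ k * T := by
  have hB0 : 0 < B := by linarith
  rcases Nat.eq_zero_or_pos k with rfl | hk0
  · have := wnorm_det_le hMB
    simp only [Nat.factorial_zero, Nat.cast_one, pow_zero, mul_one] at this
    simpa using Real.log_nonpos (by linarith [wnorm_pos hM]) this
  have hk0' : (0 : ℝ) < k := by exact_mod_cast hk0
  have h2 : wnorm (fun _ => 1) M.det ≤ ((k : ℝ) * (2 ^ s * B)) ^ k := by
    refine (wnorm_det_le hMB).trans ?_
    rw [mul_pow (k : ℝ)]
    refine mul_le_mul_of_nonneg_right ?_ (by positivity)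
    exact_mod_cast Nat.factorial_le_pow k
  calc Real.log (wnorm (fun _ => 1) M.det) ≤ Real.log (((k : ℝ) * (2 ^ s * B)) ^ k) :=
        Real.log_le_log (by linarith [wnorm_pos hM]) h2
    _ = k * (Real.log k + (s * Real.log 2 + Real.log B)) := by
        rw [Real.log_pow, Real.log_mul hk0'.ne' (by positivity), Real.log_mul (by positivity)
          hB0.ne', Real.log_pow]
    _ ≤ k * T := by
        refine mul_le_mul_of_nonneg_left ?_ hk0'.le
        have : (s : ℝ) * Real.log 2 ≤ s := by
          have := Real.log_two_lt_d9
          exact mul_le_of_le_one_right (Nat.cast_nonneg _) (by linarith)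
        linarith

lemma exists_head_wronskian {k : ℕ} (ψ : Fin k → MvPolynomial (Fin 1) ℚ)
    (hψ : LinearIndependent ℚ ψ) : ∃ δ : Fin k → ℕ, (∀ j, δ j < k) ∧ Function.Injective δ ∧
      (Matrix.of fun i j => mvHasse (Finsupp.single 0 (δ i)) (ψ j)).det ≠ 0 := by
  obtain ⟨Δ, hΔ, hdet⟩ := exists_wronskian_ne_zero ψ hψ
  have hs : ∀ i, Δ i = Finsupp.single 0 (Δ i 0) := fun i => by ext; simp
  refine ⟨fun i => Δ i 0, fun i => ?_, fun i j hij => ?_, ?_⟩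
  · have := hΔ i
    rw [hs i, Finsupp.degree_single] at this
    exact this
  · by_contra hne
    apply hdet
    refine Matrix.det_zero_of_row_eq hne ?_
    ext l
    simp only [Matrix.of_apply]
    rw [hs i, hs j]
    simp only at hij
    rw [hij]
  · simpa only [← hs] using hdet

/-- Roth's lemma. -/
theorem roth_lemma (m : ℕ) : ∀ ε : ℝ, 0 < ε → ε ≤ 1 → ∃ ω : ℝ, 0 < ω ∧
    ∀ (r : Fin m → ℕ) (R : ℝ) (p q : Fin m → ℤ) (G : MvPolynomial (Fin m) ℤ),
      (∀ h, 0 < r h) → (∀ i j, i < j → (r i : ℝ) ≤ ω * r j) → 0 < R → (∀ h, (r h : ℝ) ≤ ω * R) →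
      (∀ h, IsCoprime (p h) (q h)) → (∀ h, q h ≠ 0) →
      (∀ h, R ≤ r h * Real.log (max |(p h : ℝ)| |(q h : ℝ)|)) → G ≠ 0 →
      (∀ h, degreeOf h G ≤ r h) → Real.log (wnorm (fun _ => 1) G) ≤ ω * R →
      ¬ IndexGE (fun h => 1 / (r h : ℝ)) ε
        (transl (fun h => (p h : ℚ) / q h) (map (Int.castRingHom ℚ) G)) := by
  induction m with
  | zero =>
    intro ε hε _
    refine ⟨1, one_pos, ?_⟩
    intro r R p q G _ _ _ _ _ _ _ hG _ _ hI
    have h1 : transl (fun h => (p h : ℚ) / q h) (map (Int.castRingHom ℚ) G) ≠ 0 := by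
      rw [MvPolynomial.eq_C_of_isEmpty G, map_C, transl, algHom_C, algebraMap_eq]
      rw [MvPolynomial.eq_C_of_isEmpty G] at hG
      simpa using hG
    obtain ⟨I, hI'⟩ := MvPolynomial.ne_zero_iff.mp h1
    have := hI I hI'
    simp at this
    linarith
  | succ m ih =>
    intro ε hε hε1
    obtain ⟨ω', hω', H⟩ := ih (ε ^ 2 / 128) (by positivity) (by nlinarith)
    obtain ⟨ω, hω, hω1, hω2, hω3⟩ : ∃ ω : ℝ, 0 < ω ∧ ω ≤ ε / 2 ∧
        (m + 3) * ω ≤ ε ^ 2 / 128 ∧ (m + 3) * ω ≤ ω' := by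
      have hm : (0 : ℝ) < m + 3 := by positivity
      refine ⟨min (ε / 2) (min (ε ^ 2 / 128 / (m + 3)) (ω' / (m + 3))), by positivity,
        min_le_left _ _, ?_, ?_⟩
      · rw [mul_comm, ← le_div_iff₀ hm]
        exact (min_le_right _ _).trans (min_le_left _ _)
      · rw [mul_comm, ← le_div_iff₀ hm]
        exact (min_le_right _ _).trans (min_le_right _ _)
    refine ⟨ω, hω, ?_⟩
    intro r R p q G hr hord hR hrR hpq hq hlog hG hdeg hnorm hI
    have hωω' : ω ≤ ω' := by nlinarith [Nat.cast_nonneg (α := ℝ) m]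
    obtain ⟨k, φ, ψ, hk, hφdeg, hφn, hφli, hψli, hsep⟩ := exists_separated G r hdeg
    have hkpos : 0 < k := by
      rcases Nat.eq_zero_or_pos k with rfl | h
      · exfalso
        simp only [Finset.univ_eq_empty, Finset.sum_empty] at hsep
        exact hG ((map_eq_zero_iff _ (map_injective _ Int.cast_injective)).mp hsep)
      · exact h
    have hkpos' : (0 : ℝ) < k := by exact_mod_cast hkpos
    obtain ⟨Δ, hΔ, hUne⟩ := exists_wronskian_ne_zero _ hφli
    obtain ⟨δ, hδ, hδinj, hVne⟩ := exists_head_wronskian ψ hψli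
    set MU : Matrix (Fin k) (Fin k) (MvPolynomial (Fin m) ℤ) :=
      Matrix.of fun i l => mvHasse (Δ i) (φ l) with hMU
    set V := (Matrix.of fun i j => mvHasse (Finsupp.single 0 (δ i)) (ψ j)).det with hV
    set MW : Matrix (Fin k) (Fin k) (MvPolynomial (Fin (m + 1)) ℤ) :=
      Matrix.of fun i j => mvHasse (Finsupp.cons (δ j) (Δ i)) G with hMW
    have hmapU : map (Int.castRingHom ℚ) MU.det =
        (Matrix.of fun i l => mvHasse (Δ i) (map (Int.castRingHom ℚ) (φ l))).det := by
      rw [RingHom.map_det]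
      congr 1
      ext i l : 1
      simp [hMU, map_mvHasse]
    have hmapW : map (Int.castRingHom ℚ) MW.det =
        (Matrix.of fun i j => mvHasse (Finsupp.cons (δ j) (Δ i))
          (map (Int.castRingHom ℚ) G)).det := by
      rw [RingHom.map_det]
      congr 1
      ext i l : 1
      simp [hMW, map_mvHasse]
    have hfac : map (Int.castRingHom ℚ) MW.det =
        tailVars (map (Int.castRingHom ℚ) MU.det) * headVar V := by
      rw [hmapW, hmapU, hV, AlgHom.map_det, AlgHom.map_det,
        ← Matrix.det_transpose (AlgHom.mapMatrix headVar _), ← Matrix.det_mul]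
      congr 1
      ext i j : 1
      simp only [Matrix.of_apply, Matrix.mul_apply, Matrix.transpose_apply,
        AlgHom.mapMatrix_apply, Matrix.map_apply]
      rw [hsep, map_sum]
      exact Finset.sum_congr rfl fun l _ => mvHasse_separated _ _ _ _
    have hUne' : MU.det ≠ 0 := by
      intro h; rw [h, map_zero] at hmapU; exact hUne hmapU.symm
    obtain ⟨I0, hI0⟩ := MvPolynomial.ne_zero_iff.mp hUne'
    have hWc : ∀ i : ℕ, ((coeff (Finsupp.cons i I0) MW.det : ℤ) : ℚ) =
        (coeff I0 MU.det : ℤ) * coeff (Finsupp.single 0 i) V := by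
      intro i
      have h1 := congrArg (coeff (Finsupp.cons i I0)) hfac
      rw [coeff_separated, Finsupp.tail_cons, Finsupp.cons_zero, coeff_map, coeff_map] at h1
      exact h1
    have hWne : MW.det ≠ 0 := by
      intro h
      rw [h, map_zero] at hfac
      obtain ⟨J, hJ⟩ := MvPolynomial.ne_zero_iff.mp hVne
      have h2 := hWc (J 0)
      rw [h, coeff_zero, Int.cast_zero] at h2
      rw [show J = Finsupp.single 0 (J 0) by ext; simp] at hJ
      exact mul_ne_zero (by exact_mod_cast hI0) hJ h2.symm
    -- bounds for the Wronskians
    have hBG := wnorm_pos hG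
    have hlogk : Real.log k ≤ ω * R := by
      have h1 : (k : ℝ) ≤ r 0 + 1 := by exact_mod_cast hk
      have h2 := Real.log_le_sub_one_of_pos hkpos'
      linarith [hrR 0]
    have hsum : ((∑ h, r h : ℕ) : ℝ) ≤ (m + 1) * (ω * R) := by
      push_cast
      calc ∑ h, (r h : ℝ) ≤ ∑ _h : Fin (m + 1), ω * R := Finset.sum_le_sum fun h _ => hrR h
        _ = _ := by simp
    have hT : Real.log k + ((∑ h, r h : ℕ) : ℝ) + Real.log (wnorm (fun _ => 1) G) ≤
        (m + 3) * (ω * R) := by linarith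
    have hWlog : Real.log (wnorm (fun _ => 1) MW.det) ≤ k * ((m + 3) * (ω * R)) :=
      log_wnorm_wronskian_le hWne _ hBG (fun i j => wnorm_mvHasse_le _ _ _ hdeg) hT
    have hUlog : Real.log (wnorm (fun _ => 1) MU.det) ≤ k * ((m + 3) * (ω * R)) := by
      refine log_wnorm_wronskian_le hUne' _ hBG (fun i j => ?_) hT
      refine (wnorm_mvHasse_le (Δ i) (φ j) (fun h => r h.succ) (hφdeg j)).trans ?_
      refine mul_le_mul ?_ (hφn j) (wnorm_nonneg (fun _ => zero_le_one) _) (by positivity)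
      refine pow_le_pow_right₀ one_le_two ?_
      rw [Fin.sum_univ_succ]; exact Nat.le_add_left _ _
    -- a coefficient of small weight
    have hUidx := H (fun h => k * r h.succ) (k * R) (fun h => p h.succ) (fun h => q h.succ) MU.det
      (fun h => Nat.mul_pos hkpos (hr _)) (fun i j hij => by
        push_cast
        have h1 := hord i.succ j.succ (Fin.succ_lt_succ_iff.mpr hij)
        have h2 : ω * (r j.succ : ℝ) ≤ ω' * r j.succ :=
          mul_le_mul_of_nonneg_right hωω' (Nat.cast_nonneg _)
        have := mul_le_mul_of_nonneg_left (h1.trans h2) hkpos'.le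
        linarith) (by positivity) (fun h => by
        push_cast
        have h1 := hrR h.succ
        have h2 : ω * R ≤ ω' * R := mul_le_mul_of_nonneg_right hωω' hR.le
        have := mul_le_mul_of_nonneg_left (h1.trans h2) hkpos'.le
        linarith) (fun h => hpq _) (fun h => hq _) (fun h => by
        push_cast
        have := mul_le_mul_of_nonneg_left (hlog h.succ) hkpos'.le
        linarith) hUne' (fun h => degreeOf_det_le fun a b =>
          (degreeOf_mvHasse_le _ _ _).trans (hφdeg b h)) (by
        refine hUlog.trans ?_
        have : (m + 3) * ω * R ≤ ω' * R := mul_le_mul_of_nonneg_right hω3 hR.le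
        have := mul_le_mul_of_nonneg_left this hkpos'.le
        linarith)
    simp only [IndexGE, not_forall, not_le, exists_prop] at hUidx
    obtain ⟨J, hJ, hJw⟩ := hUidx
    obtain ⟨i, hi, hiB⟩ := exists_coeff_transl_head V hVne (p 0) (q 0) (hpq 0) (hq 0)
      ((coeff I0 MU.det : ℤ) : ℚ) (by exact_mod_cast hI0)
      (fun i => coeff (Finsupp.cons i I0) MW.det) (wnorm (fun _ => 1) MW.det) hWc
      (fun i => by simpa [Int.norm_eq_abs] using norm_coeff_le_wnorm_one MW.det (Finsupp.cons i I0))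
    have hr0 : (0 : ℝ) < r 0 := by exact_mod_cast hr 0
    have hiw : (i : ℝ) * (1 / r 0) ≤ k * ((m + 3) * ω) := by
      set X := max |(p 0 : ℝ)| |(q 0 : ℝ)|
      have hlX : 0 < Real.log X := by
        have := hlog 0
        by_contra h
        push Not at h
        have : (r 0 : ℝ) * Real.log X ≤ 0 := mul_nonpos_of_nonneg_of_nonpos hr0.le h
        linarith [hlog 0]
      have hX : 0 < X := lt_of_lt_of_le (by
        have : (q 0 : ℝ) ≠ 0 := by exact_mod_cast hq 0
        positivity) (le_max_right _ _)
      have h1 : (i : ℝ) * Real.log X ≤ k * ((m + 3) * (ω * R)) := by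
        rw [← Real.log_pow]
        exact (Real.log_le_log (by positivity) hiB).trans hWlog
      have h2 : (k : ℝ) * ((m + 3) * (ω * R)) ≤
          k * ((m + 3) * (ω * (r 0 * Real.log X))) := by
        have := hlog 0
        gcongr
      rw [mul_one_div, div_le_iff₀ hr0]
      have h3 : (i : ℝ) * Real.log X ≤ (k * ((m + 3) * ω) * r 0) * Real.log X := by linarith
      exact le_of_mul_le_mul_right h3 hlX
    -- the lower bound for the index
    have hw : ∀ h, (0 : ℝ) ≤ 1 / (r h : ℝ) := fun h => by positivity
    have hcol : ∀ i j, IndexGE (fun h => 1 / (r h : ℝ)) (max 0 (ε / 2 - δ j * (1 / (r 0 : ℝ))))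
        (mvHasse (Finsupp.cons (δ j) (Δ i)) (transl (fun h => (p h : ℚ) / q h)
          (map (Int.castRingHom ℚ) G))) := by
      intro i j
      rcases le_total (ε / 2 - δ j * (1 / (r 0 : ℝ))) 0 with h | h
      · rw [max_eq_left h]; exact IndexGE.of_nonpos hw le_rfl _
      · rw [max_eq_right h]
        refine (hI.mvHasse _).mono ?_
        rw [Fin.sum_univ_succ]
        simp only [Finsupp.cons_zero, Finsupp.cons_succ]
        have h1 : ∑ h : Fin m, (Δ i h : ℝ) * (1 / (r h.succ : ℝ)) ≤ ω := by
          calc ∑ h : Fin m, (Δ i h : ℝ) * (1 / (r h.succ : ℝ))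
              ≤ ∑ h : Fin m, (Δ i h : ℝ) * (ω / r 0) := by
                refine Finset.sum_le_sum fun h _ => mul_le_mul_of_nonneg_left ?_ (Nat.cast_nonneg _)
                have hrh : (0 : ℝ) < r h.succ := by exact_mod_cast hr _
                rw [div_le_div_iff₀ hrh hr0]
                linarith [hord 0 h.succ (Fin.succ_pos h)]
            _ = ((Δ i).degree : ℝ) * (ω / r 0) := by
                rw [← Finset.sum_mul, Finsupp.degree_eq_sum]; push_cast; rfl
            _ ≤ r 0 * (ω / r 0) := by
                refine mul_le_mul_of_nonneg_right ?_ (by positivity)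
                have := hΔ i
                exact_mod_cast (by omega : (Δ i).degree ≤ r 0)
            _ = ω := by field_simp
        linarith
    have hWidx := IndexGE.det hw (M := Matrix.of fun i j =>
      mvHasse (Finsupp.cons (δ j) (Δ i)) (transl (fun h => (p h : ℚ) / q h)
          (map (Int.castRingHom ℚ) G))) hcol
    have htr : (Matrix.of fun i j => mvHasse (Finsupp.cons (δ j) (Δ i))
        (transl (fun h => (p h : ℚ) / q h) (map (Int.castRingHom ℚ) G))).det =
        tailVars (transl (fun h => (p h.succ : ℚ) / q h.succ) (map (Int.castRingHom ℚ) MU.det)) *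
          headVar (transl (fun _ => (p 0 : ℚ) / q 0) V) := by
      rw [← transl_separated (fun h => (p h : ℚ) / q h), ← hfac, hmapW, AlgHom.map_det]
      congr 1
      ext i j : 1
      simp [mvHasse_transl]
    rw [htr] at hWidx
    have hfin := hWidx (Finsupp.cons i J) (by
      rw [coeff_separated, Finsupp.tail_cons, Finsupp.cons_zero]
      exact mul_ne_zero hJ hi)
    rw [Fin.sum_univ_succ] at hfin
    simp only [Finsupp.cons_zero, Finsupp.cons_succ] at hfin
    have hr1 : (1 : ℝ) ≤ r 0 := by exact_mod_cast hr 0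
    have hlow := sum_max_ge δ hδ hδinj (ε / 2) (r 0) (by linarith) (by linarith) hr0 (by
      have h1 : (k : ℝ) ≤ r 0 + 1 := by exact_mod_cast hk
      linarith)
    have hJw' : ∑ h : Fin m, (J h : ℝ) * (1 / (r h.succ : ℝ)) < k * (ε ^ 2 / 128) := by
      have : ∑ h : Fin m, (J h : ℝ) * (1 / (r h.succ : ℝ)) =
          k * ∑ h : Fin m, (J h : ℝ) * (1 / ((k * r h.succ : ℕ) : ℝ)) := by
        rw [Finset.mul_sum]
        refine Finset.sum_congr rfl fun h _ => ?_
        have hrh : (0 : ℝ) < r h.succ := by exact_mod_cast hr _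
        push_cast; field_simp
      rw [this]
      exact mul_lt_mul_of_pos_left hJw hkpos'
    have h5 : (k : ℝ) * ((m + 3) * ω) ≤ k * (ε ^ 2 / 128) :=
      mul_le_mul_of_nonneg_left hω2 hkpos'.le
    have h6 : 0 < (k : ℝ) * ε ^ 2 := by positivity
    linarith

section Counting
variable {ι : Type*} [Fintype ι] [DecidableEq ι]

lemma sum_piAntidiag_apply_swap (r : ℕ) (i j : ι) :
    ∑ f ∈ Finset.piAntidiag Finset.univ r, f i =
      ∑ f ∈ Finset.piAntidiag (Finset.univ : Finset ι) r, f j := by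
  refine Finset.sum_bij' (fun f _ => f ∘ Equiv.swap i j) (fun f _ => f ∘ Equiv.swap i j)
    ?_ ?_ ?_ ?_ ?_
  · intro f hf
    rw [Finset.mem_piAntidiag] at hf ⊢
    exact ⟨by rw [← hf.1]; exact Equiv.sum_comp (Equiv.swap i j) f, by simp⟩
  · intro f hf
    rw [Finset.mem_piAntidiag] at hf ⊢
    exact ⟨by rw [← hf.1]; exact Equiv.sum_comp (Equiv.swap i j) f, by simp⟩
  · intro f _; ext x; simp
  · intro f _; ext x; simp
  · intro f _; simp

lemma card_mul_sum_piAntidiag_apply (r : ℕ) (i : ι) :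
    Fintype.card ι * ∑ f ∈ Finset.piAntidiag Finset.univ r, f i =
      r * (Finset.piAntidiag (Finset.univ : Finset ι) r).card := by
  have h1 : ∑ j : ι, ∑ f ∈ Finset.piAntidiag Finset.univ r, f j =
      Fintype.card ι * ∑ f ∈ Finset.piAntidiag Finset.univ r, f i := by
    rw [Finset.sum_congr rfl fun j _ => sum_piAntidiag_apply_swap r j i]
    simp
  rw [← h1, Finset.sum_comm, Finset.sum_congr rfl fun f hf => (Finset.mem_piAntidiag.mp hf).1]
  simp [mul_comm]

lemma piAntidiag_univ_nonempty [Nonempty ι] (r : ℕ) :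
    (Finset.piAntidiag (Finset.univ : Finset ι) r).Nonempty := by
  obtain ⟨i⟩ := ‹Nonempty ι›
  exact ⟨Pi.single i r, by simp [Finset.mem_piAntidiag]⟩

lemma sum_linear_piAntidiag [Nonempty ι] (b : ι → ℝ) {r : ℕ} (hr : 0 < r) :
    ∑ f ∈ Finset.piAntidiag Finset.univ r, ∑ i, b i * f i / r =
      (∑ i, b i) / Fintype.card ι * (Finset.piAntidiag (Finset.univ : Finset ι) r).card := by
  rw [Finset.sum_comm, Finset.sum_div, Finset.sum_mul]
  refine Finset.sum_congr rfl fun i _ => ?_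
  have h := card_mul_sum_piAntidiag_apply r i
  have h' : (Fintype.card ι : ℝ) * ∑ f ∈ Finset.piAntidiag Finset.univ r, (f i : ℝ) =
      r * (Finset.piAntidiag (Finset.univ : Finset ι) r).card := by exact_mod_cast h
  have hc : (Fintype.card ι : ℝ) ≠ 0 := by exact_mod_cast Fintype.card_ne_zero
  have hr' : (r : ℝ) ≠ 0 := by exact_mod_cast hr.ne'
  have : ∑ f ∈ Finset.piAntidiag Finset.univ r, b i * (f i : ℝ) / r =
      b i / r * ∑ f ∈ Finset.piAntidiag Finset.univ r, (f i : ℝ) := by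
    rw [Finset.mul_sum]; exact Finset.sum_congr rfl fun f _ => by ring
  rw [this]
  field_simp
  linear_combination (b i) * h'

lemma abs_linear_piAntidiag_le (b : ι → ℝ) {B : ℝ} (hB : ∀ i, |b i| ≤ B) {r : ℕ} (hr : 0 < r)
    {f : ι → ℕ} (hf : f ∈ Finset.piAntidiag Finset.univ r) : |∑ i, b i * f i / r| ≤ B := by
  have hr' : (0 : ℝ) < r := by exact_mod_cast hr
  calc |∑ i, b i * f i / r| ≤ ∑ i, |b i * f i / r| := Finset.abs_sum_le_sum_abs _ _
    _ ≤ ∑ i, B * (f i / r) := by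
        refine Finset.sum_le_sum fun i _ => ?_
        rw [mul_div_assoc, abs_mul, abs_of_nonneg (by positivity : (0 : ℝ) ≤ (f i : ℝ) / r)]
        exact mul_le_mul_of_nonneg_right (hB i) (by positivity)
    _ = B := by
        rw [← Finset.mul_sum, ← Finset.sum_div]
        have := (Finset.mem_piAntidiag.mp hf).1
        rw [← Nat.cast_sum, this, div_self hr'.ne', mul_one]

lemma card_bad_le [Nonempty ι] (b : ι → ℝ) (κ : ℝ) (hκ : 0 < κ)
    (hb : ∑ i, b i = -(2 * κ * Fintype.card ι)) : ∃ ρ : ℝ, 0 ≤ ρ ∧ ρ < 1 ∧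
    ∀ (m : ℕ) (r : Fin m → ℕ), (∀ h, 0 < r h) →
      ((((Fintype.piFinset fun h => Finset.piAntidiag (Finset.univ : Finset ι) (r h)).filter
        fun e => -(m * κ) < ∑ h, ∑ i, b i * e h i / r h).card : ℕ) : ℝ) ≤
      ρ ^ m * (Fintype.piFinset fun h =>
        Finset.piAntidiag (Finset.univ : Finset ι) (r h)).card := by
  obtain ⟨B, hB⟩ : ∃ B : ℝ, ∀ i, |b i| ≤ B := by
    refine ⟨∑ i, |b i|, fun i => ?_⟩
    exact Finset.single_le_sum (f := fun i => |b i|) (fun j _ => abs_nonneg _) (Finset.mem_univ i)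
  have hB0 : 0 ≤ B := (abs_nonneg _).trans (hB (Classical.arbitrary ι))
  set T := κ + B with hT
  have hT0 : 0 < T := by positivity
  set η := min (1 / T) (κ / (2 * T ^ 2)) with hη
  have hη0 : 0 < η := by positivity
  have hη1 : η * T ≤ 1 := by
    have : η ≤ 1 / T := min_le_left _ _
    rwa [le_div_iff₀ hT0] at this
  have hη2 : η * T ^ 2 ≤ κ / 2 := by
    have : η ≤ κ / (2 * T ^ 2) := min_le_right _ _
    rw [le_div_iff₀ (by positivity)] at this
    linarith
  have hρ0 : 0 ≤ 1 - η * κ / 2 := by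
    have : η * κ ≤ η * T := by gcongr; linarith
    linarith
  refine ⟨1 - η * κ / 2, hρ0, by nlinarith, ?_⟩
  intro m r hr
  set S : (h : Fin m) → (ι → ℕ) → ℝ := fun h f => ∑ i, b i * f i / r h with hS
  have key : ∀ h, ∑ f ∈ Finset.piAntidiag (Finset.univ : Finset ι) (r h),
      Real.exp (η * (κ + S h f)) ≤
      (1 - η * κ / 2) * (Finset.piAntidiag (Finset.univ : Finset ι) (r h)).card := by
    intro h
    have hpt : ∀ f ∈ Finset.piAntidiag (Finset.univ : Finset ι) (r h),
        Real.exp (η * (κ + S h f)) ≤ (1 + η * κ + η ^ 2 * T ^ 2) + η * S h f := by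
      intro f hf
      have h1 := abs_linear_piAntidiag_le b hB (hr h) hf
      have h2 : |κ + S h f| ≤ T := by
        refine (abs_add_le _ _).trans ?_
        rw [abs_of_pos hκ]; linarith
      have h3 : |η * (κ + S h f)| ≤ η * T := by
        rw [abs_mul, abs_of_pos hη0]; gcongr
      have h4 := Real.abs_exp_sub_one_sub_id_le (h3.trans hη1)
      have h5 : (η * (κ + S h f)) ^ 2 ≤ (η * T) ^ 2 := by
        rw [← sq_abs]; gcongr
      have := (abs_le.mp h4).2
      nlinarith
    refine (Finset.sum_le_sum hpt).trans ?_
    rw [Finset.sum_add_distrib, ← Finset.mul_sum, sum_linear_piAntidiag b (hr h), hb]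
    have hc : (Fintype.card ι : ℝ) ≠ 0 := by exact_mod_cast Fintype.card_ne_zero
    have : -(2 * κ * (Fintype.card ι : ℝ)) / Fintype.card ι = -(2 * κ) := by field_simp
    rw [this]
    simp only [Finset.sum_const, nsmul_eq_mul]
    set c : ℝ := ((Finset.piAntidiag (Finset.univ : Finset ι) (r h)).card : ℝ)
    have hc0 : 0 ≤ c := Nat.cast_nonneg _
    have : (1 + η * κ + η ^ 2 * T ^ 2) + η * (-(2 * κ)) ≤ 1 - η * κ / 2 := by nlinarith
    have := mul_le_mul_of_nonneg_right this hc0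
    linarith
  calc _ ≤ ∑ e ∈ (Fintype.piFinset fun h => Finset.piAntidiag (Finset.univ : Finset ι) (r h)).filter
        (fun e => -(m * κ) < ∑ h, ∑ i, b i * e h i / r h), Real.exp (∑ h, η * (κ + S h (e h))) := by
        rw [Finset.cast_card]
        refine Finset.sum_le_sum fun e he => ?_
        rw [Finset.mem_filter] at he
        apply Real.one_le_exp
        rw [← Finset.mul_sum, Finset.sum_add_distrib]
        simp only [Finset.sum_const, Finset.card_univ, Fintype.card_fin, nsmul_eq_mul]
        have := he.2
        have : 0 ≤ (m : ℝ) * κ + ∑ h, S h (e h) := by simp only [hS]; linarith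
        positivity
    _ ≤ ∑ e ∈ Fintype.piFinset fun h => Finset.piAntidiag (Finset.univ : Finset ι) (r h),
          ∏ h, Real.exp (η * (κ + S h (e h))) := by
        simp only [Real.exp_sum]
        refine Finset.sum_le_sum_of_subset_of_nonneg (Finset.filter_subset _ _) fun e _ _ => ?_
        exact Finset.prod_nonneg fun h _ => (Real.exp_pos _).le
    _ = ∏ h, ∑ f ∈ Finset.piAntidiag (Finset.univ : Finset ι) (r h),
          Real.exp (η * (κ + S h f)) := (Finset.prod_univ_sum
          (fun h => Finset.piAntidiag (Finset.univ : Finset ι) (r h))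
          (fun h f => Real.exp (η * (κ + S h f)))).symm
    _ ≤ ∏ h, (1 - η * κ / 2) * (Finset.piAntidiag (Finset.univ : Finset ι) (r h)).card :=
        Finset.prod_le_prod (fun h _ => Finset.sum_nonneg fun f _ => (Real.exp_pos _).le)
          fun h _ => key h
    _ = _ := by
        rw [Finset.prod_mul_distrib, Fintype.card_piFinset]
        simp
end Counting

section AuxiliaryPolynomial

attribute [local instance] Matrix.seminormedAddCommGroup

lemma exists_int_vec_le {α β : Type*} [Fintype α] [Fintype β] [Nonempty β] (A : Matrix α β ℤ)
    (hcard : 2 * Fintype.card α ≤ Fintype.card β) (B : ℝ) (hB : 1 ≤ B)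
    (hA : ∀ i j, |(A i j : ℝ)| ≤ B) :
    ∃ t : β → ℤ, t ≠ 0 ∧ A.mulVec t = 0 ∧ ∀ j, |(t j : ℝ)| ≤ Fintype.card β * B := by
  classical
  have hβ : 1 ≤ Fintype.card β := Fintype.card_pos
  have hβ' : (1 : ℝ) ≤ Fintype.card β := by exact_mod_cast hβ
  rcases Nat.eq_zero_or_pos (Fintype.card α) with h0 | h0
  · have := Fintype.card_eq_zero_iff.mp h0
    refine ⟨fun _ => 1, fun h => ?_, Subsingleton.elim _ _, fun j => ?_⟩
    · exact one_ne_zero (congrFun h (Classical.arbitrary β))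
    · simp; nlinarith
  · obtain ⟨t, ht, hAt, hn⟩ := Int.Matrix.exists_ne_zero_int_vec_norm_le A (by omega) h0
    refine ⟨t, ht, hAt, fun j => ?_⟩
    have h1 : |(t j : ℝ)| ≤ ‖t‖ := by simpa [Int.norm_eq_abs] using norm_le_pi_norm t j
    have hAn : ‖A‖ ≤ B := by
      rw [Matrix.norm_le_iff (by linarith)]
      intro i j; simpa [Int.norm_eq_abs] using hA i j
    have h2 : (1 : ℝ) ≤ Fintype.card β * max 1 ‖A‖ := by
      nlinarith [le_max_left 1 ‖A‖]
    have h3 : ((Fintype.card α : ℝ) / (Fintype.card β - Fintype.card α)) ≤ 1 := by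
      have h5 : 2 * (Fintype.card α : ℝ) ≤ Fintype.card β := by exact_mod_cast hcard
      have h6 : 0 < (Fintype.card α : ℝ) := by exact_mod_cast h0
      rw [div_le_one (by linarith)]; linarith
    calc |(t j : ℝ)| ≤ _ := h1
      _ ≤ _ := hn
      _ ≤ (Fintype.card β * max 1 ‖A‖) ^ (1 : ℝ) := Real.rpow_le_rpow_of_exponent_le h2 h3
      _ ≤ Fintype.card β * B := by
        rw [Real.rpow_one]; gcongr; exact max_le hB hAn

lemma exists_repr_le_house (E : Type*) [Field E] [NumberField E] : ∃ c : ℝ, 0 ≤ c ∧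
    ∀ (x : NumberField.RingOfIntegers E) (B : ℝ),
      (∀ σ : E →+* ℂ, ‖σ (algebraMap (NumberField.RingOfIntegers E) E x)‖ ≤ B) →
      ∀ s, |(((NumberField.RingOfIntegers.basis E).repr x s : ℤ) : ℝ)| ≤ c * B := by
  classical
  obtain ⟨c, hc⟩ : ∃ c : ℝ, ∀ (x : NumberField.RingOfIntegers E) (i : E →+* ℂ),
      ‖(((NumberField.integralBasis E).reindex
        (NumberField.equivReindex E).symm).repr x i : ℂ)‖ ≤
      c * NumberField.house (algebraMap (NumberField.RingOfIntegers E) E x) :=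
    ⟨_, NumberField.house.basis_repr_norm_le_const_mul_house E⟩
  refine ⟨|c|, abs_nonneg c, fun x B hB s => ?_⟩
  have h1 := hc x ((NumberField.equivReindex E).symm s)
  simp only [Module.Basis.repr_reindex, Finsupp.mapDomain_equiv_apply, Equiv.symm_symm,
    Equiv.apply_symm_apply] at h1
  rw [NumberField.integralBasis_repr_apply] at h1
  have h2 : NumberField.house (algebraMap (NumberField.RingOfIntegers E) E x) ≤ B := by
    have hB0 : 0 ≤ B := (norm_nonneg _).trans (hB (Classical.arbitrary _))
    rw [NumberField.house, pi_norm_le_iff_of_nonneg hB0]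
    intro σ
    exact hB σ
  have h3 : |(((NumberField.RingOfIntegers.basis E).repr x s : ℤ) : ℝ)| ≤
      c * NumberField.house (algebraMap (NumberField.RingOfIntegers E) E x) := by
    simpa using h1
  refine h3.trans ?_
  have := NumberField.house_nonneg (algebraMap (NumberField.RingOfIntegers E) E x)
  exact mul_le_mul (le_abs_self c) h2 this (abs_nonneg c)

variable {ι : Type*} [Fintype ι] {R : Type*} [CommRing R]

/-- The blockwise linear substitution with matrix `μ`. -/
noncomputable def linSubst (τ : Type*) (μ : Matrix ι ι R) :
    MvPolynomial (τ × ι) R →ₐ[R] MvPolynomial (τ × ι) R :=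
  aeval fun p => ∑ j, C (μ p.2 j) * X (p.1, j)

lemma map_linSubst {τ S : Type*} [CommRing S] (g : R →+* S) (μ : Matrix ι ι R)
    (f : MvPolynomial (τ × ι) R) :
    map g (linSubst τ μ f) = linSubst τ (μ.map g) (map g f) := by
  induction f using MvPolynomial.induction_on with
  | C a => simp [linSubst, algHom_C]
  | add p q hp hq => simp only [map_add, hp, hq]
  | mul_X p n hp =>
    rw [map_mul, map_mul, hp, map_mul, map_mul]
    congr 1
    simp [linSubst]

/-- The exponent vector attached to a doubly indexed family. -/
noncomputable def pairExp {τ : Type*} [Fintype τ] (e : τ → ι → ℕ) : τ × ι →₀ ℕ :=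
  Finsupp.equivFunOnFinite.symm fun p => e p.1 p.2

@[simp] lemma pairExp_apply {τ : Type*} [Fintype τ] (e : τ → ι → ℕ) (p : τ × ι) :
    pairExp e p = e p.1 p.2 := rfl

lemma pairExp_injective {τ : Type*} [Fintype τ] :
    Function.Injective (pairExp : (τ → ι → ℕ) → τ × ι →₀ ℕ) := by
  intro e f h
  ext t i
  simpa using DFunLike.congr_fun h (t, i)

lemma norm_coeff_linSubst_le {τ : Type*} [Fintype τ] (μ : Matrix ι ι ℂ) (B : ℝ)
    (hμ : ∀ i, ∑ j, ‖μ i j‖ ≤ B) (e : τ → ι → ℕ) (f : τ × ι →₀ ℕ) :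
    ‖coeff f (linSubst τ μ (monomial (pairExp e) 1))‖ ≤ B ^ (∑ h, ∑ i, e h i) := by
  refine (norm_coeff_le_wnorm_one _ f).trans ?_
  rw [linSubst, aeval_monomial, map_one, one_mul, Finsupp.prod_fintype _ _ (by simp)]
  refine (wnorm_prod_le (fun _ => zero_le_one) _ _).trans ?_
  rw [← Fintype.sum_prod_type' (f := fun h i => e h i), ← Finset.prod_pow_eq_pow_sum]
  refine Finset.prod_le_prod (fun _ _ => wnorm_nonneg (fun _ => zero_le_one) _) fun p _ => ?_
  refine (wnorm_pow_le (fun _ => zero_le_one) _ _).trans ?_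
  rw [pairExp_apply]
  refine pow_le_pow_left₀ (wnorm_nonneg (fun _ => zero_le_one) _) ?_ _
  refine (wnorm_sum_le (fun _ => zero_le_one) _ _).trans ((Finset.sum_le_sum fun j _ => ?_).trans
    (hμ p.2))
  refine (wnorm_mul_le (fun _ => zero_le_one) _ _).trans ?_
  rw [wnorm_C, wnorm_X, mul_one]

lemma card_piAntidiag_univ_le [DecidableEq ι] (r : ℕ) :
    (Finset.piAntidiag (Finset.univ : Finset ι) r).card ≤ (2 ^ Fintype.card ι) ^ r := by
  calc (Finset.piAntidiag (Finset.univ : Finset ι) r).card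
      ≤ (Fintype.piFinset fun _ : ι => Finset.range (r + 1)).card := by
        refine Finset.card_le_card fun f hf => ?_
        rw [Fintype.mem_piFinset]
        intro i
        rw [Finset.mem_range, Nat.lt_succ_iff, ← (Finset.mem_piAntidiag.mp hf).1]
        exact Finset.single_le_sum (f := f) (fun _ _ => Nat.zero_le _) (Finset.mem_univ i)
    _ = (r + 1) ^ Fintype.card ι := by simp
    _ ≤ (2 ^ r) ^ Fintype.card ι := Nat.pow_le_pow_left (Nat.lt_two_pow_self) _
    _ = _ := by rw [← pow_mul, ← pow_mul, mul_comm]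

lemma card_multidegree_le [DecidableEq ι] {m : ℕ} (r : Fin m → ℕ) :
    (Fintype.piFinset fun h => Finset.piAntidiag (Finset.univ : Finset ι) (r h)).card ≤
      (2 ^ Fintype.card ι) ^ (∑ h, r h) := by
  rw [Fintype.card_piFinset, ← Finset.prod_pow_eq_pow_sum]
  exact Finset.prod_le_prod' fun h _ => card_piAntidiag_univ_le _

theorem exists_aux_polynomial [DecidableEq ι] [Nonempty ι] (E : Type*) [Field E] [NumberField E]
    (μ : Matrix ι ι (NumberField.RingOfIntegers E)) : ∃ B : ℝ, 1 ≤ B ∧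
    ∀ (m : ℕ) (r : Fin m → ℕ) (bad : Finset (Fin m → ι → ℕ)),
      2 * (bad.card * Module.finrank ℚ E) ≤
        (Fintype.piFinset fun h => Finset.piAntidiag (Finset.univ : Finset ι) (r h)).card →
      ∃ F : MvPolynomial (Fin m × ι) ℤ, F ≠ 0 ∧
        (∀ I ∈ F.support, ∀ h, ∑ i, I (h, i) = r h) ∧
        wnorm (fun _ => 1) F ≤ B ^ (∑ h, r h + 1) ∧
        ∀ f ∈ bad, coeff (pairExp f)
          (linSubst (Fin m) μ (map (algebraMap ℤ (NumberField.RingOfIntegers E)) F)) = 0 := by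
  classical
  obtain ⟨c, hc0, hc⟩ := exists_repr_le_house E
  obtain ⟨B0, hB0, hμ⟩ : ∃ B0 : ℝ, 1 ≤ B0 ∧ ∀ (σ : E →+* ℂ) (i : ι),
      ∑ j, ‖σ (algebraMap (NumberField.RingOfIntegers E) E (μ i j))‖ ≤ B0 := by
    refine ⟨1 + ∑ σ : E →+* ℂ, ∑ i, ∑ j,
      ‖σ (algebraMap (NumberField.RingOfIntegers E) E (μ i j))‖, ?_, ?_⟩
    · have : 0 ≤ ∑ σ : E →+* ℂ, ∑ i, ∑ j,
        ‖σ (algebraMap (NumberField.RingOfIntegers E) E (μ i j))‖ := by positivity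
      linarith
    · intro σ i
      have h1 := Finset.single_le_sum (f := fun σ : E →+* ℂ => ∑ i, ∑ j,
        ‖σ (algebraMap (NumberField.RingOfIntegers E) E (μ i j))‖)
        (fun _ _ => by positivity) (Finset.mem_univ σ)
      have h2 := Finset.single_le_sum (f := fun i => ∑ j,
        ‖σ (algebraMap (NumberField.RingOfIntegers E) E (μ i j))‖)
        (fun _ _ => by positivity) (Finset.mem_univ i)
      have h3 := h2.trans h1
      exact h3.trans (by linarith)
  refine ⟨(1 + c) * B0 * (2 ^ Fintype.card ι) ^ 2, ?_, ?_⟩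
  · have h2 : (1 : ℝ) ≤ (2 ^ Fintype.card ι) ^ 2 := one_le_pow₀ (one_le_pow₀ one_le_two)
    have h3 : 1 ≤ (1 + c) * B0 := by nlinarith
    nlinarith
  intro m r bad hcard
  set S := Fintype.piFinset fun h => Finset.piAntidiag (Finset.univ : Finset ι) (r h) with hS
  have hSne : S.Nonempty := Fintype.piFinset_nonempty.mpr fun h => piAntidiag_univ_nonempty _
  have : Nonempty S := hSne.to_subtype
  have hmem : ∀ e ∈ S, ∀ h, ∑ i, e h i = r h := fun e he h =>
    (Finset.mem_piAntidiag.mp (Fintype.mem_piFinset.mp he h)).1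
  let A : Matrix (bad × Module.Free.ChooseBasisIndex ℤ (NumberField.RingOfIntegers E)) S ℤ :=
    Matrix.of fun p e => (NumberField.RingOfIntegers.basis E).repr
      (coeff (pairExp p.1.1) (linSubst (Fin m) μ (monomial (pairExp e.1) 1))) p.2
  have hfr : Fintype.card (Module.Free.ChooseBasisIndex ℤ (NumberField.RingOfIntegers E)) =
      Module.finrank ℚ E := by
    rw [← Module.finrank_eq_card_chooseBasisIndex, NumberField.RingOfIntegers.rank]
  have hAle : ∀ p e, |(A p e : ℝ)| ≤ (1 + c) * B0 ^ (∑ h, r h) := by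
    intro p e
    have h1 := hc (coeff (pairExp p.1.1) (linSubst (Fin m) μ (monomial (pairExp e.1) 1)))
      (B0 ^ (∑ h, r h)) (fun σ => by
        have h2 := norm_coeff_linSubst_le (τ := Fin m)
          (μ.map (σ.comp (algebraMap (NumberField.RingOfIntegers E) E))) B0
          (fun i => by simpa using hμ σ i) e.1 (pairExp p.1.1)
        have h3 : map (σ.comp (algebraMap (NumberField.RingOfIntegers E) E))
            (linSubst (Fin m) μ (monomial (pairExp e.1) 1)) =
            linSubst (Fin m) (μ.map (σ.comp (algebraMap (NumberField.RingOfIntegers E) E)))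
              (monomial (pairExp e.1) 1) := by
          rw [map_linSubst, map_monomial, map_one]
        rw [← h3, coeff_map, Finset.sum_congr rfl fun h _ => hmem e.1 e.2 h] at h2
        exact h2) p.2
    have : c * B0 ^ (∑ h, r h) ≤ (1 + c) * B0 ^ (∑ h, r h) := by gcongr; linarith
    exact h1.trans this
  have hP : 1 ≤ B0 ^ (∑ h, r h) := one_le_pow₀ hB0
  obtain ⟨t, ht, hAt, htn⟩ := exists_int_vec_le A (by
    rw [Fintype.card_prod, hfr, Fintype.card_coe, Fintype.card_coe]; exact hcard)
    ((1 + c) * B0 ^ (∑ h, r h)) (by nlinarith) hAle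
  let F : MvPolynomial (Fin m × ι) ℤ := ∑ e : S, monomial (pairExp e.1) (t e)
  have hFc : ∀ e : S, coeff (pairExp e.1) F = t e := by
    intro e
    simp only [F, coeff_sum, coeff_monomial]
    rw [Finset.sum_eq_single e]
    · simp
    · intro e' _ hne; rw [if_neg]; intro h; exact hne (Subtype.ext (pairExp_injective h))
    · simp
  refine ⟨F, ?_, ?_, ?_, ?_⟩
  · intro h0
    apply ht
    ext e
    rw [← hFc, h0]; simp
  · intro I hI h
    have h1 := mem_support_iff.mp hI
    simp only [F, coeff_sum, coeff_monomial] at h1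
    obtain ⟨e, _, he⟩ := Finset.exists_ne_zero_of_sum_ne_zero h1
    have h2 : pairExp e.1 = I := by by_contra h3; rw [if_neg h3] at he; exact he rfl
    rw [← h2]
    simpa using hmem e.1 e.2 h
  · set Q : ℝ := (2 ^ Fintype.card ι) ^ (∑ h, r h) with hQ
    have hcS : ((Fintype.card S : ℕ) : ℝ) ≤ Q := by
      rw [Fintype.card_coe, hQ]; exact_mod_cast card_multidegree_le r
    have hQ0 : 0 ≤ Q := by positivity
    calc wnorm (fun _ => 1) F ≤ ∑ e : S, wnorm (fun _ => 1) (monomial (pairExp e.1) (t e)) :=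
          wnorm_sum_le (fun _ => zero_le_one) _ _
      _ ≤ ∑ _e : S, (Fintype.card S : ℝ) * ((1 + c) * B0 ^ (∑ h, r h)) := by
          refine Finset.sum_le_sum fun e _ => ?_
          rw [wnorm_monomial]
          simpa [Int.norm_eq_abs, Finsupp.prod] using htn e
      _ = (Fintype.card S : ℝ) * ((Fintype.card S : ℝ) * ((1 + c) * B0 ^ (∑ h, r h))) := by
          simp
      _ ≤ Q * (Q * ((1 + c) * B0 ^ (∑ h, r h))) := by gcongr
      _ = (1 + c) * (B0 * (2 ^ Fintype.card ι) ^ 2) ^ (∑ h, r h) := by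
          rw [hQ, mul_pow, ← pow_mul, ← pow_mul]; ring
      _ ≤ (1 + c) ^ (∑ h, r h + 1) * (B0 * (2 ^ Fintype.card ι) ^ 2) ^ (∑ h, r h + 1) := by
          have h1 : (1 : ℝ) ≤ B0 * (2 ^ Fintype.card ι) ^ 2 := by
            have h2 : (1 : ℝ) ≤ (2 ^ Fintype.card ι) ^ 2 := one_le_pow₀ (one_le_pow₀ one_le_two)
            nlinarith
          refine mul_le_mul ?_ (pow_le_pow_right₀ h1 (Nat.le_succ _)) (by positivity)
            (by positivity)
          exact le_self_pow₀ (by linarith) (Nat.succ_ne_zero _)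
      _ = _ := by rw [← mul_pow]; ring
  · intro f hf
    apply (NumberField.RingOfIntegers.basis E).repr.injective
    ext s
    have h1 := congrFun hAt (⟨f, hf⟩, s)
    rw [map_zero, Finsupp.zero_apply]
    have h2 : coeff (pairExp f)
        (linSubst (Fin m) μ (map (algebraMap ℤ (NumberField.RingOfIntegers E)) F)) =
        ∑ e : S, t e • coeff (pairExp f) (linSubst (Fin m) μ (monomial (pairExp e.1) 1)) := by
      simp only [F, map_sum, coeff_sum, map_monomial]
      refine Finset.sum_congr rfl fun e _ => ?_
      have : (monomial (pairExp e.1) (algebraMap ℤ (NumberField.RingOfIntegers E) (t e)) :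
          MvPolynomial (Fin m × ι) (NumberField.RingOfIntegers E)) =
          (t e) • monomial (pairExp e.1) 1 := by
        rw [smul_monomial]; congr 1; simp
      rw [this, map_zsmul, coeff_smul]
    rw [h2, map_sum, Finsupp.finsetSum_apply]
    simp only [map_zsmul, Finsupp.smul_apply]
    rw [Pi.zero_apply, Matrix.mulVec, dotProduct] at h1
    rw [← h1]
    refine Finset.sum_congr rfl fun e _ => ?_
    simp [A, mul_comm]

end AuxiliaryPolynomial

section AuxiliaryReal
variable {ι : Type*} [Fintype ι] {R : Type*} [CommRing R]

lemma wnorm_aeval_le {σ τ R : Type*} [NormedCommRing R] [NormOneClass R] (w : τ → ℝ)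
    (hw : ∀ i, 0 ≤ w i) (g : σ → MvPolynomial τ R) (F : MvPolynomial σ R) :
    wnorm w (aeval g F) ≤ wnorm (fun i => wnorm w (g i)) F := by
  conv_lhs => rw [F.as_sum, map_sum]
  refine (wnorm_sum_le hw _ _).trans (Finset.sum_le_sum fun I _ => ?_)
  rw [aeval_monomial, algebraMap_eq]
  refine (wnorm_mul_le hw _ _).trans ?_
  rw [wnorm_C]
  refine mul_le_mul_of_nonneg_left ?_ (norm_nonneg _)
  refine (wnorm_prod_le hw _ _).trans ?_
  exact Finset.prod_le_prod (fun _ _ => wnorm_nonneg hw _) fun i _ => wnorm_pow_le hw _ _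

lemma linSubst_linSubst {τ : Type*} (μ ν : Matrix ι ι R) (f : MvPolynomial (τ × ι) R) :
    linSubst τ ν (linSubst τ μ f) = linSubst τ (μ * ν) f := by
  have : (linSubst τ ν).comp (linSubst τ μ) = linSubst τ (μ * ν) := by
    apply MvPolynomial.algHom_ext
    intro p
    simp only [linSubst, AlgHom.comp_apply, aeval_X, map_sum, map_mul, algHom_C, algebraMap_eq,
      Matrix.mul_apply, Finset.mul_sum, Finset.sum_mul, ← mul_assoc]
    exact Finset.sum_comm
  exact DFunLike.congr_fun this f

lemma linSubst_one [DecidableEq ι] {τ : Type*} (f : MvPolynomial (τ × ι) R) :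
    linSubst τ 1 f = f := by
  have : linSubst τ (1 : Matrix ι ι R) = AlgHom.id R _ := by
    apply MvPolynomial.algHom_ext
    intro p
    simp [linSubst, Matrix.one_apply]
  rw [this]; rfl

lemma coeff_linSubst_smul_one [DecidableEq ι] {τ : Type*} (q : R) (f : MvPolynomial (τ × ι) R)
    (I : τ × ι →₀ ℕ) :
    coeff I (linSubst τ (q • (1 : Matrix ι ι R)) f) = q ^ I.degree * coeff I f := by
  classical
  have hX : (fun p : τ × ι => ∑ j, C ((q • (1 : Matrix ι ι R)) p.2 j) * X (p.1, j)) =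
      fun p => C q * X p := by
    ext1 p
    rw [Finset.sum_eq_single p.2]
    · simp
    · intro j _ hj
      simp [Matrix.one_apply_ne hj.symm]
    · simp
  induction f using MvPolynomial.induction_on' with
  | add p q hp hq => rw [map_add, coeff_add, hp, hq, coeff_add, mul_add]
  | monomial J a =>
    have : linSubst τ (q • (1 : Matrix ι ι R)) (monomial J a) = monomial J (q ^ J.degree * a) := by
      rw [linSubst, hX, aeval_monomial, algebraMap_eq]
      simp only [mul_pow, Finsupp.prod_mul]
      have hJ : q ^ J.degree = ∏ i ∈ J.support, q ^ J i :=
        (Finset.prod_pow_eq_pow_sum _ _ _).symm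
      rw [monomial_eq (s := J), C_mul, hJ, map_prod]
      simp only [Finsupp.prod, map_pow]
      ring
    rw [this, coeff_monomial, coeff_monomial]
    split_ifs with h
    · rw [h]
    · simp

lemma coeff_linSubst_smul [DecidableEq ι] {τ : Type*} (q : R) (μ : Matrix ι ι R)
    (f : MvPolynomial (τ × ι) R) (I : τ × ι →₀ ℕ) :
    coeff I (linSubst τ (q • μ) f) = q ^ I.degree * coeff I (linSubst τ μ f) := by
  rw [← coeff_linSubst_smul_one, linSubst_linSubst]
  simp

lemma isWeightedHomogeneous_linSubst {τ : Type*} (w : τ → ℕ) (μ : Matrix ι ι R)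
    (f : MvPolynomial (τ × ι) R) (n : ℕ)
    (hf : IsWeightedHomogeneous (fun p : τ × ι => w p.1) f n) :
    IsWeightedHomogeneous (fun p : τ × ι => w p.1) (linSubst τ μ f) n := by
  rw [f.as_sum, map_sum]
  refine IsWeightedHomogeneous.sum _ _ _ fun I hI => ?_
  rw [linSubst, aeval_monomial, algebraMap_eq]
  have h1 : Finsupp.weight (fun p : τ × ι => w p.1) I = n := hf (mem_support_iff.mp hI)
  rw [← h1, Finsupp.weight_apply, ← zero_add (Finsupp.sum _ _)]
  refine (isWeightedHomogeneous_C _ _).mul ?_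
  refine IsWeightedHomogeneous.prod _ _ _ fun p _ => ?_
  refine IsWeightedHomogeneous.pow ?_ _
  refine IsWeightedHomogeneous.sum _ _ _ fun j _ => ?_
  have := (isWeightedHomogeneous_C (R := R) (fun p : τ × ι => w p.1) (μ p.2 j)).mul
    (isWeightedHomogeneous_X R (fun p : τ × ι => w p.1) (p.1, j))
  simpa using this

/-- Multihomogeneity of degree `r` in the blocks of variables. -/
def MultiHom {τ : Type*} (r : τ → ℕ) (f : MvPolynomial (τ × ι) R) : Prop :=
  ∀ I ∈ f.support, ∀ h, ∑ i, I (h, i) = r h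

lemma weight_block [DecidableEq ι] {τ : Type*} [Fintype τ] [DecidableEq τ] (h : τ)
    (I : τ × ι →₀ ℕ) :
    Finsupp.weight (fun p : τ × ι => if p.1 = h then 1 else 0) I = ∑ i, I (h, i) := by
  rw [Finsupp.weight_apply, Finsupp.sum_fintype _ _ (by simp), Fintype.sum_prod_type]
  simp [Finset.sum_ite_irrel]

lemma MultiHom.linSubst {τ : Type*} [Fintype τ] {r : τ → ℕ} {f : MvPolynomial (τ × ι) R}
    (hf : MultiHom r f) (μ : Matrix ι ι R) : MultiHom r (linSubst τ μ f) := by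
  classical
  intro I hI h
  have h1 : IsWeightedHomogeneous (fun p : τ × ι => if p.1 = h then 1 else 0) f (r h) := by
    intro J hJ
    rw [weight_block, hf J (mem_support_iff.mpr hJ) h]
  have h2 := isWeightedHomogeneous_linSubst (fun t => if t = h then 1 else 0) μ f (r h) h1
  rw [← weight_block]
  exact h2 (mem_support_iff.mp hI)

lemma MultiHom.wnorm_le {τ : Type*} [Fintype τ] {R : Type*} [NormedCommRing R]
    {r : τ → ℕ} {f : MvPolynomial (τ × ι) R}
    (hf : MultiHom r f) {w : τ × ι → ℝ} {B : ℝ} (hw0 : ∀ p, 0 ≤ w p) (hw : ∀ p, w p ≤ B) :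
    wnorm w f ≤ B ^ (∑ h, r h) * wnorm (fun _ => 1) f := by
  rw [wnorm, wnorm, Finset.mul_sum]
  refine Finset.sum_le_sum fun I hI => ?_
  rw [mul_comm (B ^ _), mul_assoc]
  refine mul_le_mul_of_nonneg_left ?_ (norm_nonneg _)
  simp only [one_pow, Finsupp.prod, Finset.prod_const_one, one_mul]
  have h1 : ∑ p ∈ I.support, I p = ∑ h, r h := by
    have : ∑ p ∈ I.support, I p = ∑ p, I p :=
      Finset.sum_subset (Finset.subset_univ _) (by simp)
    rw [this, Fintype.sum_prod_type]
    exact Finset.sum_congr rfl fun h _ => hf I hI h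
  rw [← h1, ← Finset.prod_pow_eq_pow_sum]
  exact Finset.prod_le_prod (fun p _ => pow_nonneg (hw0 p) _)
    fun p _ => pow_le_pow_left₀ (hw0 p) (hw p) _

theorem exists_aux_real [DecidableEq ι] [Nonempty ι] (ℓ : Matrix ι ι ℝ)
    (halg : ∀ i j, IsAlgebraic ℚ (ℓ i j)) (hdet : ℓ.det ≠ 0) (b : ι → ℝ) (κ : ℝ) (hκ : 0 < κ)
    (hb : ∑ i, b i = -(2 * κ * Fintype.card ι)) :
    ∃ (m : ℕ) (B : ℝ), 0 < m ∧ 1 ≤ B ∧ ∀ r : Fin m → ℕ, (∀ h, 0 < r h) →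
      ∃ (F : MvPolynomial (Fin m × ι) ℤ) (P : MvPolynomial (Fin m × ι) ℝ), F ≠ 0 ∧
        MultiHom r F ∧ wnorm (fun _ => 1) F ≤ B ^ (∑ h, r h + 1) ∧
        map (Int.castRingHom ℝ) F = linSubst (Fin m) ℓ P ∧ MultiHom r P ∧
        wnorm (fun _ => 1) P ≤ B ^ (∑ h, r h + 1) ∧
        ∀ f ∈ P.support, ∑ h, ∑ i, b i * f (h, i) / r h ≤ -(m * κ) := by
  classical
  set A : Set ℝ := Set.range fun p : ι × ι => ℓ p.1 p.2 with hA
  let E : IntermediateField ℚ ℝ := IntermediateField.adjoin ℚ A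
  have : FiniteDimensional ℚ E := IntermediateField.finiteDimensional_adjoin (by
    rintro x ⟨p, rfl⟩
    exact (halg p.1 p.2).isIntegral)
  have : NumberField E := ⟨⟩
  let ℓE : Matrix ι ι E := Matrix.of fun i j =>
    ⟨ℓ i j, IntermediateField.subset_adjoin ℚ A ⟨(i, j), rfl⟩⟩
  have hℓE : ℓE.map (algebraMap E ℝ) = ℓ := by ext i j; rfl
  have hdetE : ℓE.det ≠ 0 := by
    intro h
    apply hdet
    rw [← hℓE, ← RingHom.mapMatrix_apply, ← RingHom.map_det, h, map_zero]
  obtain ⟨q, hq⟩ := IsLocalization.exist_integer_multiples_of_finite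
    (nonZeroDivisors (NumberField.RingOfIntegers E)) (fun p : ι × ι => ℓE⁻¹ p.1 p.2)
  choose μ' hμ' using hq
  let μ : Matrix ι ι (NumberField.RingOfIntegers E) := Matrix.of fun i j => μ' (i, j)
  obtain ⟨B1, hB1, haux⟩ := exists_aux_polynomial E μ
  obtain ⟨ρ, hρ0, hρ1, hbad⟩ := card_bad_le b κ hκ hb
  set D := Module.finrank ℚ E with hD
  have hDpos : (0 : ℝ) < D := by exact_mod_cast Module.finrank_pos
  obtain ⟨m, hm⟩ : ∃ m : ℕ, ρ ^ m < 1 / (2 * D) :=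
    exists_pow_lt_of_lt_one (by positivity) hρ1
  obtain ⟨B2, hB2, hμB⟩ : ∃ B2 : ℝ, 1 ≤ B2 ∧ ∀ i, ∑ j, ‖ℓ⁻¹ i j‖ ≤ B2 := by
    refine ⟨1 + ∑ i, ∑ j, ‖ℓ⁻¹ i j‖, ?_, fun i => ?_⟩
    · have : 0 ≤ ∑ i, ∑ j, ‖ℓ⁻¹ i j‖ := by positivity
      linarith
    · have := Finset.single_le_sum (f := fun i => ∑ j, ‖ℓ⁻¹ i j‖)
        (fun _ _ => by positivity) (Finset.mem_univ i)
      exact this.trans (by linarith)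
  refine ⟨m + 1, B2 * B1, Nat.succ_pos m, by nlinarith, ?_⟩
  intro r hr
  have hcard := hbad (m + 1) r hr
  set S := Fintype.piFinset fun h => Finset.piAntidiag (Finset.univ : Finset ι) (r h) with hS
  set bad := S.filter fun e => -(((m + 1 : ℕ) : ℝ) * κ) < ∑ h, ∑ i, b i * e h i / r h with hbaddef
  obtain ⟨F, hF0, hFhom, hFn, hFbad⟩ := haux (m + 1) r bad (by
    have h1 : ρ ^ (m + 1) ≤ 1 / (2 * D) := by
      rw [pow_succ]
      nlinarith [pow_nonneg hρ0 m]
    have h2 : (bad.card : ℝ) ≤ 1 / (2 * D) * S.card :=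
      hcard.trans (mul_le_mul_of_nonneg_right h1 (Nat.cast_nonneg _))
    have h3 : 2 * ((bad.card : ℝ) * D) ≤ S.card := by
      have := mul_le_mul_of_nonneg_right h2 (by positivity : (0 : ℝ) ≤ 2 * D)
      have h4 : 1 / (2 * (D : ℝ)) * S.card * (2 * D) = S.card := by field_simp
      linarith
    exact_mod_cast h3)
  have hFℝ : MultiHom r (map (Int.castRingHom ℝ) F) := fun I hI h =>
    hFhom I (support_map_subset _ _ hI) h
  refine ⟨F, linSubst _ ℓ⁻¹ (map (Int.castRingHom ℝ) F), hF0, hFhom, ?_, ?_, hFℝ.linSubst _, ?_, ?_⟩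
  · refine hFn.trans (pow_le_pow_left₀ (by linarith) ?_ _)
    nlinarith
  · rw [linSubst_linSubst, Matrix.nonsing_inv_mul _ (Ne.isUnit hdet), linSubst_one]
  · rw [linSubst]
    refine (wnorm_aeval_le _ (fun _ => zero_le_one) _ _).trans ?_
    refine (hFℝ.wnorm_le (B := B2) (fun _ => wnorm_nonneg (fun _ => zero_le_one) _)
      (fun p => ?_)).trans ?_
    · refine (wnorm_sum_le (fun _ => zero_le_one) _ _).trans
        ((Finset.sum_le_sum fun j _ => ?_).trans (hμB p.2))
      refine (wnorm_mul_le (fun _ => zero_le_one) _ _).trans ?_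
      rw [wnorm_C, wnorm_X, mul_one]
    · have h1 : wnorm (fun _ => 1) (map (Int.castRingHom ℝ) F) ≤ wnorm (fun _ => 1) F := by
        rw [wnorm_eq_of_subset _ _ (support_map_subset (Int.castRingHom ℝ) F), wnorm]
        refine Finset.sum_le_sum fun I _ => ?_
        rw [coeff_map]
        simp [Int.norm_eq_abs]
      rw [mul_pow]
      refine mul_le_mul (pow_le_pow_right₀ hB2 (Nat.le_succ _)) (h1.trans hFn)
        (wnorm_nonneg (fun _ => zero_le_one) _) (by positivity)
  · intro f hf
    by_contra hlt
    push Not at hlt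
    have hfhom := (hFℝ.linSubst ℓ⁻¹) f hf
    set e : Fin (m + 1) → ι → ℕ := fun h i => f (h, i) with he
    have hfe : pairExp e = f := by ext p; rfl
    have hemem : e ∈ bad := by
      rw [hbaddef, Finset.mem_filter]
      refine ⟨?_, hlt⟩
      rw [hS, Fintype.mem_piFinset]
      intro h
      rw [Finset.mem_piAntidiag]
      exact ⟨hfhom h, by simp⟩
    have h0 := hFbad e hemem
    rw [hfe] at h0
    let g : NumberField.RingOfIntegers E →+* ℝ :=
      (algebraMap E ℝ).comp (algebraMap (NumberField.RingOfIntegers E) E)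
    have hg : Function.Injective g :=
      (algebraMap E ℝ).injective.comp (FaithfulSMul.algebraMap_injective _ _)
    have h1 := congrArg g h0
    rw [← coeff_map, map_linSubst, MvPolynomial.map_map, map_zero] at h1
    have h2 : μ.map g = g q • ℓ⁻¹ := by
      have h3 : ℓ⁻¹ = (ℓE⁻¹).map (algebraMap E ℝ) := by
        rw [← hℓE]
        refine Matrix.inv_eq_left_inv ?_
        rw [← Matrix.map_mul, Matrix.nonsing_inv_mul _ (Ne.isUnit hdetE)]
        exact Matrix.map_one _ (map_zero _) (map_one _)
      rw [h3]
      ext i j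
      have h4 := hμ' (i, j)
      simp only [Matrix.map_apply, Matrix.smul_apply, smul_eq_mul, μ, Matrix.of_apply]
      change algebraMap E ℝ (algebraMap (NumberField.RingOfIntegers E) E (μ' (i, j))) = _
      rw [h4, Algebra.smul_def, map_mul]
      rfl
    rw [h2, coeff_linSubst_smul] at h1
    have h5 : g (q : NumberField.RingOfIntegers E) ≠ 0 := by
      rw [Ne, map_eq_zero_iff g hg]
      exact nonZeroDivisors.ne_zero q.2
    have h6 : g.comp (algebraMap ℤ (NumberField.RingOfIntegers E)) = Int.castRingHom ℝ :=
      RingHom.ext_int _ _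
    rw [h6] at h1
    exact mem_support_iff.mp hf ((mul_eq_zero.mp h1).resolve_left (pow_ne_zero _ h5))

end AuxiliaryReal

section Specialize
variable {τ ι γ : Type*} [Fintype τ] [Fintype ι] [Fintype γ] [DecidableEq ι]

/-- The substitution `X^{(h)} = u_h e_a + ∑ j, c_{h,j} g_j^{(h)}`. -/
noncomputable def pointSubst {R : Type*} [CommRing R] (a : ι) (g : τ → γ → ι → R) (p : τ × ι) :
    MvPolynomial (τ × Option γ) R :=
  (if p.2 = a then X (p.1, none) else 0) + ∑ j, C (g p.1 j p.2) * X (p.1, some j)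

/-- The exponents of the variables different from the `a`-th and the `b`-th one. -/
noncomputable def otherExp (a b : ι) (I : τ × ι →₀ ℕ) : τ × ι →₀ ℕ :=
  I.filter fun p => p.2 ≠ a ∧ p.2 ≠ b

/-- The exponents of the `a`-th variables. -/
noncomputable def mainExp (a : ι) (I : τ × ι →₀ ℕ) : τ →₀ ℕ :=
  Finsupp.equivFunOnFinite.symm fun h => I (h, a)

lemma mainExp_injOn {a b : ι} (hab : a ≠ b) {r : τ → ℕ} {F : MvPolynomial (τ × ι) ℤ}
    (hF : MultiHom r F) {I J : τ × ι →₀ ℕ} (hI : I ∈ F.support) (hJ : J ∈ F.support)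
    (ho : otherExp a b I = otherExp a b J) (hm : mainExp a I = mainExp a J) : I = J := by
  have h1 : ∀ h, I (h, a) = J (h, a) := fun h => by
    have := DFunLike.congr_fun hm h
    simpa [mainExp] using this
  have h2 : ∀ h i, i ≠ a → i ≠ b → I (h, i) = J (h, i) := fun h i hia hib => by
    have := DFunLike.congr_fun ho (h, i)
    simpa [otherExp, hia, hib] using this
  ext ⟨h, i⟩
  by_cases hib : i = b
  · subst hib
    have e1 := hF I hI h
    have e2 := hF J hJ h
    rw [← Finset.add_sum_erase _ _ (Finset.mem_univ i)] at e1 e2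
    have : ∑ x ∈ Finset.univ.erase i, I (h, x) = ∑ x ∈ Finset.univ.erase i, J (h, x) := by
      refine Finset.sum_congr rfl fun x hx => ?_
      by_cases hxa : x = a
      · rw [hxa, h1]
      · exact h2 h x hxa (Finset.ne_of_mem_erase hx)
    omega
  · by_cases hia : i = a
    · rw [hia, h1]
    · exact h2 h i hia hib

set_option maxHeartbeats 1000000 in
theorem index_of_vanishing (r : τ → ℕ) {F : MvPolynomial (τ × ι) ℤ} (hF0 : F ≠ 0)
    (hF : MultiHom r F) {a b : ι} (hab : a ≠ b) (g : τ → γ → ι → ℤ) (t : τ → ι → ℚ)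
    (hspan : ∀ h i, i ≠ a → ∃ s : γ → ℚ, ∀ k, ((if k = i then 1 else 0) -
      (if k = a then t h i else 0) : ℚ) = ∑ j, s j * g h j k) (ε : ℝ) (w : τ → ℝ)
    (hvan : ∀ I : τ × Option γ →₀ ℕ, coeff I (aeval (pointSubst a g) F) ≠ 0 →
      ε ≤ ∑ h, (I (h, none) : ℝ) * w h) :
    ∃ G : MvPolynomial τ ℤ, G ≠ 0 ∧ (∀ h, degreeOf h G ≤ r h) ∧
      wnorm (fun _ => 1) G ≤ wnorm (fun _ => 1) F ∧
      IndexGE w ε (transl (fun h => -t h b) (map (Int.castRingHom ℚ) G)) := by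
  classical
  have hba : b ≠ a := hab.symm
  choose! s hs using hspan
  obtain ⟨I₀, hI₀, hmin⟩ := Finset.exists_min_image F.support
    (fun I => (otherExp a b I).degree) (support_nonempty.mpr hF0)
  set b' := otherExp a b I₀ with hb'
  set T := F.support.filter fun I => otherExp a b I = b' with hT
  set G : MvPolynomial τ ℤ := ∑ I ∈ T, monomial (mainExp a I) (coeff I F) with hG
  -- the two substitutions
  let yv : τ × ι → MvPolynomial (τ × ι) (MvPolynomial τ ℚ) := fun p =>
    if p.2 = b then 1 else X p
  let Q : τ → MvPolynomial (τ × ι) (MvPolynomial τ ℚ) := fun h =>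
    C (X h) + ∑ i ∈ Finset.univ.erase a, C (C (-t h i)) * yv (h, i)
  let φ : τ × ι → MvPolynomial (τ × ι) (MvPolynomial τ ℚ) := fun p =>
    if p.2 = a then Q p.1 else yv p
  let ψ : τ × Option γ → MvPolynomial (τ × ι) (MvPolynomial τ ℚ) := fun p =>
    p.2.elim (C (X p.1)) fun j => ∑ i ∈ Finset.univ.erase a, C (C (s p.1 i j)) * yv (p.1, i)
  let Φ := eval₂Hom (Int.castRingHom _) φ
  let Ψ := eval₂Hom (Int.castRingHom _) ψ
  have hcomp : Ψ.comp (aeval (pointSubst a g) : _ →ₐ[ℤ] _).toRingHom = Φ := by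
    apply MvPolynomial.ringHom_ext
    · intro n; simp
    · rintro ⟨h, k⟩
      have e1 : ∀ j, (C (C ((g h j k : ℚ))) : MvPolynomial (τ × ι) (MvPolynomial τ ℚ)) =
          (g h j k : MvPolynomial (τ × ι) (MvPolynomial τ ℚ)) := fun j => by simp
      have e2 : Ψ (pointSubst a g (h, k)) = (if k = a then C (X h) else 0) +
          ∑ i ∈ Finset.univ.erase a, C (C ((if k = i then 1 else 0) -
            (if k = a then t h i else 0))) * yv (h, i) := by
        simp only [pointSubst, map_add, map_sum, map_mul]
        congr 1
        · split_ifs <;> simp [Ψ, ψ]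
        · simp only [Ψ, coe_eval₂Hom, eval₂_C, eval₂_X, ψ, Option.elim, Int.coe_castRingHom]
          simp only [← e1, Finset.mul_sum]
          rw [Finset.sum_comm]
          refine Finset.sum_congr rfl fun i hi => ?_
          rw [hs h i (Finset.ne_of_mem_erase hi) k]
          simp only [map_sum, Finset.sum_mul, map_mul]
          refine Finset.sum_congr rfl fun j _ => by ring
      have e3 : Ψ.comp (aeval (pointSubst a g) : _ →ₐ[ℤ] _).toRingHom (X (h, k)) =
          Ψ (pointSubst a g (h, k)) := by
        simp
      rw [e3, e2]
      simp only [Φ, coe_eval₂Hom, eval₂_X, φ]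
      by_cases hk : k = a
      · subst hk
        simp only [if_true, Q]
        congr 1
        refine Finset.sum_congr rfl fun i hi => ?_
        rw [if_neg (Finset.ne_of_mem_erase hi).symm, zero_sub]
      · simp only [hk, if_false, zero_add, sub_zero]
        rw [Finset.sum_eq_single k]
        · simp
        · intro i _ hi
          simp [hi.symm]
        · intro h'
          exact absurd (Finset.mem_erase.mpr ⟨hk, Finset.mem_univ _⟩) h'
  have hcoef1 : ∀ K, IndexGE w ε (coeff K (Φ F)) := by
    intro K
    have e1 : Φ F = Ψ (aeval (pointSubst a g) F) := by
      rw [← hcomp]; rfl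
    rw [e1, (aeval (pointSubst a g) F).as_sum, map_sum, coeff_sum]
    refine IndexGE.sum _ fun I hI => ?_
    have hI' := hvan I (mem_support_iff.mp hI)
    have e2 : ∃ f : MvPolynomial (τ × ι) ℚ, Ψ (monomial I (coeff I (aeval (pointSubst a g) F))) =
        C (∏ h, X h ^ I (h, none)) * map C f := by
      refine ⟨C ((coeff I (aeval (pointSubst a g) F) : ℤ) : ℚ) * ∏ p : τ × γ,
        (∑ i ∈ Finset.univ.erase a, C (s p.1 i p.2) *
          (if i = b then 1 else X (p.1, i))) ^ I (p.1, some p.2), ?_⟩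
      have e4 : ∀ p : τ × γ, ψ (p.1, some p.2) = map C (∑ i ∈ Finset.univ.erase a,
          C (s p.1 i p.2) * (if i = b then 1 else X (p.1, i)) :
            MvPolynomial (τ × ι) ℚ) := by
        intro p
        simp only [ψ, Option.elim, map_sum, map_mul, map_C, yv]
        refine Finset.sum_congr rfl fun i _ => ?_
        split_ifs <;> simp
      simp only [map_mul, map_prod, map_pow, map_C, ← e4]
      simp only [Ψ, coe_eval₂Hom, eval₂_monomial]
      rw [Finsupp.prod_fintype _ _ (by simp), Fintype.prod_prod_type, Fintype.prod_prod_type]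
      simp only [Fintype.prod_option, Finset.prod_mul_distrib]
      have e6 : ∀ h, ψ (h, none) = C (X h) := fun h => rfl
      simp only [e6]
      have e7 : (Int.castRingHom (MvPolynomial (τ × ι) (MvPolynomial τ ℚ)))
          (coeff I (aeval (pointSubst a g) F)) = C (C ((coeff I (aeval (pointSubst a g) F) : ℤ) : ℚ)) := by
        simp
      rw [e7]
      ring
    obtain ⟨f, hf⟩ := e2
    rw [hf, coeff_C_mul, coeff_map]
    intro J hJ
    have e5 : (∏ h, X h ^ I (h, none) : MvPolynomial τ ℚ) =
        monomial (Finsupp.equivFunOnFinite.symm fun h => I (h, none)) 1 := by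
      rw [monomial_eq, Finsupp.prod_fintype _ _ (by simp)]
      simp
    rw [e5, mul_comm, C_mul_monomial, coeff_monomial] at hJ
    split_ifs at hJ with hJe
    · rw [← hJe]
      simpa using hI'
    · exact absurd rfl hJ
  have hcoef2 : coeff b' (Φ F) = transl (fun h => -t h b) (map (Int.castRingHom ℚ) G) := by
    have key : ∀ I ∈ F.support, coeff b' (Φ (monomial I (coeff I F))) =
        if otherExp a b I = b' then transl (fun h => -t h b) (map (Int.castRingHom ℚ)
          (monomial (mainExp a I) (coeff I F))) else 0 := by
      intro I hI
      have e1 : Φ (monomial I (coeff I F)) = C (C ((coeff I F : ℤ) : ℚ)) *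
          (monomial (otherExp a b I) 1 * ∏ h, Q h ^ I (h, a)) := by
        simp only [Φ, coe_eval₂Hom, eval₂_monomial]
        have e2 : ∀ p : τ × ι, φ p ^ I p = X p ^ (otherExp a b I p) *
            (if p.2 = a then Q p.1 ^ I p else 1) := by
          intro p
          simp only [φ, yv, otherExp, Finsupp.filter_apply]
          by_cases h1 : p.2 = a
          · simp [h1]
          · by_cases h2 : p.2 = b
            · simp [h2, hba]
            · simp [h1, h2]
        have e3 : (Int.castRingHom (MvPolynomial (τ × ι) (MvPolynomial τ ℚ))) (coeff I F) =
            C (C ((coeff I F : ℤ) : ℚ)) := by simp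
        have e4 : (∏ p : τ × ι, if p.2 = a then Q p.1 ^ I p else 1) = ∏ h, Q h ^ I (h, a) := by
          rw [Fintype.prod_prod_type]
          exact Finset.prod_congr rfl fun h _ => by simp
        have e5 : (monomial (otherExp a b I) 1 : MvPolynomial (τ × ι) (MvPolynomial τ ℚ)) =
            ∏ p, X p ^ otherExp a b I p := by
          rw [monomial_eq, Finsupp.prod_fintype _ _ fun _ => pow_zero _, C_1, one_mul]
        rw [Finsupp.prod_fintype _ _ fun _ => pow_zero _, Finset.prod_congr rfl fun p _ => e2 p,
          Finset.prod_mul_distrib, e3, e4, e5]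
      rw [e1, coeff_C_mul, coeff_monomial_mul']
      by_cases hle : otherExp a b I ≤ b'
      · have heq : otherExp a b I = b' := by
          obtain ⟨c, hc⟩ := le_iff_exists_add.mp hle
          have h1 := hmin I hI
          change b'.degree ≤ _ at h1
          rw [hc, map_add] at h1
          have h2 : c.degree = 0 := by omega
          rw [Finsupp.degree_eq_zero_iff] at h2
          rw [hc, h2, add_zero]
        rw [if_pos hle, if_pos heq, heq, tsub_self, ← constantCoeff_eq, map_prod]
        have e3 : ∀ h, constantCoeff (Q h) = X h + C (-t h b) := by
          intro h
          simp only [Q, map_add, constantCoeff_C, map_sum, map_mul]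
          congr 1
          rw [Finset.sum_eq_single b]
          · simp [yv]
          · intro i _ hib
            simp [yv, hib]
          · intro h'
            exact absurd (Finset.mem_erase.mpr ⟨hba, Finset.mem_univ _⟩) h'
        simp only [map_pow, e3, map_monomial, transl, aeval_monomial]
        rw [Finsupp.prod_fintype _ _ (by simp)]
        simp [mainExp, algebraMap_eq]
      · rw [if_neg hle, if_neg (fun h => hle h.le), mul_zero]
    conv_lhs => rw [F.as_sum, map_sum, coeff_sum]
    rw [Finset.sum_congr rfl key, ← Finset.sum_filter, hG, map_sum, map_sum]
  have hGcoef : ∀ I ∈ T, coeff (mainExp a I) G = coeff I F := by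
    intro I hI
    rw [hG, coeff_sum, Finset.sum_eq_single I]
    · simp
    · intro J hJ hJI
      rw [coeff_monomial, if_neg]
      intro hm
      rw [hT, Finset.mem_filter] at hI hJ
      exact hJI (mainExp_injOn hab hF hJ.1 hI.1 (hJ.2.trans hI.2.symm) hm)
    · exact fun h => absurd hI h
  refine ⟨G, ?_, ?_, ?_, hcoef2 ▸ hcoef1 b'⟩
  · intro h0
    have := hGcoef I₀ (by rw [hT, Finset.mem_filter]; exact ⟨hI₀, rfl⟩)
    rw [h0, coeff_zero] at this
    exact mem_support_iff.mp hI₀ this.symm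
  · intro h
    rw [hG]
    refine (degreeOf_sum_le _ _ _).trans (Finset.sup_le fun I hI => ?_)
    rw [hT, Finset.mem_filter] at hI
    rw [degreeOf_monomial_eq _ _ (mem_support_iff.mp hI.1)]
    have := hF I hI.1 h
    rw [← this]
    simp only [mainExp, Finsupp.equivFunOnFinite_symm_apply_apply]
    exact Finset.single_le_sum (f := fun i => I (h, i)) (fun _ _ => Nat.zero_le _)
      (Finset.mem_univ a)
  · rw [hG]
    refine (wnorm_sum_le (fun _ => zero_le_one) _ _).trans ?_
    rw [wnorm, hT]
    refine (Finset.sum_le_sum fun I _ => ?_).trans (Finset.sum_le_sum_of_subset_of_nonneg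
      (Finset.filter_subset _ _) fun I _ _ => ?_)
    · rw [wnorm_monomial]; simp
    · exact mul_nonneg (norm_nonneg _) (weight_nonneg (fun _ => zero_le_one) _)

end Specialize

section Vanishing
variable {ι γ : Type*} [Fintype ι] [Fintype γ] [DecidableEq ι]

lemma prod_exp_pow {σ : Type*} [Fintype σ] (θ : σ → ℝ) (I : σ →₀ ℕ) :
    (I.prod fun i k => Real.exp (θ i) ^ k) = Real.exp (∑ i, (I i : ℝ) * θ i) := by
  rw [Finsupp.prod_fintype _ _ (by simp), Real.exp_sum]
  exact Finset.prod_congr rfl fun i _ => (Real.exp_nat_mul _ _).symm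

lemma map_pointSubst {τ R S : Type*} [CommRing R] [CommRing S] (f : R →+* S) (a : ι)
    (g : τ → γ → ι → R) (p : τ × ι) :
    map f (pointSubst a g p) = pointSubst a (fun h j i => f (g h j i)) p := by
  simp only [pointSubst, map_add, map_sum, map_mul, map_C, map_X]
  split_ifs <;> simp

lemma sum_mul_pointSubst {τ R : Type*} [CommRing R] (a : ι)
    (g : τ → γ → ι → R) (c : ι → R) (h : τ) :
    ∑ i, C (c i) * pointSubst a g (h, i) =
      C (c a) * X (h, none) + ∑ j, C (∑ i, c i * g h j i) * X (h, some j) := by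
  simp only [pointSubst, mul_add, Finset.sum_add_distrib]
  congr 1
  · rw [Finset.sum_eq_single a] <;> simp +contextual
  · simp only [Finset.mul_sum, map_sum, Finset.sum_mul]
    rw [Finset.sum_comm]
    refine Finset.sum_congr rfl fun j _ => Finset.sum_congr rfl fun i _ => ?_
    rw [C_mul, mul_assoc]

theorem vanishing_of_small {m : ℕ} {r : Fin m → ℕ} (hr : ∀ h, 0 < r h)
    {F : MvPolynomial (Fin m × ι) ℤ} {P : MvPolynomial (Fin m × ι) ℝ} {ℓ : Matrix ι ι ℝ}
    (hFP : map (Int.castRingHom ℝ) F = linSubst (Fin m) ℓ P) (hP : MultiHom r P) {E : ℝ}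
    (hPE : wnorm (fun _ => 1) P ≤ Real.exp E) {b : ι → ℝ} {κ : ℝ}
    (hPs : ∀ f ∈ P.support, ∑ h, ∑ i, b i * f (h, i) / r h ≤ -(m * κ))
    (g : Fin m → γ → ι → ℤ) {x : Fin m → ℝ} (hx : ∀ h, 0 < x h)
    (hg : ∀ h j J, |∑ i, ℓ J i * g h j i| ≤ Real.exp (b J * x h)) {A : ℝ}
    (hA : ∀ J, |b J| ≤ A) {D : ℝ} (a : ι)
    (hDa : ∀ J, |ℓ J a| + Fintype.card γ ≤ Real.exp D) {R η ε : ℝ} (hR : 0 < R)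
    (hη1 : η ≤ 1) (hr1 : ∀ h, R ≤ r h * x h) (hr2 : ∀ h, r h * x h ≤ (1 + η) * R)
    (hnum : E + (∑ h, (r h : ℝ)) * D - m * κ * R + m * η * A * R + 2 * A * ε * R < 0)
    (I : Fin m × Option γ →₀ ℕ) (hI : coeff I (aeval (pointSubst a g) F) ≠ 0) :
    ε ≤ ∑ h, (I (h, none) : ℝ) * (1 / r h) := by
  by_contra! hlt
  have hA0 : 0 ≤ A := (abs_nonneg _).trans (hA a)
  have hr' : ∀ h, (0 : ℝ) < r h := fun h => by exact_mod_cast hr h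
  let θ : Fin m × Option γ → ℝ := fun p => p.2.elim (-(A * x p.1)) fun _ => 0
  let w : Fin m × Option γ → ℝ := fun p => Real.exp (θ p)
  have hw : ∀ p, 0 ≤ w p := fun p => (Real.exp_pos _).le
  let gR : Fin m → γ → ι → ℝ := fun h j i => (g h j i : ℝ)
  let ψ : Fin m × ι → MvPolynomial (Fin m × Option γ) ℝ := fun p =>
    ∑ i, C (ℓ p.2 i) * pointSubst a gR (p.1, i)
  have hmap : MvPolynomial.map (Int.castRingHom ℝ) (aeval (pointSubst a g) F) = aeval ψ P := by
    have e1 : MvPolynomial.map (Int.castRingHom ℝ) (aeval (pointSubst a g) F) =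
        aeval (pointSubst a gR) (MvPolynomial.map (Int.castRingHom ℝ) F) := by
      have : (MvPolynomial.map (Int.castRingHom ℝ)).comp (aeval (pointSubst a g) : _ →ₐ[ℤ] _).toRingHom =
          (aeval (pointSubst a gR) : _ →ₐ[ℝ] _).toRingHom.comp (MvPolynomial.map (Int.castRingHom ℝ)) := by
        apply MvPolynomial.ringHom_ext
        · intro n; simp
        · intro p
          simpa [gR] using map_pointSubst (Int.castRingHom ℝ) a g p
      exact DFunLike.congr_fun this F
    have e2 : (aeval (pointSubst a gR)).comp (linSubst (Fin m) ℓ) = aeval ψ := by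
      apply MvPolynomial.algHom_ext
      intro p
      simp only [linSubst, AlgHom.comp_apply, aeval_X, map_sum, map_mul, algHom_C, algebraMap_eq, ψ]
    rw [e1, hFP, ← e2]
    rfl
  have hψ : ∀ p, wnorm w (ψ p) ≤ Real.exp (D + b p.2 * x p.1) := by
    intro p
    simp only [ψ, sum_mul_pointSubst]
    have hb1 : Real.exp (-(A * x p.1)) ≤ Real.exp (b p.2 * x p.1) := by
      apply Real.exp_le_exp.mpr
      nlinarith [neg_le_of_abs_le (hA p.2), hx p.1]
    calc _ ≤ wnorm w (C (ℓ p.2 a) * X (p.1, none)) + ∑ j, wnorm w (C (∑ i, ℓ p.2 i * gR p.1 j i) *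
          X (p.1, some j)) :=
          (wnorm_add_le hw _ _).trans (add_le_add le_rfl (wnorm_sum_le hw _ _))
      _ ≤ |ℓ p.2 a| * Real.exp (b p.2 * x p.1) + ∑ j : γ, Real.exp (b p.2 * x p.1) := by
          gcongr with j
          · refine (wnorm_mul_le hw _ _).trans ?_
            rw [wnorm_C, wnorm_X, Real.norm_eq_abs]
            exact mul_le_mul_of_nonneg_left hb1 (abs_nonneg _)
          · refine (wnorm_mul_le hw _ _).trans ?_
            rw [wnorm_C, wnorm_X, Real.norm_eq_abs]
            have : w (p.1, some j) = 1 := by simp [w, θ]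
            rw [this, mul_one]
            exact hg p.1 j p.2
      _ = (|ℓ p.2 a| + Fintype.card γ) * Real.exp (b p.2 * x p.1) := by
          simp; ring
      _ ≤ Real.exp D * Real.exp (b p.2 * x p.1) := by
          gcongr; exact hDa _
      _ = _ := (Real.exp_add _ _).symm
  have h1 : |((coeff I (aeval (pointSubst a g) F) : ℤ) : ℝ)| * Real.exp (∑ p, (I p : ℝ) * θ p) ≤
      wnorm w (aeval ψ P) := by
    have := norm_coeff_mul_weight_le hw (aeval ψ P) I
    rw [prod_exp_pow, ← hmap, coeff_map] at this
    rw [← hmap]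
    exact this
  have h2 : (1 : ℝ) ≤ |((coeff I (aeval (pointSubst a g) F) : ℤ) : ℝ)| := by
    exact_mod_cast Int.one_le_abs hI
  have h3 : wnorm w (aeval ψ P) ≤
      Real.exp ((∑ h, (r h : ℝ)) * D - m * κ * R + m * η * A * R) * Real.exp E := by
    refine (wnorm_aeval_le w hw ψ P).trans ?_
    refine le_trans ?_ (mul_le_mul_of_nonneg_left hPE (Real.exp_pos _).le)
    rw [wnorm, wnorm, Finset.mul_sum]
    refine Finset.sum_le_sum fun f hf => ?_
    rw [mul_left_comm]
    refine mul_le_mul_of_nonneg_left ?_ (norm_nonneg _)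
    have e1 : (f.prod fun i k => wnorm w (ψ i) ^ k) ≤
        f.prod fun i k => Real.exp (D + b i.2 * x i.1) ^ k :=
      Finset.prod_le_prod (fun i _ => pow_nonneg (wnorm_nonneg hw _) _)
        fun i _ => pow_le_pow_left₀ (wnorm_nonneg hw _) (hψ i) _
    refine e1.trans ?_
    rw [prod_exp_pow]
    simp only [one_pow, Finsupp.prod, Finset.prod_const_one, mul_one]
    apply Real.exp_le_exp.mpr
    have hsum : ∀ h, ∑ i, (f (h, i) : ℝ) = r h := fun h => by exact_mod_cast hP f hf h
    have e2 : ∀ h i, (f (h, i) : ℝ) * (b i * x h) ≤ R * (b i * f (h, i) / r h) +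
        η * R * A * (f (h, i) / r h) := by
      intro h i
      have e3 : (f (h, i) : ℝ) * (b i * x h) = R * (b i * f (h, i) / r h) +
          (r h * x h - R) * (b i * (f (h, i) / r h)) := by
        have := (hr' h).ne'
        field_simp
        ring
      rw [e3]
      have e4 : (r h * x h - R) * (b i * (f (h, i) / r h)) ≤ (η * R) * (A * (f (h, i) / r h)) := by
        have p1 : 0 ≤ (f (h, i) : ℝ) / r h := by positivity
        have p2 : b i * (f (h, i) / r h) ≤ A * (f (h, i) / r h) :=
          mul_le_mul_of_nonneg_right ((le_abs_self _).trans (hA i)) p1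
        have p3 : 0 ≤ r h * x h - R := by linarith [hr1 h]
        have p4 : r h * x h - R ≤ η * R := by linarith [hr2 h]
        exact (mul_le_mul_of_nonneg_left p2 p3).trans
          (mul_le_mul_of_nonneg_right p4 (mul_nonneg hA0 p1))
      linarith
    rw [Fintype.sum_prod_type]
    calc ∑ h, ∑ i, (f (h, i) : ℝ) * (D + b i * x h)
        = ∑ h, ((r h : ℝ) * D + ∑ i, (f (h, i) : ℝ) * (b i * x h)) := by
          refine Finset.sum_congr rfl fun h _ => ?_
          simp only [mul_add, Finset.sum_add_distrib]
          rw [← Finset.sum_mul, hsum]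
      _ ≤ ∑ h, ((r h : ℝ) * D + (R * ∑ i, b i * f (h, i) / r h + η * R * A)) := by
          refine Finset.sum_le_sum fun h _ => add_le_add le_rfl ?_
          refine (Finset.sum_le_sum fun i _ => e2 h i).trans ?_
          rw [Finset.sum_add_distrib, ← Finset.mul_sum, ← Finset.mul_sum,
            ← Finset.sum_div (f := fun i => (f (h, i) : ℝ)), hsum,
            div_self (hr' h).ne', mul_one]
      _ ≤ _ := by
          simp only [Finset.sum_add_distrib, ← Finset.mul_sum, ← Finset.sum_mul]
          have := mul_le_mul_of_nonneg_left (hPs f hf) hR.le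
          simp only [Finset.sum_const, Finset.card_univ, Fintype.card_fin, nsmul_eq_mul]
          nlinarith
  have h4 : -(2 * A * ε * R) ≤ ∑ p, (I p : ℝ) * θ p := by
    rw [Fintype.sum_prod_type]
    simp only [Fintype.sum_option, θ, Option.elim, mul_zero, Finset.sum_const_zero, add_zero]
    have e1 : ∀ h, -((I (h, none) : ℝ) * (1 / r h) * (2 * A * R)) ≤
        (I (h, none) : ℝ) * -(A * x h) := by
      intro h
      have e2 : (I (h, none) : ℝ) * (A * x h) = (I (h, none) : ℝ) * (1 / r h) *
          (A * (r h * x h)) := by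
        have := (hr' h).ne'
        field_simp
      have e3 : r h * x h ≤ 2 * R := (hr2 h).trans (by nlinarith)
      have e4 : A * (r h * x h) ≤ 2 * A * R := by nlinarith
      have e5 : 0 ≤ (I (h, none) : ℝ) * (1 / r h) := by positivity
      nlinarith [mul_le_mul_of_nonneg_left e4 e5]
    refine le_trans ?_ (Finset.sum_le_sum fun h _ => e1 h)
    rw [Finset.sum_neg_distrib, ← Finset.sum_mul]
    have : 0 ≤ 2 * A * R := by positivity
    nlinarith [mul_le_mul_of_nonneg_right hlt.le this]
  have h5 : Real.exp (-(2 * A * ε * R)) ≤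
      Real.exp ((∑ h, (r h : ℝ)) * D - m * κ * R + m * η * A * R) * Real.exp E := by
    refine le_trans ?_ (h1.trans h3)
    refine (Real.exp_le_exp.mpr h4).trans ?_
    exact le_mul_of_one_le_left (Real.exp_pos _).le h2
  rw [← Real.exp_add, Real.exp_le_exp] at h5
  linarith

end Vanishing

lemma exists_rapid_sequence {p : ℝ → Prop} (hp : ∀ X, ∃ x ≥ X, p x) (X₁ c : ℝ) (m : ℕ) :
    ∃ x : Fin m → ℝ, (∀ h, X₁ ≤ x h) ∧ (∀ h, p (x h)) ∧ ∀ i j, i < j → c * x j ≤ x i := by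
  choose f hf hpf using hp
  let y : ℕ → ℝ := fun k => Nat.rec (f X₁) (fun _ z => f (max z (c * z))) k
  have hy1 : ∀ k, y k ≤ y (k + 1) := fun k => (le_max_left _ _).trans (hf _)
  have hy2 : ∀ k, c * y k ≤ y (k + 1) := fun k => (le_max_right _ _).trans (hf _)
  have hmono : Monotone y := monotone_nat_of_le_succ hy1
  have hpy : ∀ k, p (y k) := by
    intro k
    cases k with
    | zero => exact hpf _
    | succ k => exact hpf _
  refine ⟨fun h => y (m - 1 - h), fun h => (hf X₁).trans (hmono (Nat.zero_le _)),
    fun h => hpy _, fun i j hij => ?_⟩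
  have h1 : (i : ℕ) < j := hij
  have h2 : m - 1 - (j : ℕ) + 1 ≤ m - 1 - i := by
    have := j.2
    omega
  exact (hy2 _).trans (hmono h2)

section NoPoints
variable {ι γ : Type*} [Fintype ι] [Fintype γ] [DecidableEq ι]

set_option maxHeartbeats 1000000 in
/-- The penultimate-minimum form of the subspace theorem. -/
theorem subspace_penultimate (ℓ : Matrix ι ι ℝ)
    (halg : ∀ i j, IsAlgebraic ℚ (ℓ i j)) (hdet : ℓ.det ≠ 0) (b : ι → ℝ) (hb : ∑ i, b i < 0)
    (c : ℝ) (hc : 0 < c) (a b₀ : ι) (hab : a ≠ b₀) :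
    ∃ X₀ : ℝ, ∀ x ≥ X₀, ∀ (g : γ → ι → ℤ) (t : ι → ℚ),
      (∀ j J, |∑ i, ℓ J i * g j i| ≤ Real.exp (b J * x)) →
      (∀ i, i ≠ a → ∃ s : γ → ℚ, ∀ k, ((if k = i then 1 else 0) -
        (if k = a then t i else 0) : ℚ) = ∑ j, s j * g j k) →
      Real.log (max |((t b₀).num : ℝ)| ((t b₀).den : ℝ)) < c * x := by
  by_contra! hcon
  have : Nonempty ι := ⟨a⟩
  have hcard : (0 : ℝ) < Fintype.card ι := by exact_mod_cast Fintype.card_pos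
  set κ : ℝ := -(∑ i, b i) / (2 * Fintype.card ι) with hκdef
  have hκ : 0 < κ := div_pos (by linarith) (by positivity)
  obtain ⟨m, B, hm, hB, haux⟩ := exists_aux_real ℓ halg hdet b κ hκ (by
    rw [hκdef]; field_simp)
  have hm1 : (1 : ℝ) ≤ m := by exact_mod_cast hm
  set A : ℝ := ∑ i, |b i| with hA
  have hA0 : 0 ≤ A := Finset.sum_nonneg fun i _ => abs_nonneg _
  have hAb : ∀ J, |b J| ≤ A := fun J =>
    Finset.single_le_sum (f := fun i => |b i|) (fun i _ => abs_nonneg _) (Finset.mem_univ J)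
  set D : ℝ := ∑ J, |ℓ J a| + Fintype.card γ with hD
  have hD0 : 0 ≤ D := by positivity
  have hDa : ∀ J, |ℓ J a| + Fintype.card γ ≤ Real.exp D := by
    intro J
    have h1 : |ℓ J a| ≤ ∑ J, |ℓ J a| :=
      Finset.single_le_sum (f := fun J => |ℓ J a|) (fun i _ => abs_nonneg _) (Finset.mem_univ J)
    have := Real.add_one_le_exp D
    linarith
  set ε : ℝ := min 1 (κ / (8 * (A + 1))) with hε
  have hε0 : 0 < ε := lt_min one_pos (by positivity)
  have hε1 : 2 * A * ε ≤ κ / 4 := by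
    have h1 : ε ≤ κ / (8 * (A + 1)) := min_le_right _ _
    rw [le_div_iff₀ (by positivity)] at h1
    nlinarith
  set η : ℝ := min 1 (κ / (4 * (A + 1))) with hη
  have hη0 : 0 < η := lt_min one_pos (by positivity)
  have hη1 : η * A ≤ κ / 4 := by
    have h1 : η ≤ κ / (4 * (A + 1)) := min_le_right _ _
    rw [le_div_iff₀ (by positivity)] at h1
    nlinarith
  obtain ⟨ω, hω, hroth⟩ := roth_lemma m ε hε0 (min_le_left _ _)
  set l : ℝ := Real.log B with hl
  have hl0 : 0 ≤ l := Real.log_nonneg hB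
  set X₁ : ℝ := 1 + 2 / (ω * c) + 4 * m * l / (ω * c) + 16 * (l + D) / κ with hX₁
  have hX₁1 : 1 ≤ X₁ := by
    have : 0 ≤ 2 / (ω * c) + 4 * m * l / (ω * c) + 16 * (l + D) / κ := by positivity
    linarith
  obtain ⟨x, hx1, hx2, hx3⟩ := exists_rapid_sequence (p := fun x => ∃ (g : γ → ι → ℤ) (t : ι → ℚ),
      (∀ j J, |∑ i, ℓ J i * g j i| ≤ Real.exp (b J * x)) ∧
      (∀ i, i ≠ a → ∃ s : γ → ℚ, ∀ k, ((if k = i then 1 else 0) -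
        (if k = a then t i else 0) : ℚ) = ∑ j, s j * g j k) ∧
      c * x ≤ Real.log (max |((t b₀).num : ℝ)| ((t b₀).den : ℝ))) hcon X₁ (2 / ω) m
  choose g t hg hs ht using hx2
  have hx0 : ∀ h, 0 < x h := fun h => by linarith [hx1 h]
  set R : ℝ := 1 + (∑ h, x h) / η + 2 * l / (ω * c) + 8 * l / κ with hR
  have hsx : 0 ≤ ∑ h, x h := Finset.sum_nonneg fun h _ => (hx0 h).le
  have hR1 : 1 ≤ R := by
    have : 0 ≤ (∑ h, x h) / η + 2 * l / (ω * c) + 8 * l / κ := by positivity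
    linarith
  have hRx : ∀ h, x h ≤ η * R := by
    intro h
    have h1 : x h ≤ ∑ h, x h :=
      Finset.single_le_sum (f := x) (fun i _ => (hx0 i).le) (Finset.mem_univ h)
    have h2 : (∑ h, x h) / η ≤ R := by
      have : 0 ≤ 2 * l / (ω * c) + 8 * l / κ := by positivity
      linarith
    rw [div_le_iff₀ hη0] at h2
    linarith
  have hRl1 : l ≤ ω * c * R / 2 := by
    have h2 : 2 * l / (ω * c) ≤ R := by
      have : 0 ≤ (∑ h, x h) / η + 8 * l / κ := by positivity
      linarith
    rw [div_le_iff₀ (by positivity)] at h2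
    linarith
  have hRl2 : l ≤ κ * R / 8 := by
    have h2 : 8 * l / κ ≤ R := by
      have : 0 ≤ (∑ h, x h) / η + 2 * l / (ω * c) := by positivity
      linarith
    rw [div_le_iff₀ (by positivity)] at h2
    linarith
  set r : Fin m → ℕ := fun h => ⌈R / x h⌉₊ with hr
  have hrpos : ∀ h, 0 < r h := fun h => Nat.ceil_pos.mpr (div_pos (by linarith) (hx0 h))
  have hr1 : ∀ h, R ≤ r h * x h := fun h => by
    rw [← div_le_iff₀ (hx0 h)]; exact Nat.le_ceil _
  have hr2 : ∀ h, r h * x h ≤ (1 + η) * R := fun h => by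
    have h1 : (r h : ℝ) < R / x h + 1 := Nat.ceil_lt_add_one (div_pos (by linarith) (hx0 h)).le
    have h2 := mul_lt_mul_of_pos_right h1 (hx0 h)
    rw [add_mul, div_mul_cancel₀ _ (hx0 h).ne', one_mul] at h2
    linarith [hRx h]
  have hη2 : η ≤ 1 := min_le_left _ _
  have hr3 : ∀ h, r h * x h ≤ 2 * R := fun h => by
    linarith [hr2 h, mul_le_mul_of_nonneg_right hη2 (by linarith : 0 ≤ R)]
  have hr4 : ∀ h, r h * X₁ ≤ 2 * R := fun h =>
    (mul_le_mul_of_nonneg_left (hx1 h) (Nat.cast_nonneg _)).trans (hr3 h)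
  have hsum : (∑ h, (r h : ℝ)) * X₁ ≤ m * (2 * R) := by
    rw [Finset.sum_mul]
    refine (Finset.sum_le_sum fun h _ => hr4 h).trans ?_
    simp
  have hs0 : 0 ≤ ∑ h, (r h : ℝ) := Finset.sum_nonneg fun h _ => Nat.cast_nonneg _
  obtain ⟨F, P, hF0, hFhom, hFn, hFP, hPhom, hPn, hPs⟩ := haux r hrpos
  have hBexp : B ^ (∑ h, r h + 1) = Real.exp ((∑ h, (r h : ℝ) + 1) * l) := by
    rw [mul_comm, hl, ← Real.rpow_def_of_pos (by linarith)]
    rw [← Real.rpow_natCast]; push_cast; rfl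
  rw [hBexp] at hFn hPn
  have hsD : (∑ h, (r h : ℝ)) * (l + D) ≤ m * κ * R / 8 := by
    have h1 : 16 * (l + D) / κ ≤ X₁ := by
      have : 0 ≤ 1 + 2 / (ω * c) + 4 * m * l / (ω * c) := by positivity
      linarith
    rw [div_le_iff₀ hκ] at h1
    have h2 := mul_le_mul_of_nonneg_left h1 hs0
    have h3 := mul_le_mul_of_nonneg_right hsum hκ.le
    linarith
  have hvan := vanishing_of_small hrpos hFP hPhom hPn hPs g hx0 hg hAb a hDa
    (by linarith : 0 < R) hη2 hr1 hr2 (ε := ε) (by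
      have e1 : m * η * A * R ≤ m * R * (κ / 4) := by
        have : 0 ≤ m * R := by positivity
        linarith [mul_le_mul_of_nonneg_left hη1 this]
      have e2 : 2 * A * ε * R ≤ κ / 4 * R := mul_le_mul_of_nonneg_right hε1 (by linarith)
      have e3 : κ * R ≤ m * κ * R := by
        have : 0 ≤ κ * R := by positivity
        linarith [mul_le_mul_of_nonneg_right hm1 this]
      have e4 : 0 < κ * R := by positivity
      linarith)
  obtain ⟨G, hG0, hGdeg, hGn, hGidx⟩ := index_of_vanishing r hF0 hFhom hab g t hs ε
    (fun h => 1 / (r h : ℝ)) hvan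
  have hGpos := wnorm_pos hG0
  refine hroth r (c * R) (fun h => -(t h b₀).num) (fun h => (t h b₀).den) G hrpos ?_
    (by positivity) ?_ ?_ ?_ ?_ hG0 hGdeg ?_ ?_
  · intro i j hij
    have h1 := hx3 i j hij
    rw [div_mul_eq_mul_div, div_le_iff₀ hω] at h1
    have h2 := hr1 j
    have h3 := hr3 i
    have h4 : (r i : ℝ) * x j ≤ ω * r j * x j := by
      have h5 := mul_le_mul_of_nonneg_left h1 (Nat.cast_nonneg (α := ℝ) (r i))
      linarith [mul_le_mul_of_nonneg_left h3 hω.le, mul_le_mul_of_nonneg_left h2 hω.le]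
    exact le_of_mul_le_mul_right h4 (hx0 j)
  · intro h
    have h1 : 2 / (ω * c) ≤ X₁ := by
      have : 0 ≤ 1 + 4 * m * l / (ω * c) + 16 * (l + D) / κ := by positivity
      linarith
    rw [div_le_iff₀ (by positivity)] at h1
    have h2 := hr4 h
    have h3 : (0 : ℝ) ≤ r h := Nat.cast_nonneg _
    have h4 := mul_le_mul_of_nonneg_left h1 h3
    have h5 : 0 < ω * c := by positivity
    linarith [mul_le_mul_of_nonneg_right h2 h5.le]
  · intro h
    rw [IsCoprime.neg_left_iff, Int.isCoprime_iff_gcd_eq_one]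
    exact (t h b₀).reduced
  · intro h
    exact_mod_cast (t h b₀).den_nz
  · intro h
    have h1 := ht h
    have h2 : max |((-(t h b₀).num : ℤ) : ℝ)| |(((t h b₀).den : ℤ) : ℝ)| =
        max |((t h b₀).num : ℝ)| ((t h b₀).den : ℝ) := by
      push_cast
      rw [abs_neg, Nat.abs_cast]
    rw [h2]
    have h3 := mul_le_mul_of_nonneg_left h1 (Nat.cast_nonneg (α := ℝ) (r h))
    have h4 := mul_le_mul_of_nonneg_left (hr1 h) hc.le
    linarith
  · have h1 : Real.log (wnorm (fun _ => 1) G) ≤ (∑ h, (r h : ℝ) + 1) * l := by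
      rw [Real.log_le_iff_le_exp (by linarith)]
      exact hGn.trans hFn
    refine h1.trans ?_
    have h2 : 4 * m * l / (ω * c) ≤ X₁ := by
      have : 0 ≤ 1 + 2 / (ω * c) + 16 * (l + D) / κ := by positivity
      linarith
    rw [div_le_iff₀ (by positivity)] at h2
    have h3 : (∑ h, (r h : ℝ)) * l ≤ ω * c * R / 2 := by
      have h5 := mul_le_mul_of_nonneg_left h2 hs0
      have h6 : 0 < ω * c := by positivity
      have h7 := mul_le_mul_of_nonneg_right hsum h6.le
      have h8 : (0 : ℝ) < m := by linarith
      have h9 : m * ((∑ h, (r h : ℝ)) * l) ≤ m * (ω * c * R / 2) := by linarith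
      exact le_of_mul_le_mul_left h9 h8
    linarith
  · convert hGidx using 3
    ext h
    push_cast
    rw [neg_div, Rat.num_div_den]

end NoPoints

end PolynomialMethod

/-- Minkowski's linear forms theorem with strict inequalities. -/
lemma exists_int_linear_forms_lt {n : ℕ} (A : Matrix (Fin n) (Fin n) ℝ) (hA : A.det ≠ 0)
    {ρ : ℝ} (hρ : 0 < ρ) (h : |A.det| < ρ ^ n) :
    ∃ v : Fin n → ℤ, v ≠ 0 ∧ ∀ i, |∑ k, A i k * v k| < ρ := by
  classical
  let b := Pi.basisFun ℝ (Fin n)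
  let S : Set (Fin n → ℝ) := (Matrix.toLin' A) ⁻¹' (Set.univ.pi fun _ => Set.Ioo (-ρ) ρ)
  have hvol : MeasureTheory.volume S = ENNReal.ofReal (|A.det|⁻¹ * (2 * ρ) ^ n) := by
    have h1 : LinearMap.det (Matrix.toLin' A) ≠ 0 := by rwa [LinearMap.det_toLin']
    rw [MeasureTheory.Measure.addHaar_preimage_linearMap _ h1, Real.volume_pi_Ioo]
    rw [LinearMap.det_toLin', abs_inv, ENNReal.ofReal_mul (by positivity)]
    congr 1
    rw [Finset.prod_const, ENNReal.ofReal_pow (by positivity)]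
    simp [two_mul]
  have hsymm : ∀ x ∈ S, -x ∈ S := by
    intro x hx i hi
    have := hx i hi
    simp only [Set.mem_Ioo, map_neg, Pi.neg_apply] at this ⊢
    constructor <;> linarith [this.1, this.2]
  have hconv : Convex ℝ S :=
    (convex_pi fun i _ => convex_Ioo (-ρ) ρ).linear_preimage _
  have hfund := ZSpan.isAddFundamentalDomain b MeasureTheory.volume
  have hfv : MeasureTheory.volume (ZSpan.fundamentalDomain b) = 1 := by
    have : ZSpan.fundamentalDomain b = Set.univ.pi fun _ => Set.Ico (0 : ℝ) 1 := by
      ext x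
      simp [ZSpan.mem_fundamentalDomain, b, Set.mem_pi]
    rw [this, Real.volume_pi_Ico]
    simp
  have hcount : Countable (Submodule.span ℤ (Set.range b)).toAddSubgroup :=
    inferInstanceAs (Countable (Submodule.span ℤ (Set.range b)))
  obtain ⟨x, hx0, hxS⟩ := MeasureTheory.exists_ne_zero_mem_lattice_of_measure_mul_two_pow_lt_measure
    (L := (Submodule.span ℤ (Set.range b)).toAddSubgroup) (s := S) hfund hsymm hconv (by
      rw [hfv, hvol, one_mul, Module.finrank_fin_fun]
      have h2 : (2 : ENNReal) ^ n = ENNReal.ofReal (2 ^ n) := by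
        rw [ENNReal.ofReal_pow (by norm_num)]; simp
      rw [h2]
      apply (ENNReal.ofReal_lt_ofReal_iff (by positivity)).2
      rw [mul_pow, inv_mul_eq_div, lt_div_iff₀ (abs_pos.2 hA)]
      exact mul_lt_mul_of_pos_left h (by positivity))
  have hmem := (b.mem_span_iff_repr_mem ℤ (x : Fin n → ℝ)).1 x.2
  choose v hv using hmem
  have hv' : ∀ i, ((v i : ℤ) : ℝ) = (x : Fin n → ℝ) i := by
    intro i; simpa [b] using hv i
  refine ⟨v, ?_, ?_⟩
  · rintro rfl
    apply hx0
    ext i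
    simpa using (hv' i).symm
  · intro i
    have := hxS i (Set.mem_univ i)
    rw [abs_lt]
    simp only [hv']
    simpa [Matrix.toLin'_apply, Matrix.mulVec, dotProduct] using this

section Reduction

variable {n : ℕ}

/-- The real span of the images of the first `j` members of a sequence of integer points. -/
def latticeFlag (f : (Fin n → ℤ) →+ (Fin n → ℝ)) (y : ℕ → Fin n → ℤ) (j : ℕ) :
    Submodule ℝ (Fin n → ℝ) :=
  Submodule.span ℝ ((fun i => f (y i)) '' Set.Iio j)

/-- The first `m` members of `y` realise the successive minima `lam` up to the constant `C`, and
the coordinates `π` are adapted to them in the sense of Davenport. -/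
structure IsReducedSystem (f : (Fin n → ℤ) →+ (Fin n → ℝ)) (m : ℕ) (C : ℝ)
    (y : ℕ → Fin n → ℤ) (π : ℕ → Fin n) (lam : ℕ → ℝ) : Prop where
  minimal : ∀ j < m, ∀ v, f v ∉ latticeFlag f y j → lam j ≤ ‖f v‖
  bound : ∀ l < m, ∀ j < m, |f (y j) (π l)| ≤ C * min (lam l) (lam j)
  mono : ∀ i j, i ≤ j → j < m → lam i ≤ lam j
  pos : ∀ j < m, 0 < lam j
  dominated : ∀ j ≤ m, ∀ s ∈ latticeFlag f y j, ∀ T, 0 ≤ T → (∀ l < j, |s (π l)| ≤ T) →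
    ‖s‖ ≤ 3 ^ j * T
  interp : ∀ t : ℕ → ℝ, ∃ c : ℕ → ℝ, ∀ l < m, (∑ i ∈ Finset.range m, c i • f (y i)) (π l) = t l
  inj : Set.InjOn π (Set.Iio m)

lemma latticeFlag_succ (f : (Fin n → ℤ) →+ (Fin n → ℝ)) (y : ℕ → Fin n → ℤ) (j : ℕ) :
    latticeFlag f y (j + 1) = Submodule.span ℝ {f (y j)} ⊔ latticeFlag f y j := by
  have : Set.Iio (j + 1) = insert j (Set.Iio j) := by
    ext i; simp only [Set.mem_Iio, Set.mem_insert_iff]; omega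
  rw [latticeFlag, this, Set.image_insert_eq, Submodule.span_insert, latticeFlag]

lemma latticeFlag_mono (f : (Fin n → ℤ) →+ (Fin n → ℝ)) (y : ℕ → Fin n → ℤ) {i j : ℕ}
    (h : i ≤ j) : latticeFlag f y i ≤ latticeFlag f y j :=
  Submodule.span_mono (Set.image_mono (Set.Iio_subset_Iio h))

lemma latticeFlag_congr (f : (Fin n → ℤ) →+ (Fin n → ℝ)) {y y' : ℕ → Fin n → ℤ} {j : ℕ}
    (h : ∀ i < j, y i = y' i) : latticeFlag f y j = latticeFlag f y' j := by
  unfold latticeFlag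
  congr 1
  exact Set.image_congr fun i hi => by simp only [h i hi]

lemma sum_smul_mem_latticeFlag (f : (Fin n → ℤ) →+ (Fin n → ℝ)) (y : ℕ → Fin n → ℤ) (j : ℕ)
    (c : ℕ → ℝ) : ∑ i ∈ Finset.range j, c i • f (y i) ∈ latticeFlag f y j :=
  Submodule.sum_mem _ fun i hi => Submodule.smul_mem _ _
    (Submodule.subset_span ⟨i, Finset.mem_range.1 hi, rfl⟩)

lemma IsReducedSystem.latticeFlag_ne_top {f : (Fin n → ℤ) →+ (Fin n → ℝ)} {m : ℕ} {C : ℝ}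
    {y : ℕ → Fin n → ℤ} {π : ℕ → Fin n} {lam : ℕ → ℝ} (h : IsReducedSystem f m C y π lam)
    (hm : m < n) : latticeFlag f y m ≠ ⊤ := by
  classical
  obtain ⟨p, -, hp⟩ : ∃ p ∈ (Finset.univ : Finset (Fin n)), p ∉ (Finset.range m).image π := by
    apply Finset.exists_mem_notMem_of_card_lt_card
    refine Finset.card_image_le.trans_lt ?_
    simpa using hm
  intro htop
  have h1 := h.dominated m le_rfl (Pi.single p 1) (htop ▸ Submodule.mem_top) 0 le_rfl (by
    intro l hl
    have : π l ≠ p := fun e => hp (Finset.mem_image.2 ⟨l, Finset.mem_range.2 hl, e⟩)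
    simp [this])
  rw [mul_zero] at h1
  have h2 : (Pi.single p (1 : ℝ) : Fin n → ℝ) = 0 := norm_le_zero_iff.1 h1
  have := congrFun h2 p
  simp at this

lemma IsReducedSystem.exists_succ {f : (Fin n → ℤ) →+ (Fin n → ℝ)} {m : ℕ} {C : ℝ}
    (hspan : Submodule.span ℝ (Set.range f) = ⊤)
    (hfin : ∀ ρ : ℝ, {v | ‖f v‖ ≤ ρ}.Finite)
    {y : ℕ → Fin n → ℤ} {π : ℕ → Fin n} {lam : ℕ → ℝ} (h : IsReducedSystem f m C y π lam)
    (hm : m < n) (hC : 1 ≤ C) :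
    ∃ y' π' lam', IsReducedSystem f (m + 1) (1 + 3 ^ m + (m + 1) * 3 ^ m * C) y' π' lam' := by
  classical
  obtain ⟨v₀, hv₀⟩ : ∃ v, f v ∉ latticeFlag f y m := by
    by_contra hcon
    push Not at hcon
    apply h.latticeFlag_ne_top hm
    rw [eq_top_iff, ← hspan, Submodule.span_le]
    rintro _ ⟨v, rfl⟩
    exact hcon v
  obtain ⟨x, ⟨-, hxS⟩, hxmin⟩ : ∃ x ∈ {v | ‖f v‖ ≤ ‖f v₀‖ ∧ f v ∉ latticeFlag f y m},
      ∀ v ∈ {v | ‖f v‖ ≤ ‖f v₀‖ ∧ f v ∉ latticeFlag f y m}, ‖f x‖ ≤ ‖f v‖ :=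
    Set.exists_min_image _ (fun v => ‖f v‖)
      ((hfin ‖f v₀‖).subset fun v hv => hv.1) ⟨v₀, le_rfl, hv₀⟩
  have hxmin' : ∀ v, f v ∉ latticeFlag f y m → ‖f x‖ ≤ ‖f v‖ := by
    intro v hv
    rcases le_total ‖f v‖ ‖f v₀‖ with h1 | h1
    · exact hxmin v ⟨h1, hv⟩
    · exact (hxmin v₀ ⟨le_rfl, hv₀⟩).trans h1
  obtain ⟨c, hc⟩ := h.interp (fun l => f x (π l))
  set w : Fin n → ℝ := ∑ i ∈ Finset.range m, c i • f (y i) with hw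
  have hwS : w ∈ latticeFlag f y m := sum_smul_mem_latticeFlag f y m c
  set z : Fin n → ℝ := f x - w with hz
  have hz0 : z ≠ 0 := fun e => hxS (by rwa [sub_eq_zero.1 e])
  have hzπ : ∀ l < m, z (π l) = 0 := by
    intro l hl
    rw [hz, Pi.sub_apply, hc l hl, sub_self]
  have hlampos : 0 < ‖f x‖ := norm_pos_iff.2 fun e => hxS (by rw [e]; exact Submodule.zero_mem _)
  have hlam_le : ∀ i < m, lam i ≤ ‖f x‖ := fun i hi =>
    h.minimal i hi x fun e => hxS (latticeFlag_mono f y hi.le e)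
  have : Nonempty (Fin n) := ⟨⟨m, hm⟩⟩
  obtain ⟨p, hp⟩ : ∃ p, ∀ i, |z i| ≤ |z p| := Finite.exists_max fun i => |z i|
  have hzp : z p ≠ 0 := by
    intro e
    apply hz0
    ext i
    have := hp i
    rw [e, abs_zero] at this
    exact abs_eq_zero.1 (le_antisymm this (abs_nonneg _))
  set x' : Fin n → ℤ := x - ∑ i ∈ Finset.range m, ⌊c i⌋ • y i with hx'
  have hfx' : f x' = z + ∑ i ∈ Finset.range m, Int.fract (c i) • f (y i) := by
    have h1 : f x' = f x - ∑ i ∈ Finset.range m, (⌊c i⌋ : ℝ) • f (y i) := by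
      rw [hx', map_sub, map_sum]
      congr 1
      refine Finset.sum_congr rfl fun i _ => ?_
      rw [map_zsmul, Int.cast_smul_eq_zsmul]
    rw [h1, hz, hw, sub_add, ← Finset.sum_sub_distrib]
    congr 1
    refine Finset.sum_congr rfl fun i _ => ?_
    rw [← sub_smul]
    congr 1
    rw [Int.fract]; ring
  let y' : ℕ → Fin n → ℤ := Function.update y m x'
  let π' : ℕ → Fin n := Function.update π m p
  let lam' : ℕ → ℝ := Function.update lam m ‖f x‖
  have hy'lt : ∀ i < m, y' i = y i := fun i hi => Function.update_of_ne hi.ne _ _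
  have hπ'lt : ∀ i < m, π' i = π i := fun i hi => Function.update_of_ne hi.ne _ _
  have hlam'lt : ∀ i < m, lam' i = lam i := fun i hi => Function.update_of_ne hi.ne _ _
  have hy'm : y' m = x' := Function.update_self _ _ _
  have hπ'm : π' m = p := Function.update_self _ _ _
  have hlam'm : lam' m = ‖f x‖ := Function.update_self _ _ _
  have hflag : ∀ j ≤ m, latticeFlag f y' j = latticeFlag f y j := fun j hj =>
    latticeFlag_congr f fun i hi => hy'lt i (hi.trans_le hj)
  have hflagm : latticeFlag f y' (m + 1) = Submodule.span ℝ {z} ⊔ latticeFlag f y m := by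
    rw [latticeFlag_succ, hflag m le_rfl, hy'm, hfx']
    have hmem := sum_smul_mem_latticeFlag f y m (fun i => Int.fract (c i))
    apply le_antisymm
    · refine sup_le ?_ le_sup_right
      rw [Submodule.span_singleton_le_iff_mem]
      exact Submodule.add_mem _ (Submodule.mem_sup_left (Submodule.mem_span_singleton_self z))
        (Submodule.mem_sup_right hmem)
    · refine sup_le ?_ le_sup_right
      rw [Submodule.span_singleton_le_iff_mem]
      have := Submodule.sub_mem _ (Submodule.mem_sup_left (Submodule.mem_span_singleton_self
        (z + ∑ i ∈ Finset.range m, Int.fract (c i) • f (y i))))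
        (Submodule.mem_sup_right (S := Submodule.span ℝ
          {z + ∑ i ∈ Finset.range m, Int.fract (c i) • f (y i)}) hmem)
      rwa [add_sub_cancel_right] at this
  have hynorm : ∀ j < m, ‖f (y j)‖ ≤ 3 ^ m * (C * lam j) := by
    intro j hj
    refine h.dominated m le_rfl _ (Submodule.subset_span ⟨j, hj, rfl⟩) _
      (mul_nonneg (by linarith) (h.pos j hj).le) fun l hl => ?_
    exact (h.bound l hl j hj).trans (mul_le_mul_of_nonneg_left (min_le_right _ _) (by linarith))
  have hwnorm : ‖w‖ ≤ 3 ^ m * ‖f x‖ := by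
    refine h.dominated m le_rfl w hwS _ (norm_nonneg _) fun l hl => ?_
    rw [hc l hl]
    exact norm_le_pi_norm (f x) (π l)
  have hfract : ∀ i, |Int.fract (c i)| ≤ 1 := fun i => by
    rw [abs_of_nonneg (Int.fract_nonneg _)]; exact (Int.fract_lt_one _).le
  have h3 : (1 : ℝ) ≤ 3 ^ m := one_le_pow₀ (by norm_num)
  set C' : ℝ := 1 + 3 ^ m + (m + 1) * 3 ^ m * C with hC'
  have hm0 : (0 : ℝ) ≤ m := Nat.cast_nonneg m
  have h3C : C ≤ 3 ^ m * C := le_mul_of_one_le_left (by linarith) h3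
  have hm3C : (0 : ℝ) ≤ m * (3 ^ m * C) := mul_nonneg hm0 (by linarith)
  have hC'3 : 3 ^ m * C ≤ C' := by
    have : C' = 1 + 3 ^ m + m * (3 ^ m * C) + 3 ^ m * C := by rw [hC']; ring
    linarith
  have hC'4 : m * C ≤ C' := by
    have h5 := mul_le_mul_of_nonneg_left h3C hm0
    have : C' = 1 + 3 ^ m + m * (3 ^ m * C) + 3 ^ m * C := by rw [hC']; ring
    linarith
  have hx'π : ∀ l < m, |f x' (π l)| ≤ C' * lam l := by
    intro l hl
    have h1 : f x' (π l) = ∑ i ∈ Finset.range m, Int.fract (c i) * f (y i) (π l) := by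
      rw [hfx', Pi.add_apply, hzπ l hl, zero_add, Finset.sum_apply]
      rfl
    rw [h1]
    calc _ ≤ ∑ i ∈ Finset.range m, |Int.fract (c i) * f (y i) (π l)| :=
          Finset.abs_sum_le_sum_abs _ _
      _ ≤ ∑ i ∈ Finset.range m, C * lam l := by
          refine Finset.sum_le_sum fun i hi => ?_
          rw [abs_mul]
          refine (mul_le_of_le_one_left (abs_nonneg _) (hfract i)).trans ?_
          exact (h.bound l hl i (Finset.mem_range.1 hi)).trans
            (mul_le_mul_of_nonneg_left (min_le_left _ _) (by linarith))
      _ = m * C * lam l := by simp [mul_assoc]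
      _ ≤ C' * lam l := mul_le_mul_of_nonneg_right hC'4 (h.pos l hl).le
  have hx'norm : ‖f x'‖ ≤ C' * ‖f x‖ := by
    rw [hfx', hz]
    calc _ ≤ ‖f x - w‖ + ‖∑ i ∈ Finset.range m, Int.fract (c i) • f (y i)‖ := norm_add_le _ _
      _ ≤ (‖f x‖ + 3 ^ m * ‖f x‖) + ∑ i ∈ Finset.range m, 3 ^ m * (C * ‖f x‖) := by
          refine add_le_add ((norm_sub_le _ _).trans (add_le_add le_rfl hwnorm))
            ((norm_sum_le _ _).trans (Finset.sum_le_sum fun i hi => ?_))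
          have hi' := Finset.mem_range.1 hi
          rw [norm_smul, Real.norm_eq_abs]
          refine (mul_le_of_le_one_left (norm_nonneg _) (hfract i)).trans ((hynorm i hi').trans ?_)
          exact mul_le_mul_of_nonneg_left (mul_le_mul_of_nonneg_left (hlam_le i hi') (by linarith))
            (by positivity)
      _ = (1 + 3 ^ m + m * 3 ^ m * C) * ‖f x‖ := by
          rw [Finset.sum_const, Finset.card_range, nsmul_eq_mul]; ring
      _ ≤ C' * ‖f x‖ := by
          refine mul_le_mul_of_nonneg_right ?_ hlampos.le
          have : C' = 1 + 3 ^ m + m * 3 ^ m * C + 3 ^ m * C := by rw [hC']; ring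
          linarith
  refine ⟨y', π', lam', ?_, ?_, ?_, ?_, ?_, ?_, ?_⟩
  · intro j hj v hv
    rw [hflag j (by omega)] at hv
    rcases Nat.lt_succ_iff_lt_or_eq.1 hj with hj | rfl
    · rw [hlam'lt j hj]; exact h.minimal j hj v hv
    · rw [hlam'm]; exact hxmin' v hv
  · intro l hl j hj
    rcases Nat.lt_succ_iff_lt_or_eq.1 hj with hj | hj
    · rcases Nat.lt_succ_iff_lt_or_eq.1 hl with hl | hl
      · rw [hy'lt j hj, hπ'lt l hl, hlam'lt l hl, hlam'lt j hj]
        exact (h.bound l hl j hj).trans (mul_le_mul_of_nonneg_right (by linarith)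
          (le_min (h.pos l hl).le (h.pos j hj).le))
      · rw [hy'lt j hj, hl, hlam'm, hlam'lt j hj, min_eq_right (hlam_le j hj)]
        refine (norm_le_pi_norm (f (y j)) _).trans ((hynorm j hj).trans ?_)
        rw [← mul_assoc]
        exact mul_le_mul_of_nonneg_right hC'3 (h.pos j hj).le
    · rcases Nat.lt_succ_iff_lt_or_eq.1 hl with hl | hl
      · rw [hj, hy'm, hπ'lt l hl, hlam'lt l hl, hlam'm, min_eq_left (hlam_le l hl)]
        exact hx'π l hl
      · rw [hj, hl, hy'm, hlam'm, min_self]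
        exact (norm_le_pi_norm (f x') _).trans hx'norm
  · intro i j hij hj
    rcases Nat.lt_succ_iff_lt_or_eq.1 hj with hj | rfl
    · rw [hlam'lt j hj, hlam'lt i (by omega)]; exact h.mono i j hij hj
    · rcases hij.lt_or_eq with hi | rfl
      · rw [hlam'm, hlam'lt i hi]; exact hlam_le i hi
      · exact le_rfl
  · intro j hj
    rcases Nat.lt_succ_iff_lt_or_eq.1 hj with hj | rfl
    · rw [hlam'lt j hj]; exact h.pos j hj
    · rw [hlam'm]; exact hlampos
  · intro j hj s hs T hT hsT
    rcases Nat.le_succ_iff.1 hj with hj | rfl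
    · rw [hflag j hj] at hs
      exact h.dominated j hj s hs T hT fun l hl => by
        have := hsT l hl
        rwa [hπ'lt l (by omega)] at this
    · rw [hflagm] at hs
      obtain ⟨u, hu, s', hs', rfl⟩ := Submodule.mem_sup.1 hs
      obtain ⟨r, rfl⟩ := Submodule.mem_span_singleton.1 hu
      have h1 : ‖s'‖ ≤ 3 ^ m * T := by
        refine h.dominated m le_rfl s' hs' T hT fun l hl => ?_
        have := hsT l (by omega)
        rw [hπ'lt l hl] at this
        simpa [hzπ l hl] using this
      have h2 := hsT m (by omega)
      rw [hπ'm] at h2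
      have h4 : |r * z p| ≤ T + 3 ^ m * T := by
        have h5 : r * z p = (r • z + s') p - s' p := by simp
        rw [h5]
        refine (abs_sub _ _).trans (add_le_add h2 ?_)
        exact (norm_le_pi_norm s' p).trans h1
      have h6 : ‖r • z‖ ≤ T + 3 ^ m * T := by
        rw [pi_norm_le_iff_of_nonneg (by positivity)]
        intro i
        refine le_trans ?_ h4
        rw [Pi.smul_apply, smul_eq_mul, Real.norm_eq_abs, abs_mul, abs_mul]
        exact mul_le_mul_of_nonneg_left (hp i) (abs_nonneg _)
      have h7 : T ≤ 3 ^ m * T := le_mul_of_one_le_left hT h3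
      have h8 := norm_add_le (r • z) s'
      rw [pow_succ]
      linarith
  · intro t
    obtain ⟨c', hc'⟩ := h.interp t
    set w' : Fin n → ℝ := ∑ i ∈ Finset.range m, c' i • f (y i) with hw'
    set r : ℝ := (t m - w' p) / z p with hr
    refine ⟨fun i => if i = m then r else c' i - r * Int.fract (c i), ?_⟩
    have hsum : ∑ i ∈ Finset.range (m + 1),
        (if i = m then r else c' i - r * Int.fract (c i)) • f (y' i) = w' + r • z := by
      rw [Finset.sum_range_succ, if_pos rfl, hy'm, hfx', smul_add, hw']
      have : ∑ i ∈ Finset.range m,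
          (if i = m then r else c' i - r * Int.fract (c i)) • f (y' i)
          = ∑ i ∈ Finset.range m, (c' i • f (y i) - r • (Int.fract (c i) • f (y i))) := by
        refine Finset.sum_congr rfl fun i hi => ?_
        have hi' := Finset.mem_range.1 hi
        rw [if_neg hi'.ne, hy'lt i hi', sub_smul, smul_smul]
      rw [this, Finset.sum_sub_distrib, ← Finset.smul_sum]
      abel
    intro l hl
    rw [hsum]
    rcases Nat.lt_succ_iff_lt_or_eq.1 hl with hl | rfl
    · rw [hπ'lt l hl, Pi.add_apply, Pi.smul_apply, hzπ l hl, smul_zero, add_zero, hc' l hl]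
    · rw [hπ'm, Pi.add_apply, Pi.smul_apply, smul_eq_mul, hr, div_mul_cancel₀ _ hzp]
      ring
  · intro i hi j hj hij
    have key : ∀ l < m, π' l ≠ π' m := by
      intro l hl e
      rw [hπ'lt l hl, hπ'm] at e
      exact hzp (e ▸ hzπ l hl)
    rcases Nat.lt_succ_iff_lt_or_eq.1 hi with hi | hi <;>
      rcases Nat.lt_succ_iff_lt_or_eq.1 hj with hj | hj
    · rw [hπ'lt i hi, hπ'lt j hj] at hij
      exact h.inj hi hj hij
    · subst hj; exact absurd hij (key i hi)
    · subst hi; exact absurd hij.symm (key j hj)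
    · rw [hi, hj]

end Reduction

lemma abs_det_le_of_row_le {ι : Type*} [Fintype ι] [DecidableEq ι] (M : Matrix ι ι ℝ) (C : ℝ)
    (r : ι → ℝ) (h : ∀ i j, |M i j| ≤ C * r i) :
    |M.det| ≤ (Fintype.card ι).factorial * C ^ Fintype.card ι * ∏ i, r i := by
  rw [Matrix.det_apply]
  refine (Finset.abs_sum_le_sum_abs _ _).trans ?_
  have : ∀ σ ∈ (Finset.univ : Finset (Equiv.Perm ι)),
      |Equiv.Perm.sign σ • ∏ i, M (σ i) i| ≤ C ^ Fintype.card ι * ∏ i, r i := by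
    intro σ _
    have h1 : |Equiv.Perm.sign σ • ∏ i, M (σ i) i| = ∏ i, |M (σ i) i| := by
      rw [← Finset.abs_prod]
      rcases Int.units_eq_one_or (Equiv.Perm.sign σ) with h | h <;> simp [h]
    rw [h1]
    calc ∏ i, |M (σ i) i| ≤ ∏ i, C * r (σ i) :=
          Finset.prod_le_prod (fun _ _ => abs_nonneg _) fun i _ => h _ _
      _ = C ^ Fintype.card ι * ∏ i, r i := by
          rw [Finset.prod_mul_distrib, Equiv.prod_comp σ r]; simp
  refine (Finset.sum_le_sum this).trans ?_
  rw [Finset.sum_const, Finset.card_univ, Fintype.card_perm, nsmul_eq_mul, mul_assoc]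

lemma abs_det_le_of_col_le {ι : Type*} [Fintype ι] [DecidableEq ι] (M : Matrix ι ι ℝ) (C : ℝ)
    (r : ι → ℝ) (h : ∀ i j, |M i j| ≤ C * r j) :
    |M.det| ≤ (Fintype.card ι).factorial * C ^ Fintype.card ι * ∏ i, r i := by
  rw [← Matrix.det_transpose]
  exact abs_det_le_of_row_le _ C r fun i j => h j i

section Reduction

variable {n : ℕ}

/-- The values of the linear forms with coefficient matrix `A` at integer points. -/
def intForms (A : Matrix (Fin n) (Fin n) ℝ) : (Fin n → ℤ) →+ (Fin n → ℝ) where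
  toFun v i := ∑ k, A i k * v k
  map_zero' := by ext i; simp
  map_add' v w := by
    ext i
    simp [mul_add, Finset.sum_add_distrib]

lemma intForms_apply (A : Matrix (Fin n) (Fin n) ℝ) (v : Fin n → ℤ) (i : Fin n) :
    intForms A v i = ∑ k, A i k * v k := rfl

lemma span_range_intForms (A : Matrix (Fin n) (Fin n) ℝ) (hA : A.det ≠ 0) :
    Submodule.span ℝ (Set.range (intForms A)) = ⊤ := by
  rw [eq_top_iff]
  intro w _
  have hu : IsUnit A.det := isUnit_iff_ne_zero.2 hA
  have h1 : w = ∑ k, (A⁻¹.mulVec w) k • intForms A (Pi.single k 1) := by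
    have h2 : A.mulVec (A⁻¹.mulVec w) = w := by
      rw [Matrix.mulVec_mulVec, Matrix.mul_nonsing_inv _ hu, Matrix.one_mulVec]
    ext i
    conv_lhs => rw [← h2]
    simp [Finset.sum_apply, intForms_apply, Pi.single_apply, Matrix.mulVec, dotProduct, mul_comm]
  rw [h1]
  exact Submodule.sum_mem _ fun k _ => Submodule.smul_mem _ _ (Submodule.subset_span ⟨_, rfl⟩)

lemma finite_norm_intForms_le (A : Matrix (Fin n) (Fin n) ℝ) (hA : A.det ≠ 0) (ρ : ℝ) :
    {v | ‖intForms A v‖ ≤ ρ}.Finite := by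
  have hu : IsUnit A.det := isUnit_iff_ne_zero.2 hA
  set B : ℤ := ⌈∑ i, ∑ k, |A⁻¹ i k| * ρ⌉
  refine (Set.finite_Icc (fun _ : Fin n => -B) (fun _ => B)).subset fun v hv => ?_
  have hv' : ‖intForms A v‖ ≤ ρ := hv
  have hρ : 0 ≤ ρ := (norm_nonneg _).trans hv'
  have key : ∀ i, |v i| ≤ B := by
    intro i
    have h2 : A⁻¹.mulVec (intForms A v) = fun i => ((v i : ℤ) : ℝ) := by
      have : intForms A v = A.mulVec fun i => ((v i : ℤ) : ℝ) := rfl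
      rw [this, Matrix.mulVec_mulVec, Matrix.nonsing_inv_mul _ hu, Matrix.one_mulVec]
    have h3 : |(v i : ℝ)| ≤ ∑ i, ∑ k, |A⁻¹ i k| * ρ := by
      rw [← congrFun h2 i]
      calc |∑ k, A⁻¹ i k * intForms A v k| ≤ ∑ k, |A⁻¹ i k * intForms A v k| :=
            Finset.abs_sum_le_sum_abs _ _
        _ ≤ ∑ k, |A⁻¹ i k| * ρ := by
            refine Finset.sum_le_sum fun k _ => ?_
            rw [abs_mul]
            exact mul_le_mul_of_nonneg_left ((norm_le_pi_norm _ k).trans hv') (abs_nonneg _)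
        _ ≤ _ := Finset.single_le_sum (f := fun i => ∑ k, |A⁻¹ i k| * ρ)
            (fun i _ => Finset.sum_nonneg fun k _ => mul_nonneg (abs_nonneg _) hρ)
            (Finset.mem_univ i)
    have h4 := h3.trans (Int.le_ceil _)
    exact_mod_cast h4
  exact ⟨fun i => (abs_le.1 (key i)).1, fun i => (abs_le.1 (key i)).2⟩

lemma exists_isReducedSystem (hn : 0 < n) (m : ℕ) (hm : m ≤ n) : ∃ C : ℝ, 1 ≤ C ∧
    ∀ A : Matrix (Fin n) (Fin n) ℝ, A.det ≠ 0 → ∃ y π lam,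
      IsReducedSystem (intForms A) m C y π lam := by
  induction m with
  | zero =>
    refine ⟨1, le_rfl, fun A hA => ⟨fun _ => 0, fun _ => ⟨0, hn⟩, fun _ => 0, ?_, ?_, ?_, ?_, ?_,
      ?_, ?_⟩⟩
    · intro j hj; omega
    · intro j hj; omega
    · intro i j _ hj; omega
    · intro j hj; omega
    · intro j hj s hs T hT _
      obtain rfl : j = 0 := by omega
      have : s = 0 := by simpa [latticeFlag] using hs
      rw [this]
      simpa using hT
    · intro t
      exact ⟨0, fun l hl => by omega⟩
    · intro i hi
      simp at hi
  | succ m ih =>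
    obtain ⟨C, hC, h⟩ := ih (by omega)
    refine ⟨1 + 3 ^ m + (m + 1) * 3 ^ m * C, ?_, fun A hA => ?_⟩
    · have : (0 : ℝ) ≤ 3 ^ m + (m + 1) * 3 ^ m * C := by positivity
      linarith
    · obtain ⟨y, π, lam, hred⟩ := h A hA
      exact hred.exists_succ (span_range_intForms A hA) (finite_norm_intForms_le A hA)
        (by omega) hC

/-- Reduction theory: an integral basis adapted to a system of linear forms. -/
lemma exists_reduced_basis (hn : 0 < n) : ∃ C : ℝ, 1 ≤ C ∧
    ∀ A : Matrix (Fin n) (Fin n) ℝ, A.det ≠ 0 →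
      ∃ (y : Matrix (Fin n) (Fin n) ℤ) (π : Equiv.Perm (Fin n)) (lam : Fin n → ℝ),
        y.det ≠ 0 ∧ Monotone lam ∧ (∀ j, 0 < lam j) ∧
        (∀ v : Fin n → ℤ, v ≠ 0 → ∃ i, lam ⟨0, hn⟩ ≤ |∑ k, A i k * v k|) ∧
        (∀ l j, |∑ k, A (π l) k * y j k| ≤ C * min (lam l) (lam j)) ∧
        ∏ j, lam j ≤ C * |A.det| ∧ |A.det| ≤ C * ∏ j, lam j := by
  classical
  obtain ⟨C, hC, h⟩ := exists_isReducedSystem hn n le_rfl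
  refine ⟨C + (3 ^ n) ^ n + n.factorial * C ^ n, ?_, fun A hA => ?_⟩
  · have : (0 : ℝ) ≤ (3 ^ n) ^ n + n.factorial * C ^ n := by positivity
    linarith
  obtain ⟨y, π, lam, hred⟩ := h A hA
  have : Nonempty (Fin n) := ⟨⟨0, hn⟩⟩
  have hinj : Function.Injective fun l : Fin n => π l := fun i j hij =>
    Fin.ext (hred.inj i.2 j.2 hij)
  let π' : Equiv.Perm (Fin n) := Equiv.ofBijective _ (Finite.injective_iff_bijective.1 hinj)
  have hπ' : ∀ l, π' l = π l := fun l => rfl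
  have hbound : ∀ l j : Fin n, |∑ k, A (π' l) k * y j k| ≤ C * min (lam l) (lam j) :=
    fun l j => hred.bound l l.2 j j.2
  let y' : Matrix (Fin n) (Fin n) ℤ := fun j => y j
  have hdet0 : y'.det ≠ 0 := by
    intro h0
    obtain ⟨u, hu0, hu⟩ := Matrix.exists_mulVec_eq_zero_iff.2 (show (y'.map (Int.cast : ℤ → ℝ)).det = 0 by
      have := (Int.castRingHom ℝ).map_det y'
      rw [h0, map_zero] at this
      exact this.symm)
    -- every vector is a combination of the images of `y`, so the functional `u ∘ A⁻¹` vanishes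
    have hAu : IsUnit A.det := isUnit_iff_ne_zero.2 hA
    have hfun : ∀ v : Fin n → ℝ, dotProduct u (A⁻¹.mulVec v) = 0 := by
      intro v
      obtain ⟨c, hc⟩ := hred.interp (fun l => if hl : l < n then v (π' ⟨l, hl⟩) else 0)
      have hv : v = A.mulVec (∑ i ∈ Finset.range n, c i • fun k => ((y i k : ℤ) : ℝ)) := by
        ext i
        obtain ⟨l, rfl⟩ := π'.surjective i
        have := hc l l.2
        simp only [l.2, dif_pos] at this
        rw [← hπ'] at this
        rw [← this, Matrix.mulVec_sum]
        simp only [Matrix.mulVec_smul, Finset.sum_apply]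
        rfl
      rw [hv, Matrix.mulVec_mulVec, Matrix.nonsing_inv_mul _ hAu, Matrix.one_mulVec,
        dotProduct_sum]
      refine Finset.sum_eq_zero fun i hi => ?_
      rw [dotProduct_smul]
      have := congrFun hu ⟨i, Finset.mem_range.1 hi⟩
      rw [dotProduct_comm]
      have h2 : (fun k => ((y i k : ℤ) : ℝ)) ⬝ᵥ u = 0 := this
      rw [h2, smul_zero]
    apply hu0
    have := hfun (A.mulVec u)
    rw [Matrix.mulVec_mulVec, Matrix.nonsing_inv_mul _ hAu, Matrix.one_mulVec] at this
    exact dotProduct_self_eq_zero.1 this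
  have hlampos : ∀ j : Fin n, 0 < lam j := fun j => hred.pos j j.2
  have hprodpos : 0 < ∏ j : Fin n, lam j := Finset.prod_pos fun j _ => hlampos j
  have hflagtop : ∀ v, intForms A v ∈ latticeFlag (intForms A) y n := by
    intro v
    obtain ⟨c, hc⟩ := hred.interp (fun l => if hl : l < n then intForms A v (π' ⟨l, hl⟩) else 0)
    have : intForms A v = ∑ i ∈ Finset.range n, c i • intForms A (y i) := by
      ext i
      obtain ⟨l, rfl⟩ := π'.surjective i
      have := hc l l.2
      simp only [l.2, dif_pos] at this
      rw [hπ', this, hπ']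
    rw [this]
    exact sum_smul_mem_latticeFlag _ _ _ _
  have hinj0 : ∀ v, intForms A v = 0 → v = 0 := by
    intro v hv
    have h1 := Matrix.eq_zero_of_mulVec_eq_zero hA (v := fun k => ((v k : ℤ) : ℝ)) hv
    ext k
    have := congrFun h1 k
    simpa using this
  refine ⟨y', π', fun j => lam j, hdet0, fun i j hij => hred.mono i j hij j.2, hlampos, ?_, ?_,
    ?_, ?_⟩
  · intro v hv
    have h1 : lam 0 ≤ ‖intForms A v‖ := hred.minimal 0 hn v fun hmem =>
      hv (hinj0 v (by simpa [latticeFlag] using hmem))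
    by_contra hcon
    push Not at hcon
    have : ‖intForms A v‖ < lam 0 := (pi_norm_lt_iff (hred.pos 0 hn)).2 hcon
    linarith
  · intro l j
    refine (hbound l j).trans (mul_le_mul_of_nonneg_right ?_ (le_min (hlampos l).le (hlampos j).le))
    have : (0 : ℝ) ≤ (3 ^ n) ^ n + n.factorial * C ^ n := by positivity
    linarith
  · -- upper bound for the product of the minima
    let B : Matrix (Fin n) (Fin n) ℝ := fun l k => (lam l)⁻¹ * A (π' l) k
    have hB : B.det = (∏ l : Fin n, (lam l)⁻¹) * ((Equiv.Perm.sign π' : ℤ) * A.det) := by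
      rw [← Matrix.det_permute, ← Matrix.det_mul_column]
      rfl
    have hBabs : |B.det| = (∏ l : Fin n, lam l)⁻¹ * |A.det| := by
      rw [hB, abs_mul, abs_mul, Finset.prod_inv_distrib, abs_inv, abs_of_pos hprodpos]
      have : |((Equiv.Perm.sign π' : ℤ) : ℝ)| = 1 := by
        rcases Int.units_eq_one_or (Equiv.Perm.sign π') with h | h <;> simp [h]
      rw [this, one_mul]
    have hB0 : B.det ≠ 0 := by
      rw [← abs_pos, hBabs]
      exact mul_pos (inv_pos.2 hprodpos) (abs_pos.2 hA)
    have hge : ((3 : ℝ) ^ n)⁻¹ ^ n ≤ |B.det| := by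
      by_contra hlt
      push Not at hlt
      obtain ⟨v, hv0, hv⟩ := exists_int_linear_forms_lt B hB0 (by positivity) hlt
      have hex : ∃ j, intForms A v ∈ latticeFlag (intForms A) y j := ⟨n, hflagtop v⟩
      have hspec := Nat.find_spec hex
      have hle : Nat.find hex ≤ n := Nat.find_min' hex (hflagtop v)
      obtain ⟨j, hj⟩ : ∃ j, Nat.find hex = j + 1 := by
        refine Nat.exists_eq_succ_of_ne_zero fun h0 => hv0 (hinj0 v ?_)
        rw [h0] at hspec
        simpa [latticeFlag] using hspec
      rw [hj] at hspec
      have hjn : j < n := by omega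
      have hlam := hred.minimal j hjn v (Nat.find_min hex (by omega))
      have hT : ∀ l < j + 1, |intForms A v (π l)| < (3 ^ n)⁻¹ * lam j := by
        intro l hl
        have hln : l < n := by omega
        have h1 := hv ⟨l, hln⟩
        have h2 : ∑ k, B ⟨l, hln⟩ k * v k = (lam l)⁻¹ * intForms A v (π l) := by
          rw [intForms_apply, Finset.mul_sum]
          exact Finset.sum_congr rfl fun k _ => mul_assoc _ _ _
        have hl0 := hred.pos l hln
        rw [h2, abs_mul, abs_of_pos (inv_pos.2 hl0), inv_mul_eq_div, div_lt_iff₀ hl0] at h1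
        exact h1.trans_le (mul_le_mul_of_nonneg_left (hred.mono l j (by omega) hjn) (by positivity))
      obtain ⟨l₀, hl₀, hmax⟩ := Finset.exists_max_image (Finset.range (j + 1))
        (fun l => |intForms A v (π l)|) ⟨0, by simp⟩
      have h5 := hred.dominated (j + 1) (by omega) _ hspec |intForms A v (π l₀)| (abs_nonneg _)
        fun l hl => hmax l (Finset.mem_range.2 hl)
      have h6 := hT l₀ (Finset.mem_range.1 hl₀)
      have h7 : (3 : ℝ) ^ (j + 1) ≤ 3 ^ n := pow_le_pow_right₀ (by norm_num) (by omega)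
      have h8 : (3 : ℝ) ^ (j + 1) * |intForms A v (π l₀)| ≤ 3 ^ n * |intForms A v (π l₀)| :=
        mul_le_mul_of_nonneg_right h7 (abs_nonneg _)
      have h9 : (3 : ℝ) ^ n * |intForms A v (π l₀)| < 3 ^ n * ((3 ^ n)⁻¹ * lam j) :=
        mul_lt_mul_of_pos_left h6 (by positivity)
      rw [mul_inv_cancel_left₀ (by positivity)] at h9
      linarith
    rw [hBabs, inv_mul_eq_div, le_div_iff₀ hprodpos, inv_pow, inv_mul_le_iff₀ (by positivity)] at hge
    refine hge.trans (mul_le_mul_of_nonneg_right ?_ (abs_nonneg _))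
    have : (0 : ℝ) ≤ C + n.factorial * C ^ n := by positivity
    linarith
  · let M : Matrix (Fin n) (Fin n) ℝ := A.submatrix π' id * (y'.map (Int.cast : ℤ → ℝ)).transpose
    have hM : |M.det| = |A.det| * |(y'.det : ℝ)| := by
      have h1 : (y'.map (Int.cast : ℤ → ℝ)).det = (y'.det : ℝ) :=
        ((Int.castRingHom ℝ).map_det y').symm
      rw [Matrix.det_mul, Matrix.det_transpose, abs_mul, h1, Matrix.det_permute, abs_mul]
      have : |((Equiv.Perm.sign π' : ℤ) : ℝ)| = 1 := by
        rcases Int.units_eq_one_or (Equiv.Perm.sign π') with h | h <;> simp [h]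
      rw [this, one_mul]
    have h1 : (1 : ℝ) ≤ |(y'.det : ℝ)| := by
      exact_mod_cast Int.one_le_abs hdet0
    have h2 := abs_det_le_of_row_le M C (fun l => lam l) fun l j =>
      (hbound l j).trans (mul_le_mul_of_nonneg_left (min_le_left _ _) (by linarith))
    rw [hM, Fintype.card_fin] at h2
    have h3 : |A.det| ≤ |A.det| * |(y'.det : ℝ)| := le_mul_of_one_le_right (abs_nonneg _) h1
    refine (h3.trans h2).trans (mul_le_mul_of_nonneg_right ?_ hprodpos.le)
    have : (0 : ℝ) ≤ C + (3 ^ n) ^ n := by positivity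
    linarith

end Reduction

section Compound

variable {n p : ℕ}

/-- The matrix of `p × p` minors of a square matrix. -/
def compoundMatrix {R : Type*} [CommRing R] (p : ℕ) (A : Matrix (Fin n) (Fin n) R) :
    Matrix (Fin p ↪o Fin n) (Fin p ↪o Fin n) R :=
  fun I J => (A.submatrix I J).det

lemma compoundMatrix_apply {R : Type*} [CommRing R] (A : Matrix (Fin n) (Fin n) R)
    (I J : Fin p ↪o Fin n) : compoundMatrix p A I J = (A.submatrix I J).det := rfl

lemma compoundMatrix_transpose {R : Type*} [CommRing R] (A : Matrix (Fin n) (Fin n) R) :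
    compoundMatrix p A.transpose = (compoundMatrix p A).transpose := by
  ext I J
  rw [Matrix.transpose_apply, compoundMatrix_apply, compoundMatrix_apply, ← Matrix.det_transpose]
  rfl

noncomputable instance : Fintype (Fin p ↪o Fin n) :=
  Fintype.ofEquiv _ (Set.powersetCard.ofFinEmbEquiv (I := Fin n) (n := p)).symm

noncomputable instance : DecidableEq (Fin p ↪o Fin n) := Classical.decEq _

lemma compoundMatrix_eq_toMatrix {R : Type*} [CommRing R] (A : Matrix (Fin n) (Fin n) R) :
    compoundMatrix p A = (LinearMap.toMatrix ((Pi.basisFun R (Fin n)).exteriorPower p)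
      ((Pi.basisFun R (Fin n)).exteriorPower p)
      (exteriorPower.map p (Matrix.toLin' A))).submatrix Set.powersetCard.ofFinEmbEquiv
        Set.powersetCard.ofFinEmbEquiv := by
  ext I J
  rw [Matrix.submatrix_apply, LinearMap.toMatrix_apply, exteriorPower.basis_apply,
    exteriorPower.map_apply_ιMulti_family, exteriorPower.basis_repr_apply,
    exteriorPower.ιMulti_family, exteriorPower.ιMultiDual_apply_ιMulti, ← Matrix.det_transpose,
    compoundMatrix_apply]
  congr 1
  ext i j
  simp

lemma compoundMatrix_mul {R : Type*} [CommRing R] (A B : Matrix (Fin n) (Fin n) R) :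
    compoundMatrix p (A * B) = compoundMatrix p A * compoundMatrix p B := by
  rw [compoundMatrix_eq_toMatrix, compoundMatrix_eq_toMatrix, compoundMatrix_eq_toMatrix,
    Matrix.toLin'_mul, exteriorPower.map_comp, LinearMap.toMatrix_comp _
      ((Pi.basisFun R (Fin n)).exteriorPower p), Matrix.submatrix_mul_equiv]

lemma compoundMatrix_one {R : Type*} [CommRing R] :
    compoundMatrix p (1 : Matrix (Fin n) (Fin n) R) = 1 := by
  rw [compoundMatrix_eq_toMatrix, Matrix.toLin'_one, exteriorPower.map_id, LinearMap.toMatrix_id,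
    Matrix.submatrix_one_equiv]

lemma compoundMatrix_map {R S : Type*} [CommRing R] [CommRing S] (f : R →+* S)
    (A : Matrix (Fin n) (Fin n) R) : compoundMatrix p (A.map f) = (compoundMatrix p A).map f := by
  ext I J
  rw [Matrix.map_apply, compoundMatrix_apply, compoundMatrix_apply, RingHom.map_det]
  rfl

lemma det_compoundMatrix_ne_zero {F : Type*} [Field F] (A : Matrix (Fin n) (Fin n) F)
    (hA : A.det ≠ 0) : (compoundMatrix p A).det ≠ 0 := by
  have h : compoundMatrix p A * compoundMatrix p A⁻¹ = 1 := by
    rw [← compoundMatrix_mul, Matrix.mul_nonsing_inv _ (isUnit_iff_ne_zero.2 hA),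
      compoundMatrix_one]
  intro h0
  have := congrArg Matrix.det h
  rw [Matrix.det_mul, h0, zero_mul, Matrix.det_one] at this
  exact zero_ne_one this

/-- Every index belongs to the same number of `p`-subsets. -/
lemma exists_sum_orderEmbedding_eq (n p : ℕ) : ∃ c : ℕ, ∀ v : Fin n → ℝ,
    ∑ J : Fin p ↪o Fin n, ∑ a, v (J a) = c * ∑ i, v i := by
  classical
  have hcard : ∀ i j : Fin n, ((Finset.powersetCard p (Finset.univ : Finset (Fin n))).filter
      (i ∈ ·)).card ≤ ((Finset.powersetCard p (Finset.univ : Finset (Fin n))).filter (j ∈ ·)).card := by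
    intro i j
    refine Finset.card_le_card_of_injOn (fun s => s.map (Equiv.swap i j).toEmbedding) ?_ ?_
    · intro s hs
      simp only [Finset.coe_filter, Finset.mem_powersetCard, Set.mem_ofPred_eq] at hs ⊢
      refine ⟨⟨Finset.subset_univ _, by rw [Finset.card_map]; exact hs.1.2⟩, ?_⟩
      exact Finset.mem_map.2 ⟨i, hs.2, Equiv.swap_apply_left i j⟩
    · intro s _ t _ hst
      exact Finset.map_injective _ hst
  rcases isEmpty_or_nonempty (Fin n) with he | ⟨⟨i₀⟩⟩
  · refine ⟨0, fun v => ?_⟩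
    simp only [Nat.cast_zero, zero_mul]
    refine Finset.sum_eq_zero fun J _ => Finset.sum_eq_zero fun a _ => (he.false (J a)).elim
  refine ⟨((Finset.powersetCard p (Finset.univ : Finset (Fin n))).filter (i₀ ∈ ·)).card,
    fun v => ?_⟩
  have h1 : ∑ J : Fin p ↪o Fin n, ∑ a, v (J a)
      = ∑ s ∈ Finset.powersetCard p (Finset.univ : Finset (Fin n)), ∑ i ∈ s, v i := by
    refine Finset.sum_bij (fun J _ => Finset.univ.map J.toEmbedding) ?_ ?_ ?_ ?_
    · intro J _
      simp [Finset.mem_powersetCard]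
    · intro J _ J' _ h
      apply Set.powersetCard.ofFinEmbEquiv.injective
      apply Subtype.ext
      simpa [Set.powersetCard.ofFinEmbEquiv] using h
    · intro s hs
      rw [Finset.mem_powersetCard] at hs
      exact ⟨s.orderEmbOfFin hs.2, Finset.mem_univ _, by
        ext i
        simp only [Finset.mem_map, Finset.mem_univ, true_and]
        exact Set.ext_iff.1 (Finset.range_orderEmbOfFin s hs.2) i⟩
    · intro J _
      simp
  rw [h1]
  have h2 : ∀ s ∈ Finset.powersetCard p (Finset.univ : Finset (Fin n)),
      ∑ i ∈ s, v i = ∑ i, if i ∈ s then v i else 0 := by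
    intro s _
    simp
  rw [Finset.sum_congr rfl h2, Finset.sum_comm, Finset.mul_sum]
  refine Finset.sum_congr rfl fun i _ => ?_
  rw [← Finset.sum_filter, Finset.sum_const, nsmul_eq_mul, le_antisymm (hcard i i₀) (hcard i₀ i)]

end Compound

lemma orderEmbedding_le_natAdd {k q : ℕ} (I : Fin (q + 1) ↪o Fin (k + (q + 1))) (a : Fin (q + 1)) :
    I a ≤ Fin.natAdd k a := by
  have hup : ∀ a : ℕ, ∀ ha : a < q + 1, (I ⟨q - a, by omega⟩ : ℕ) ≤ k + (q - a) := by
    intro a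
    induction a with
    | zero => intro ha; have := (I ⟨q - 0, by omega⟩).2; omega
    | succ a ih =>
      intro ha
      have h1 := ih (by omega)
      have h2 : I ⟨q - (a + 1), by omega⟩ < I ⟨q - a, by omega⟩ :=
        I.strictMono (by rw [Fin.lt_def]; simp only; omega)
      rw [Fin.lt_def] at h2
      omega
  have h2 := hup (q - a) (by omega)
  have h3 : (⟨q - (q - a), by omega⟩ : Fin (q + 1)) = a := Fin.ext (by simp only; omega)
  rw [h3] at h2
  rw [Fin.le_def, Fin.val_natAdd]
  omega

/-- A strictly increasing tuple other than the top one starts strictly below it. -/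
lemma orderEmbedding_zero_lt {k q : ℕ} (I : Fin (q + 1) ↪o Fin (k + (q + 1)))
    (hI : I ≠ Fin.natAddOrderEmb k) : (I 0 : ℕ) < k := by
  by_contra hcon
  push Not at hcon
  apply hI
  have hlow : ∀ a : ℕ, ∀ ha : a < q + 1, k + a ≤ (I ⟨a, ha⟩ : ℕ) := by
    intro a
    induction a with
    | zero => intro ha; simpa using hcon
    | succ a ih =>
      intro ha
      have h1 := ih (by omega)
      have h2 : I ⟨a, by omega⟩ < I ⟨a + 1, ha⟩ := I.strictMono (by simp [Fin.lt_def])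
      rw [Fin.lt_def] at h2
      omega
  ext a
  have h1 := hlow a a.2
  have h2 := orderEmbedding_le_natAdd I a
  rw [Fin.le_def, Fin.val_natAdd] at h2
  have h4 : ((Fin.natAddOrderEmb k a : Fin (k + (q + 1))) : ℕ) = k + a := by simp
  rw [h4]
  simp only [Fin.eta] at h1
  omega

/-- A product of minima over an index set different from the top one loses the gap. -/
lemma sum_orderEmbedding_le {k p : ℕ} (hk : 0 < k) (hp : 0 < p) (μ : Fin (k + p) → ℝ) (hμ : Monotone μ)
    (I : Fin p ↪o Fin (k + p)) (hI : I ≠ Fin.natAddOrderEmb k) :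
    ∑ a, μ (I a) ≤ ∑ a : Fin p, μ (Fin.natAdd k a)
      - (μ ⟨k, by omega⟩ - μ ⟨k - 1, by omega⟩) := by
  obtain ⟨q, rfl⟩ := Nat.exists_eq_succ_of_ne_zero hp.ne'
  rw [Fin.sum_univ_succ, Fin.sum_univ_succ]
  have h1 : μ (I 0) ≤ μ ⟨k - 1, by omega⟩ := hμ (by
    have := orderEmbedding_zero_lt I hI
    rw [Fin.le_def]; simp only; omega)
  have h2 : ∑ a : Fin q, μ (I a.succ) ≤ ∑ a : Fin q, μ (Fin.natAdd k a.succ) :=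
    Finset.sum_le_sum fun a _ => hμ (orderEmbedding_le_natAdd I _)
  have h3 : (Fin.natAdd k (0 : Fin (q + 1))) = ⟨k, by omega⟩ := Fin.ext (by simp)
  rw [h3]
  linarith

/-- The penultimate-minimum theorem, uniformly in a bounded set of exponents. -/
lemma subspace_penultimate_uniform {ι γ : Type*} [Fintype ι] [Fintype γ] [DecidableEq ι]
    (ℓ : Matrix ι ι ℝ) (halg : ∀ i j, IsAlgebraic ℚ (ℓ i j)) (hdet : ℓ.det ≠ 0)
    (B η c : ℝ) (hη : 0 < η) (hc : 0 < c) :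
    ∀ᶠ x : ℝ in Filter.atTop, ∀ b : ι → ℝ, (∀ i, |b i| ≤ B) → ∑ i, b i ≤ -η →
      ∀ a b₀ : ι, a ≠ b₀ → ∀ (g : γ → ι → ℤ) (t : ι → ℚ),
      (∀ j J, |∑ i, ℓ J i * g j i| ≤ Real.exp (b J * x)) →
      (∀ i, i ≠ a → ∃ s : γ → ℚ, ∀ k,
        ((if k = i then 1 else 0) - (if k = a then t i else 0) : ℚ) = ∑ j, s j * g j k) →
      Real.log (max |((t b₀).num : ℝ)| ((t b₀).den : ℝ)) < c * x := by
  obtain ⟨Q, hQ⟩ := exists_nat_gt ((Fintype.card ι : ℝ) / η)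
  have hQ0 : (0 : ℝ) < Q := lt_of_le_of_lt (by positivity) hQ
  have hQη : (Fintype.card ι : ℝ) < Q * η := (div_lt_iff₀ hη).1 hQ
  set M : ℤ := ⌈B * Q⌉ with hM
  have hkey : ∀ᶠ x : ℝ in Filter.atTop,
      ∀ m ∈ Set.Icc (fun _ : ι => -M - 1) (fun _ => M + 1), ∀ a b₀ : ι,
      ∑ i, (m i : ℝ) / Q < 0 → a ≠ b₀ → ∀ (g : γ → ι → ℤ) (t : ι → ℚ),
      (∀ j J, |∑ i, ℓ J i * g j i| ≤ Real.exp ((m J : ℝ) / Q * x)) →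
      (∀ i, i ≠ a → ∃ s : γ → ℚ, ∀ k,
        ((if k = i then 1 else 0) - (if k = a then t i else 0) : ℚ) = ∑ j, s j * g j k) →
      Real.log (max |((t b₀).num : ℝ)| ((t b₀).den : ℝ)) < c * x := by
    rw [Filter.eventually_all_finite (Set.finite_Icc _ _)]
    intro m _
    rw [Filter.eventually_all]
    intro a
    rw [Filter.eventually_all]
    intro b₀
    by_cases hneg : ∑ i, (m i : ℝ) / Q < 0
    · by_cases hab : a ≠ b₀
      · obtain ⟨X₀, hX₀⟩ := subspace_penultimate (γ := γ) ℓ halg hdet (fun i => (m i : ℝ) / Q) hneg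
          c hc a b₀ hab
        filter_upwards [Filter.eventually_ge_atTop X₀] with x hx _ _ g t h1 h2
        exact hX₀ x hx g t h1 h2
      · exact Filter.Eventually.of_forall fun x _ h => absurd h hab
    · exact Filter.Eventually.of_forall fun x h => absurd h hneg
  filter_upwards [hkey, Filter.eventually_ge_atTop 0] with x hx hx0 b hbB hbs a b₀ hab g t h1 h2
  have hup : ∀ i, b i ≤ (⌈b i * Q⌉ : ℝ) / Q := fun i => by
    rw [le_div_iff₀ hQ0]; exact Int.le_ceil _
  have hlo : ∀ i, (⌈b i * Q⌉ : ℝ) / Q ≤ b i + 1 / Q := fun i => by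
    rw [div_le_iff₀ hQ0, add_mul, one_div, inv_mul_cancel₀ hQ0.ne']
    exact (Int.ceil_lt_add_one _).le
  refine hx (fun i => ⌈b i * Q⌉) ⟨fun i => ?_, fun i => ?_⟩ a b₀ ?_ hab g t ?_ h2
  · have h3 : -(B * Q) ≤ b i * Q := by
      rw [← neg_mul]; exact mul_le_mul_of_nonneg_right (abs_le.1 (hbB i)).1 hQ0.le
    have h4 : (-M - 1 : ℝ) ≤ ⌈b i * Q⌉ := by
      have h5 := Int.ceil_lt_add_one (B * Q)
      have h6 := Int.le_ceil (b i * Q)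
      have h7 := Int.le_ceil (B * Q)
      rw [← hM] at h5 h7
      linarith
    exact_mod_cast h4
  · have h3 : b i * Q ≤ B * Q := mul_le_mul_of_nonneg_right (abs_le.1 (hbB i)).2 hQ0.le
    have h4 : ⌈b i * Q⌉ ≤ M := Int.ceil_mono h3
    change ⌈b i * Q⌉ ≤ M + 1
    omega
  · calc ∑ i, (⌈b i * Q⌉ : ℝ) / Q ≤ ∑ i, (b i + 1 / Q) := Finset.sum_le_sum fun i _ => hlo i
      _ = ∑ i, b i + Fintype.card ι / Q := by
          rw [Finset.sum_add_distrib, Finset.sum_const, Finset.card_univ, nsmul_eq_mul]; ring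
      _ < 0 := by
          have : (Fintype.card ι : ℝ) / Q < η := by rw [div_lt_iff₀ hQ0]; linarith
          linarith
  · intro j J
    exact (h1 j J).trans (Real.exp_le_exp.2 (mul_le_mul_of_nonneg_right (hup J) hx0))

lemma isAlgebraic_det {ι : Type*} [Fintype ι] [DecidableEq ι] (M : Matrix ι ι ℝ)
    (h : ∀ i j, IsAlgebraic ℚ (M i j)) : IsAlgebraic ℚ M.det := by
  have key : M.det ∈ algebraicClosure ℚ ℝ := by
    rw [Matrix.det_apply]
    refine sum_mem fun σ _ => ?_
    rw [Units.smul_def, zsmul_eq_mul]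
    exact mul_mem (intCast_mem _ _) (prod_mem fun i _ => mem_algebraicClosure_iff.2 (h _ _))
  exact mem_algebraicClosure_iff.1 key

/-- If two consecutive minima of a reduced basis are far apart, then the ratios of the minors that
describe the subspace spanned by the smaller vectors have small height. -/
lemma log_height_minor_ratio_lt {k p : ℕ} (hk : 0 < k) (hp : 0 < p)
    (L : Matrix (Fin (k + p)) (Fin (k + p)) ℝ) (halg : ∀ i j, IsAlgebraic ℚ (L i j))
    (hdet : L.det ≠ 0) (e : Fin (k + p) → ℝ) (he : ∑ i, e i = 0) (C C₀ B δ c : ℝ)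
    (hC : 1 ≤ C) (hB : 0 ≤ B) (hδ : 0 < δ) (hc : 0 < c) :
    ∀ᶠ x : ℝ in Filter.atTop, ∀ (y : Matrix (Fin (k + p)) (Fin (k + p)) ℤ)
      (π : Equiv.Perm (Fin (k + p))) (μ : Fin (k + p) → ℝ), Monotone μ →
      (∀ l j, |∑ i, L (π l) i * y j i| ≤ C * Real.exp (e (π l) * x + min (μ l) (μ j))) →
      ∑ i, μ i ≤ C₀ → (∀ i, |μ i| ≤ B * x) →
      δ * x ≤ μ ⟨k, by omega⟩ - μ ⟨k - 1, by omega⟩ →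
      ∀ Y : Matrix (Fin (k + p)) (Fin (k + p)) ℚ, Y * y.map (Int.cast : ℤ → ℚ) = 1 →
      ∀ a b₀ : Fin p ↪o Fin (k + p), (Y.submatrix a (Fin.natAdd k)).det ≠ 0 →
      ∀ t : ℚ, t = (Y.submatrix b₀ (Fin.natAdd k)).det / (Y.submatrix a (Fin.natAdd k)).det →
      Real.log (max |(t.num : ℝ)| (t.den : ℝ)) < c * x := by
  classical
  obtain ⟨w, hw⟩ := exists_sum_orderEmbedding_eq (k + p) p
  let I₀ : Fin p ↪o Fin (k + p) := Fin.natAddOrderEmb k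
  set C' : ℝ := p.factorial * C ^ p with hC'
  have hC'1 : 1 ≤ C' := by
    have h1 : (1 : ℝ) ≤ p.factorial := by exact_mod_cast Nat.one_le_iff_ne_zero.2 (Nat.factorial_ne_zero p)
    exact one_le_mul_of_one_le_of_one_le h1 (one_le_pow₀ hC)
  have hlogC' : 0 ≤ Real.log C' := Real.log_nonneg hC'1
  set N : ℝ := (Fintype.card (Fin p ↪o Fin (k + p)) : ℝ) with hN
  set B₁ : ℝ := p * ∑ i, |e i| + Real.log C' + (p + 2) * B with hB₁
  have hmain : ∀ᶠ x : ℝ in Filter.atTop, ∀ π : Equiv.Perm (Fin (k + p)),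
      ∀ b : (Fin p ↪o Fin (k + p)) → ℝ, (∀ i, |b i| ≤ B₁) → ∑ i, b i ≤ -(δ / 2) →
      ∀ a b₀ : Fin p ↪o Fin (k + p), a ≠ b₀ →
      ∀ (g : {I : Fin p ↪o Fin (k + p) // I ≠ I₀} → (Fin p ↪o Fin (k + p)) → ℤ)
        (t : (Fin p ↪o Fin (k + p)) → ℚ),
      (∀ j J, |∑ i, compoundMatrix p (L.submatrix π id) J i * g j i| ≤ Real.exp (b J * x)) →
      (∀ i, i ≠ a → ∃ s : {I : Fin p ↪o Fin (k + p) // I ≠ I₀} → ℚ, ∀ k,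
        ((if k = i then 1 else 0) - (if k = a then t i else 0) : ℚ) = ∑ j, s j * g j k) →
      Real.log (max |((t b₀).num : ℝ)| ((t b₀).den : ℝ)) < c * x := by
    rw [Filter.eventually_all]
    intro π
    refine subspace_penultimate_uniform _ ?_ ?_ B₁ (δ / 2) c (by linarith) hc
    · exact fun i j => isAlgebraic_det _ fun _ _ => halg _ _
    · apply det_compoundMatrix_ne_zero
      rw [Matrix.det_permute]
      refine mul_ne_zero ?_ hdet
      rcases Int.units_eq_one_or (Equiv.Perm.sign π) with h | h <;> simp [h]
  filter_upwards [hmain, Filter.eventually_ge_atTop 1,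
    Filter.eventually_ge_atTop (2 * (N * Real.log C' + w * C₀) / δ)] with x hx hx1 hx2
    y π μ hμ hyb hμs hμB hgap Y hY a b₀ ha t ht
  have hx0 : 0 < x := by linarith
  rcases eq_or_ne a b₀ with rfl | hab
  · rw [div_self ha] at ht
    rw [ht]
    simpa using mul_pos hc hx0
  set G : ℝ := μ ⟨k, by omega⟩ - μ ⟨k - 1, by omega⟩ with hG
  let S : (Fin p ↪o Fin (k + p)) → ℝ := fun J => ∑ a, μ (J a)
  let E : (Fin p ↪o Fin (k + p)) → ℝ := fun J => ∑ a, e (π (J a))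
  let b : (Fin p ↪o Fin (k + p)) → ℝ := fun J =>
    E J + (Real.log C' + S J - if J = I₀ then G else 0) / x
  let t' : (Fin p ↪o Fin (k + p)) → ℚ := fun J =>
    (Y.submatrix J (Fin.natAdd k)).det / (Y.submatrix a (Fin.natAdd k)).det
  have ht' : t' b₀ = t := ht.symm
  rw [← ht']
  have hSabs : ∀ J, |S J| ≤ p * (B * x) := fun J => by
    refine (Finset.abs_sum_le_sum_abs _ _).trans ((Finset.sum_le_sum fun a _ => hμB (J a)).trans ?_)
    simp
  have hEabs : ∀ J, |E J| ≤ p * ∑ i, |e i| := fun J => by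
    refine (Finset.abs_sum_le_sum_abs _ _).trans ((Finset.sum_le_sum fun a _ =>
      Finset.single_le_sum (f := fun i => |e i|) (fun i _ => abs_nonneg _)
        (Finset.mem_univ (π (J a)))).trans ?_)
    simp
  have hG0 : 0 ≤ G := (mul_pos hδ hx0).le.trans hgap
  have hGabs : G ≤ 2 * (B * x) := by
    have h1 := (abs_le.1 (hμB ⟨k, by omega⟩)).2
    have h2 := (abs_le.1 (hμB ⟨k - 1, by omega⟩)).1
    rw [hG]; linarith
  have hbexp : ∀ J, b J * x = E J * x + (Real.log C' + S J - if J = I₀ then G else 0) := by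
    intro J
    simp only [b]
    rw [add_mul, div_mul_cancel₀ _ hx0.ne']
  refine hx π b ?_ ?_ a b₀ hab
    (fun I K => compoundMatrix p y I.1 K) t' ?_ ?_
  · intro J
    have h1 : |(Real.log C' + S J - if J = I₀ then G else 0) / x| ≤ Real.log C' + (p + 2) * B := by
      rw [abs_div, abs_of_pos hx0, div_le_iff₀ hx0]
      have h2 : |if J = I₀ then G else 0| ≤ 2 * (B * x) := by
        split_ifs
        · rwa [abs_of_nonneg hG0]
        · rw [abs_zero]; positivity
      have h3 := abs_sub (Real.log C' + S J) (if J = I₀ then G else 0)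
      have h4 := abs_add_le (Real.log C') (S J)
      rw [abs_of_nonneg hlogC'] at h4
      have h5 := hSabs J
      have h6 : Real.log C' ≤ Real.log C' * x := le_mul_of_one_le_right hlogC' hx1
      have h7 : (Real.log C' + (p + 2) * B) * x = Real.log C' * x + p * (B * x) + 2 * (B * x) := by
        ring
      rw [h7]; linarith
    have h8 := abs_add_le (E J) ((Real.log C' + S J - if J = I₀ then G else 0) / x)
    have h9 := hEabs J
    rw [hB₁]; simp only [b]; linarith
  · have h1 : ∑ J, b J = (N * Real.log C' + w * ∑ i, μ i - G) / x := by
      simp only [b]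
      rw [Finset.sum_add_distrib, ← Finset.sum_div, Finset.sum_sub_distrib,
        Finset.sum_add_distrib]
      have h2 : ∑ J, E J = 0 := by
        have := hw fun i => e (π i)
        rw [Equiv.sum_comp π e, he, mul_zero] at this
        exact this
      have h3 : ∑ J, S J = w * ∑ i, μ i := hw μ
      rw [h2, h3, zero_add]
      simp [hN]
    rw [h1, div_le_iff₀ hx0]
    have h4 : (w : ℝ) * ∑ i, μ i ≤ w * C₀ := mul_le_mul_of_nonneg_left hμs (Nat.cast_nonneg w)
    rw [div_le_iff₀ hδ] at hx2
    linarith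
  · rintro ⟨I, hI⟩ J
    let M : Matrix (Fin (k + p)) (Fin (k + p)) ℝ :=
      L.submatrix π id * (y.map (Int.castRingHom ℝ)).transpose
    have hMl : ∀ l j, M l j = ∑ i, L (π l) i * y j i := fun l j => rfl
    have h1 : ∑ K, compoundMatrix p (L.submatrix π id) J K * (compoundMatrix p y I K : ℤ)
        = (M.submatrix J I).det := by
      rw [← compoundMatrix_apply, compoundMatrix_mul, compoundMatrix_transpose,
        compoundMatrix_map, Matrix.mul_apply]
      rfl
    rw [h1, hbexp]
    have hexp : ∀ s : ℝ, Real.exp (E J * x + (Real.log C' + s)) =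
        C' * Real.exp (E J * x) * Real.exp s := by
      intro s
      rw [Real.exp_add, Real.exp_add, Real.exp_log (by linarith)]; ring
    by_cases hJ : J = I₀
    · rw [if_pos hJ, add_sub_assoc, hexp]
      let R : Matrix (Fin p) (Fin p) ℝ := fun a b =>
        Real.exp (-(e (π (J a)) * x)) * M (J a) (I b)
      have h2 : M.submatrix J I = fun a b => Real.exp (e (π (J a)) * x) * R a b := by
        ext a b
        simp only [R]
        rw [← mul_assoc, ← Real.exp_add]
        simp
      have h3 : (M.submatrix J I).det = Real.exp (E J * x) * R.det := by
        rw [h2]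
        have := Matrix.det_mul_column (fun a => Real.exp (e (π (J a)) * x)) R
        rw [← Real.exp_sum, ← Finset.sum_mul] at this
        exact this
      have h4 := abs_det_le_of_col_le R C (fun b => Real.exp (μ (I b))) fun a b => by
        simp only [R]
        rw [abs_mul, Real.abs_exp, hMl]
        calc _ ≤ Real.exp (-(e (π (J a)) * x)) * (C * Real.exp (e (π (J a)) * x
              + min (μ (J a)) (μ (I b)))) :=
              mul_le_mul_of_nonneg_left (hyb _ _) (Real.exp_pos _).le
          _ = C * Real.exp (min (μ (J a)) (μ (I b))) := by
              rw [mul_left_comm, ← Real.exp_add]; congr 2; ring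
          _ ≤ _ := mul_le_mul_of_nonneg_left (Real.exp_le_exp.2 (min_le_right _ _)) (by linarith)
      rw [Fintype.card_fin, ← Real.exp_sum] at h4
      rw [h3, abs_mul, Real.abs_exp]
      have h5 := sum_orderEmbedding_le hk hp μ hμ I hI
      have h6 : ∑ a, μ (I a) ≤ S J - G := by
        rw [hJ]; exact h5
      calc Real.exp (E J * x) * |R.det| ≤ Real.exp (E J * x) * (C' * Real.exp (S J - G)) :=
            mul_le_mul_of_nonneg_left (h4.trans (mul_le_mul_of_nonneg_left (Real.exp_le_exp.2 h6)
              (by linarith))) (Real.exp_pos _).le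
        _ = _ := by ring
    · rw [if_neg hJ, sub_zero, hexp]
      have h4 := abs_det_le_of_row_le (M.submatrix J I) C
        (fun a => Real.exp (e (π (J a)) * x + μ (J a))) fun a b => by
          rw [Matrix.submatrix_apply, hMl]
          exact (hyb _ _).trans (mul_le_mul_of_nonneg_left (Real.exp_le_exp.2
            (add_le_add le_rfl (min_le_left _ _))) (by linarith))
      rw [Fintype.card_fin, ← Real.exp_sum, Finset.sum_add_distrib, ← Finset.sum_mul,
        Real.exp_add] at h4
      refine h4.trans (le_of_eq ?_)
      simp only [hC', E, S, mul_assoc]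
  · intro i _
    have hcomp : compoundMatrix p Y * (compoundMatrix p y).map (Int.cast : ℤ → ℚ) = 1 := by
      have : (compoundMatrix p y).map (Int.cast : ℤ → ℚ)
          = compoundMatrix p (y.map (Int.cast : ℤ → ℚ)) :=
        (compoundMatrix_map (Int.castRingHom ℚ) y).symm
      rw [this, ← compoundMatrix_mul, hY, compoundMatrix_one]
    have hrow : ∀ i K : Fin p ↪o Fin (k + p), ∑ I, compoundMatrix p Y i I * ((compoundMatrix p y I K : ℤ) : ℚ)
        = if K = i then 1 else 0 := by
      intro i K
      have := congrFun (congrFun hcomp i) K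
      rw [Matrix.mul_apply, Matrix.one_apply] at this
      simp only [Matrix.map_apply] at this
      rw [this]
      simp only [eq_comm]
    refine ⟨fun I => compoundMatrix p Y i I.1 - t' i * compoundMatrix p Y a I.1, fun K => ?_⟩
    have h1 : (if K = a then t' i else 0) = t' i * if K = a then 1 else 0 := by simp
    rw [h1, ← hrow i K, ← hrow a K, Finset.mul_sum, ← Finset.sum_sub_distrib,
      Fintype.sum_eq_add_sum_subtype_ne _ I₀]
    have h2 : compoundMatrix p Y i I₀ - t' i * compoundMatrix p Y a I₀ = 0 := by
      have h3 : compoundMatrix p Y a I₀ ≠ 0 := ha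
      have h4 : t' i = compoundMatrix p Y i I₀ / compoundMatrix p Y a I₀ := rfl
      rw [h4, div_mul_cancel₀ _ h3, sub_self]
    rw [← mul_assoc, ← sub_mul, h2, zero_mul, zero_add]
    refine Finset.sum_congr rfl fun I _ => ?_
    ring

/-- Liouville's inequality for integral linear combinations of algebraic numbers. -/
lemma exists_le_abs_int_combination {ι : Type*} [Fintype ι] (α : ι → ℝ)
    (halg : ∀ i, IsAlgebraic ℚ (α i)) (hli : LinearIndependent ℚ α) :
    ∃ c : ℝ, 0 < c ∧ ∃ m : ℕ, ∀ u : ι → ℤ, u ≠ 0 → ∀ B : ℝ, 1 ≤ B → (∀ i, |(u i : ℝ)| ≤ B) →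
      c ≤ B ^ m * |∑ i, α i * u i| := by
  classical
  let K := IntermediateField.adjoin ℚ (Set.range α)
  have hfin : FiniteDimensional ℚ K :=
    IntermediateField.finiteDimensional_adjoin (S := Set.range α) (by
      rintro _ ⟨i, rfl⟩
      exact (halg i).isIntegral)
  let α' : ι → K := fun i => ⟨α i, IntermediateField.subset_adjoin ℚ _ ⟨i, rfl⟩⟩
  obtain ⟨N, hN0, hN⟩ := exists_integral_multiples ℤ ℚ (L := K) (Finset.univ.image α')
  have hNint : ∀ i, IsIntegral ℤ (N • α' i) := fun i =>
    hN _ (Finset.mem_image_of_mem _ (Finset.mem_univ i))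
  let σ₀ : K →ₐ[ℚ] ℂ := (IsScalarTower.toAlgHom ℚ ℝ ℂ).comp K.val
  set T : ℝ := 1 + ∑ σ : K →ₐ[ℚ] ℂ, ∑ i, ‖σ (N • α' i)‖ with hT
  have hT1 : 1 ≤ T := by
    have : 0 ≤ ∑ σ : K →ₐ[ℚ] ℂ, ∑ i, ‖σ (N • α' i)‖ := by positivity
    linarith
  set m := (Finset.univ.erase σ₀).card with hm
  have hNpos : (0 : ℝ) < |(N : ℝ)| := abs_pos.2 (Int.cast_ne_zero.2 hN0)
  refine ⟨(|(N : ℝ)| * T ^ m)⁻¹, by positivity, m, fun u hu B hB huB => ?_⟩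
  set ξ : K := ∑ i, u i • (N • α' i) with hξ
  have hξint : IsIntegral ℤ ξ := IsIntegral.sum _ fun i _ => (hNint i).smul (u i)
  have hσξ : ∀ σ : K →ₐ[ℚ] ℂ, ‖σ ξ‖ ≤ T * B := by
    intro σ
    rw [hξ, map_sum]
    calc ‖∑ i, σ (u i • N • α' i)‖ ≤ ∑ i, ‖σ (u i • N • α' i)‖ := norm_sum_le _ _
      _ ≤ ∑ i, ‖σ (N • α' i)‖ * B := by
          refine Finset.sum_le_sum fun i _ => ?_
          rw [map_zsmul, zsmul_eq_mul, norm_mul, mul_comm, Complex.norm_intCast]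
          exact mul_le_mul_of_nonneg_left (huB i) (norm_nonneg _)
      _ = (∑ i, ‖σ (N • α' i)‖) * B := by rw [Finset.sum_mul]
      _ ≤ T * B := by
          refine mul_le_mul_of_nonneg_right ?_ (by linarith)
          have := Finset.single_le_sum (f := fun σ : K →ₐ[ℚ] ℂ => ∑ i, ‖σ (N • α' i)‖)
            (fun _ _ => by positivity) (Finset.mem_univ σ)
          linarith
  have hσ₀ξ : ‖σ₀ ξ‖ = |(N : ℝ)| * |∑ i, α i * u i| := by
    have h1 : σ₀ ξ = ((N * ∑ i, α i * u i : ℝ) : ℂ) := by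
      have h2 : ((ξ : K) : ℝ) = N * ∑ i, α i * u i := by
        rw [hξ, Finset.mul_sum, AddSubmonoidClass.coe_finsetSum]
        refine Finset.sum_congr rfl fun i _ => ?_
        simp only [zsmul_eq_mul, MulMemClass.coe_mul, SubringClass.coe_intCast, α']
        ring
      change ((((ξ : K) : ℝ)) : ℂ) = _
      rw [h2]
    rw [h1, Complex.norm_real, Real.norm_eq_abs, abs_mul]
  have hξ0 : ξ ≠ 0 := by
    intro h0
    rw [h0, map_zero, norm_zero] at hσ₀ξ
    have h1 : ∑ i, α i * u i = 0 := by
      rcases mul_eq_zero.1 hσ₀ξ.symm with h | h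
      · exact absurd h hNpos.ne'
      · exact abs_eq_zero.1 h
    apply hu
    have h2 := Fintype.linearIndependent_iff.1 hli (fun i => (u i : ℚ)) (by
      rw [← h1]
      refine Finset.sum_congr rfl fun i _ => ?_
      rw [Rat.smul_def]
      push_cast
      ring)
    ext i
    exact_mod_cast h2 i
  have hnorm : (1 : ℝ) ≤ ∏ σ : K →ₐ[ℚ] ℂ, ‖σ ξ‖ := by
    have h1 := Algebra.norm_eq_prod_embeddings ℚ ℂ ξ
    obtain ⟨z, hz⟩ := IsIntegrallyClosed.isIntegral_iff.1 (Algebra.isIntegral_norm ℚ hξint)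
    have hz0 : z ≠ 0 := by
      rintro rfl
      rw [map_zero] at hz
      exact hξ0 (Algebra.norm_eq_zero_iff.1 hz.symm)
    rw [← norm_prod, ← h1, ← hz]
    have : (algebraMap ℚ ℂ) ((algebraMap ℤ ℚ) z) = (z : ℂ) := by simp
    rw [this, Complex.norm_intCast]
    exact_mod_cast Int.one_le_abs hz0
  rw [← Finset.mul_prod_erase Finset.univ _ (Finset.mem_univ σ₀), hσ₀ξ] at hnorm
  have hprod : ∏ σ ∈ Finset.univ.erase σ₀, ‖σ ξ‖ ≤ (T * B) ^ m :=
    (Finset.prod_le_prod (fun _ _ => norm_nonneg _) fun σ _ => hσξ σ).trans_eq (Finset.prod_const _)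
  rw [inv_le_iff_one_le_mul₀ (by positivity)]
  calc 1 ≤ _ := hnorm
    _ ≤ |(N : ℝ)| * |∑ i, α i * u i| * (T * B) ^ m :=
        mul_le_mul_of_nonneg_left hprod (by positivity)
    _ = _ := by rw [mul_pow]; ring

/-- Liouville's inequality for rational linear combinations of algebraic numbers. -/
lemma exists_le_abs_rat_combination {ι : Type*} [Fintype ι] (α : ι → ℝ)
    (halg : ∀ i, IsAlgebraic ℚ (α i)) (hli : LinearIndependent ℚ α) :
    ∃ c : ℝ, 0 < c ∧ ∃ m : ℕ, ∀ r : ι → ℚ, r ≠ 0 → ∀ B : ℝ, 1 ≤ B →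
      (∀ i, max |((r i).num : ℝ)| ((r i).den : ℝ) ≤ B) → c ≤ B ^ m * |∑ i, α i * r i| := by
  classical
  obtain ⟨c, hc, m, h⟩ := exists_le_abs_int_combination α halg hli
  refine ⟨c, hc, (Fintype.card ι + 1) * m + Fintype.card ι, fun r hr B hB hrB => ?_⟩
  set D : ℕ := ∏ i, (r i).den with hD
  have hD0 : 0 < D := Finset.prod_pos fun i _ => (r i).den_pos
  have hDB : (D : ℝ) ≤ B ^ Fintype.card ι := by
    rw [hD, Nat.cast_prod]
    exact (Finset.prod_le_prod (fun _ _ => by positivity)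
      fun i _ => (le_max_right _ _).trans (hrB i)).trans_eq (Finset.prod_const _)
  let u : ι → ℤ := fun i => (r i).num * ∏ j ∈ Finset.univ.erase i, ((r j).den : ℤ)
  have hu : ∀ i, (u i : ℚ) = D * r i := by
    intro i
    have h1 : (D : ℚ) = (r i).den * ∏ j ∈ Finset.univ.erase i, ((r j).den : ℚ) := by
      rw [hD, Nat.cast_prod, Finset.mul_prod_erase Finset.univ (fun j => ((r j).den : ℚ)) (Finset.mem_univ i)]
    have h2 : ((r i).den : ℚ) * r i = (r i).num := Rat.den_mul_eq_num _
    simp only [u]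
    push_cast
    rw [h1, ← h2]
    ring
  have hu' : ∀ i, (u i : ℝ) = D * r i := fun i => by exact_mod_cast congrArg (Rat.cast : ℚ → ℝ) (hu i)
  have hrabs : ∀ i, |(r i : ℝ)| ≤ B := by
    intro i
    have h1 : (r i : ℝ) = (r i).num / (r i).den := Rat.cast_def _
    have h2 : (1 : ℝ) ≤ (r i).den := by exact_mod_cast (r i).den_pos
    rw [h1, abs_div, abs_of_pos (by linarith : (0 : ℝ) < (r i).den)]
    exact (div_le_self (abs_nonneg _) h2).trans ((le_max_left _ _).trans (hrB i))
  have hu0 : u ≠ 0 := by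
    intro h0
    apply hr
    ext i
    have := hu i
    rw [h0] at this
    simp only [Pi.zero_apply, Int.cast_zero] at this
    rcases mul_eq_zero.1 this.symm with h | h
    · exact absurd (Nat.cast_eq_zero.1 h) hD0.ne'
    · simpa using h
  have h1 := h u hu0 (B ^ (Fintype.card ι + 1)) (one_le_pow₀ hB) fun i => by
    rw [hu', abs_mul, abs_of_nonneg (Nat.cast_nonneg D), pow_succ]
    exact mul_le_mul hDB (hrabs i) (abs_nonneg _) (by positivity)
  have h2 : ∑ i, α i * u i = D * ∑ i, α i * r i := by
    rw [Finset.mul_sum]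
    exact Finset.sum_congr rfl fun i _ => by rw [hu']; ring
  rw [h2, abs_mul, abs_of_nonneg (Nat.cast_nonneg D), ← pow_mul] at h1
  refine h1.trans ?_
  rw [pow_add, mul_assoc]
  refine mul_le_mul_of_nonneg_left ?_ (by positivity)
  exact mul_le_mul_of_nonneg_right hDB (abs_nonneg _)

lemma exists_orderEmbedding_det_submatrix {R : Type*} [CommRing R] {n p : ℕ}
    (W : Matrix (Fin n) (Fin p) R) (f : Fin p → Fin n) (hf : Function.Injective f) :
    ∃ J : Fin p ↪o Fin n, (W.submatrix f id).det = (W.submatrix J id).det ∨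
      (W.submatrix f id).det = -(W.submatrix J id).det := by
  have hmono : StrictMono (f ∘ Tuple.sort f) :=
    (Tuple.monotone_sort f).strictMono_of_injective (hf.comp (Tuple.sort f).injective)
  refine ⟨OrderEmbedding.ofStrictMono _ hmono, ?_⟩
  have h1 : (W.submatrix (OrderEmbedding.ofStrictMono _ hmono) id)
      = (W.submatrix f id).submatrix (Tuple.sort f) id := rfl
  rw [h1, Matrix.det_permute]
  rcases Int.units_eq_one_or (Equiv.Perm.sign (Tuple.sort f)) with h | h <;> simp [h]

lemma exists_orderEmbedding_det_ne_zero {k p : ℕ} (Y : Matrix (Fin (k + p)) (Fin (k + p)) ℚ)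
    (hY : Y.det ≠ 0) : ∃ a : Fin p ↪o Fin (k + p), (Y.submatrix a (Fin.natAdd k)).det ≠ 0 := by
  by_contra! h
  refine det_compoundMatrix_ne_zero (p := p) Y hY ?_
  exact Matrix.det_eq_zero_of_column_eq_zero (Fin.natAddOrderEmb k) h

/-- A linear form that is small on the first `k` rows of a unimodular-like integer matrix takes a
small value at a rational vector whose coordinates are ratios of minors of the inverse matrix. -/
lemma exists_rat_vector_of_inverse {k p : ℕ} (y : Matrix (Fin (k + p)) (Fin (k + p)) ℤ)
    (Y : Matrix (Fin (k + p)) (Fin (k + p)) ℚ) (hY : Y * y.map (Int.cast : ℤ → ℚ) = 1)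
    (a : Fin p ↪o Fin (k + p)) (ha : (Y.submatrix a (Fin.natAdd k)).det ≠ 0)
    (α : Fin (k + p) → ℝ) (C D : ℝ) (hC : 1 ≤ C) (hD : 0 < D) (R : Fin k → ℝ)
    (hR : ∀ i j, |(y (Fin.castAdd p i) j : ℝ)| ≤ C * R i)
    (hl : ∀ i, D * |∑ j, α j * y (Fin.castAdd p i) j| ≤ C * R i)
    (j : Fin (k + p)) (hj : j ∉ Set.range a) :
    ∃ r : Fin (k + p) → ℚ, r ≠ 0 ∧
      (∀ i, r i = 0 ∨ r i = 1 ∨ ∃ J : Fin p ↪o Fin (k + p),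
        r i = (Y.submatrix J (Fin.natAdd k)).det / (Y.submatrix a (Fin.natAdd k)).det ∨
        r i = -((Y.submatrix J (Fin.natAdd k)).det / (Y.submatrix a (Fin.natAdd k)).det)) ∧
      D * |∑ i, α i * r i| ≤ (k + p).factorial * C ^ (k + p) * ∏ i, R i := by
  classical
  set W : Matrix (Fin (k + p)) (Fin p) ℚ := Y.submatrix id (Fin.natAdd k) with hW
  set V : Matrix (Fin p) (Fin p) ℚ := Y.submatrix a (Fin.natAdd k) with hV
  let W' : Fin (k + p) → Fin p → ℚ := fun i m => V.transpose.cramer (W i) m / V.det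
  have hyY : y.map (Int.cast : ℤ → ℚ) * Y = 1 := mul_eq_one_comm.1 hY
  have hW'a : ∀ m m', W' (a m) m' = if m = m' then 1 else 0 := by
    intro m m'
    have h1 : V.transpose.cramer (W (a m)) = Pi.single m V.det := Matrix.cramer_transpose_row_self V m
    simp only [W', h1, Pi.single_apply, eq_comm (a := m')]
    split_ifs
    · exact div_self ha
    · exact zero_div _
  have hyW' : ∀ (i : Fin k) m, ∑ q, (y (Fin.castAdd p i) q : ℚ) * W' q m = 0 := by
    intro i m
    have h0 : ∑ q, (y (Fin.castAdd p i) q : ℚ) • W q = 0 := by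
      ext m'
      have h1 := congrFun (congrFun hyY (Fin.castAdd p i)) (Fin.natAdd k m')
      rw [Matrix.one_apply_ne (by intro h; have := congrArg Fin.val h; simp at this; omega)] at h1
      rw [Matrix.mul_apply] at h1
      simpa [Finset.sum_apply, hW] using h1
    have h2 : ∑ q, (y (Fin.castAdd p i) q : ℚ) * V.transpose.cramer (W q) m = 0 := by
      have h3 := congrFun (congrArg V.transpose.cramer h0) m
      rw [map_sum, Finset.sum_apply, map_zero] at h3
      refine Eq.trans (Finset.sum_congr rfl fun q _ => ?_) h3
      rw [map_smul]
      rfl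
    calc _ = (∑ q, (y (Fin.castAdd p i) q : ℚ) * V.transpose.cramer (W q) m) / V.det := by
          rw [Finset.sum_div]
          exact Finset.sum_congr rfl fun q _ => by simp only [W']; ring
      _ = 0 := by rw [h2, zero_div]
  let θ : Fin (k + p) → ℝ := fun q => α q - ∑ m, α (a m) * W' q m
  let r : Fin (k + p) → ℚ := fun i => (if i = j then 1 else 0) - ∑ m, if a m = i then W' j m else 0
  have hra : ∀ m, r (a m) = -W' j m := by
    intro m
    have h1 : a m ≠ j := fun h => hj ⟨m, h⟩
    simp [r, h1]
  have hrn : ∀ i, i ∉ Set.range a → r i = if i = j then 1 else 0 := by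
    intro i hi
    have : ∀ m, a m ≠ i := fun m h => hi ⟨m, h⟩
    simp [r, this]
  have hθr : ∑ i, α i * r i = θ j := by
    simp only [r, θ, Rat.cast_sub, Rat.cast_sum, mul_sub, Finset.sum_sub_distrib]
    refine congrArg₂ _ ?_ ?_
    · simp [apply_ite (Rat.cast : ℚ → ℝ)]
    · simp only [Finset.mul_sum]
      rw [Finset.sum_comm]
      refine Finset.sum_congr rfl fun m _ => ?_
      rw [Finset.sum_eq_single (a m)]
      · simp
      · intro b _ hb; simp [hb.symm]
      · simp
  refine ⟨r, ?_, ?_, ?_⟩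
  · intro h0
    have h1 := hrn j hj
    rw [h0] at h1
    simp at h1
  · intro i
    by_cases hi : i ∈ Set.range a
    · obtain ⟨m, rfl⟩ := hi
      right; right
      have hf : Function.Injective (Function.update a m j) := by
        intro m₁ m₂ h
        by_cases h1 : m₁ = m <;> by_cases h2 : m₂ = m
        · rw [h1, h2]
        · rw [h1, Function.update_self, Function.update_of_ne h2] at h
          exact absurd ⟨m₂, h.symm⟩ hj
        · rw [h2, Function.update_self, Function.update_of_ne h1] at h
          exact absurd ⟨m₁, h⟩ hj
        · rw [Function.update_of_ne h1, Function.update_of_ne h2] at h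
          exact a.injective h
      obtain ⟨J, hJ⟩ := exists_orderEmbedding_det_submatrix W _ hf
      have h1 : V.transpose.cramer (W j) m = (W.submatrix (Function.update a m j) id).det := by
        rw [Matrix.cramer_transpose_apply]
        congr 1
        ext m₁ m₂
        by_cases h1 : m₁ = m
        · subst h1; simp [hW]
        · simp [h1, hW, hV]
      have h2 : (W.submatrix J id) = Y.submatrix J (Fin.natAdd k) := rfl
      refine ⟨J, ?_⟩
      rw [hra]
      simp only [W', h1]
      rw [h2] at hJ
      rcases hJ with hJ | hJ
      · right; rw [hJ]
      · left; rw [hJ]; ring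
    · rw [hrn i hi]
      split_ifs
      · exact Or.inr (Or.inl rfl)
      · exact Or.inl rfl
  · rw [hθr]
    let Z : Matrix (Fin (k + p)) (Fin (k + p)) ℤ :=
      fun i => Fin.addCases (fun i => y (Fin.castAdd p i)) (fun m => Pi.single (a m) 1) i
    have hZl : ∀ i q, Z (Fin.castAdd p i) q = y (Fin.castAdd p i) q := fun i q => by simp [Z]
    have hZr : ∀ m q, Z (Fin.natAdd k m) q = if q = a m then 1 else 0 := fun m q => by
      simp [Z, Pi.single_apply]
    have hZdet : Z.det ≠ 0 := by
      intro h0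
      have h1 : (Z.map (Int.cast : ℤ → ℚ) * Y).det = V.det := by
        rw [← Matrix.det_submatrix_equiv_self finSumFinEquiv]
        have : (Z.map (Int.cast : ℤ → ℚ) * Y).submatrix finSumFinEquiv finSumFinEquiv
            = Matrix.fromBlocks 1 0 (Y.submatrix a (Fin.castAdd p)) V := by
          ext i i'
          rcases i with i | m
          · have h2 : (Z.map (Int.cast : ℤ → ℚ) * Y) (Fin.castAdd p i)
                = (1 : Matrix (Fin (k + p)) (Fin (k + p)) ℚ) (Fin.castAdd p i) := by
              rw [← hyY]
              ext q
              simp only [Matrix.mul_apply, Matrix.map_apply, hZl]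
            rw [Matrix.submatrix_apply, finSumFinEquiv_apply_left, h2]
            rcases i' with i' | m'
            · simp [Matrix.one_apply]
            · simp only [Matrix.fromBlocks_apply₁₂, Matrix.zero_apply]
              exact Matrix.one_apply_ne (by intro h; have := congrArg Fin.val h; simp at this; omega)
          · have h2 : ∀ q, (Z.map (Int.cast : ℤ → ℚ) * Y) (Fin.natAdd k m) q = Y (a m) q := by
              intro q
              simp [Matrix.mul_apply, hZr]
            rw [Matrix.submatrix_apply, finSumFinEquiv_apply_right, h2]
            rcases i' with i' | m' <;> simp [hV]
        rw [this, Matrix.det_fromBlocks_zero₁₂, Matrix.det_one, one_mul]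
      rw [Matrix.det_mul] at h1
      have h2 : (Z.map (Int.cast : ℤ → ℚ)).det = ((Z.det : ℤ) : ℚ) := by
        simpa using (RingHom.map_det (Int.castRingHom ℚ) Z).symm
      rw [h2, h0, Int.cast_zero, zero_mul] at h1
      exact ha h1.symm
    set Zr : Matrix (Fin (k + p)) (Fin (k + p)) ℝ := Z.map (Int.cast : ℤ → ℝ) with hZr'
    have hZr1 : 1 ≤ |Zr.det| := by
      have h2 : Zr.det = ((Z.det : ℤ) : ℝ) := by
        simpa using (RingHom.map_det (Int.castRingHom ℝ) Z).symm
      rw [h2]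
      exact_mod_cast Int.one_le_abs hZdet
    let lv : Fin (k + p) → ℝ :=
      fun i => Fin.addCases (fun i => ∑ j, α j * y (Fin.castAdd p i) j) (fun _ => 0) i
    have hZθ : Zr.mulVec θ = lv := by
      ext i
      refine Fin.addCases (fun i => ?_) (fun m => ?_) i
      · have h1 : ∀ m, ∑ q, (y (Fin.castAdd p i) q : ℝ) * W' q m = 0 := fun m => by
          exact_mod_cast congrArg (Rat.cast : ℚ → ℝ) (hyW' i m)
        simp only [Matrix.mulVec, dotProduct, hZr', Matrix.map_apply, hZl, θ, lv, Fin.addCases_left,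
          mul_sub, Finset.sum_sub_distrib]
        have h2 : ∑ q, (y (Fin.castAdd p i) q : ℝ) * ∑ m, α (a m) * W' q m = 0 := by
          simp only [Finset.mul_sum]
          rw [Finset.sum_comm]
          refine Finset.sum_eq_zero fun m _ => ?_
          rw [← mul_zero (α (a m)), ← h1 m, Finset.mul_sum]
          exact Finset.sum_congr rfl fun q _ => by ring
        rw [h2, sub_zero]
        exact Finset.sum_congr rfl fun q _ => mul_comm _ _
      · simp [Matrix.mulVec, dotProduct, hZr', hZr, θ, lv, hW'a, apply_ite (Rat.cast : ℚ → ℝ)]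
    have hcr : Zr.det * θ j = (Zr.updateCol j lv).det := by
      rw [← hZθ, ← Matrix.cramer_apply, Matrix.cramer_eq_adjugate_mulVec, Matrix.mulVec_mulVec,
        Matrix.adjugate_mul, Matrix.smul_mulVec, Matrix.one_mulVec]
      rfl
    have hdet : D * |Zr.det * θ j| = |(Zr.updateCol j (D • lv)).det| := by
      rw [Matrix.det_updateCol_smul, hcr, abs_mul, abs_of_pos hD]
    let R' : Fin (k + p) → ℝ := fun i => Fin.addCases R (fun _ => 1) i
    have hbd : ∀ i q, |(Zr.updateCol j (D • lv)) i q| ≤ C * R' i := by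
      intro i q
      refine Fin.addCases (fun i => ?_) (fun m => ?_) i
      · by_cases hq : q = j
        · subst hq
          simpa [lv, R', abs_mul, abs_of_pos hD] using hl i
        · simpa [Matrix.updateCol_ne hq, hZr', hZl, R'] using hR i q
      · by_cases hq : q = j
        · subst hq
          simp [lv, R']; linarith
        · simp only [Matrix.updateCol_ne hq, hZr', Matrix.map_apply, hZr, R', Fin.addCases_right, mul_one]
          split_ifs <;> simp <;> linarith
    have hfin := abs_det_le_of_row_le _ C R' hbd
    rw [← hdet, Fintype.card_fin, Fin.prod_univ_add] at hfin
    simp only [R', Fin.addCases_left, Fin.addCases_right, Finset.prod_const_one, mul_one] at hfin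
    refine le_trans ?_ hfin
    rw [abs_mul]
    exact mul_le_mul_of_nonneg_left (le_mul_of_one_le_left (abs_nonneg _) hZr1) hD.le

lemma abs_coord_le_of_form_le {ι : Type*} [Fintype ι] [DecidableEq ι] (α : ι → ℝ) (z : ι)
    (hz : α z ≠ 0) (v : ι → ℝ) (M : ℝ) (hM : 0 ≤ M) (hl : |∑ i, α i * v i| ≤ M)
    (hv : ∀ i, i ≠ z → |v i| ≤ M) (i : ι) : |v i| ≤ (1 + (1 + ∑ i, |α i|) / |α z|) * M := by
  have hz' : 0 < |α z| := abs_pos.2 hz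
  have hnn : 0 ≤ (1 + ∑ i, |α i|) / |α z| := by positivity
  by_cases hi : i = z
  · subst hi
    have h1 : α i * v i = ∑ i, α i * v i - ∑ q ∈ Finset.univ.erase i, α q * v q := by
      rw [← Finset.add_sum_erase _ _ (Finset.mem_univ i)]; ring
    have h2 : |∑ q ∈ Finset.univ.erase i, α q * v q| ≤ (∑ i, |α i|) * M := by
      refine (Finset.abs_sum_le_sum_abs _ _).trans ?_
      rw [Finset.sum_mul]
      calc _ ≤ ∑ q ∈ Finset.univ.erase i, |α q| * M := Finset.sum_le_sum fun q hq => by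
            rw [abs_mul]
            exact mul_le_mul_of_nonneg_left (hv q (Finset.ne_of_mem_erase hq)) (abs_nonneg _)
        _ ≤ _ := Finset.sum_le_sum_of_subset_of_nonneg (Finset.erase_subset _ _)
            fun q _ _ => by positivity
    have h3 : |α i| * |v i| ≤ (1 + ∑ i, |α i|) * M := by
      rw [← abs_mul, h1]
      refine (abs_sub _ _).trans ?_
      linarith
    have h4 : |v i| ≤ (1 + ∑ i, |α i|) / |α i| * M := by
      rw [div_mul_eq_mul_div, le_div_iff₀ hz']
      linarith
    linarith
  · have := hv i hi
    have h5 := mul_nonneg hnn hM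
    linarith

lemma sum_castAdd_le_of_monotone {k p : ℕ} (μ : Fin (k + p) → ℝ) (hμ : Monotone μ) (C₀ : ℝ)
    (h : ∑ i, μ i ≤ C₀) : ∑ i : Fin k, μ (Fin.castAdd p i) ≤ max C₀ 0 := by
  by_cases h0 : ∑ i : Fin k, μ (Fin.castAdd p i) ≤ 0
  · exact h0.trans (le_max_right _ _)
  push Not at h0
  obtain ⟨i, -, hi⟩ := Finset.exists_lt_of_sum_lt (s := Finset.univ)
    (f := fun _ : Fin k => (0 : ℝ)) (g := fun i => μ (Fin.castAdd p i)) (by simpa using h0)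
  rw [Fin.sum_univ_add] at h
  have h1 : 0 ≤ ∑ m : Fin p, μ (Fin.natAdd k m) := Finset.sum_nonneg fun m _ =>
    hi.le.trans (hμ (by rw [Fin.le_def, Fin.val_castAdd, Fin.val_natAdd]; omega))
  exact le_max_of_le_left (by linarith)

/-- For the system consisting of a linear form with algebraic, linearly independent coefficients and
of coordinate forms, the successive minima have no large gaps. -/
lemma eventually_gap_lt {k p : ℕ} (hk : 0 < k) (hp : 0 < p) (α : Fin (k + p) → ℝ)
    (halg : ∀ i, IsAlgebraic ℚ (α i)) (hli : LinearIndependent ℚ α) (z : Fin (k + p))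
    (C C₀ B δ : ℝ) (hC : 1 ≤ C) (hB : 0 ≤ B) (hδ : 0 < δ) :
    ∀ᶠ x : ℝ in Filter.atTop, ∀ (y : Matrix (Fin (k + p)) (Fin (k + p)) ℤ)
      (π : Equiv.Perm (Fin (k + p))) (μ : Fin (k + p) → ℝ), y.det ≠ 0 → Monotone μ →
      (∀ l j, |∑ i, (Matrix.updateRow (1 : Matrix (Fin (k + p)) (Fin (k + p)) ℝ) z α) (π l) i * y j i|
        ≤ C * Real.exp ((if π l = z then -((k + p : ℕ) - 1 : ℝ) else 1) * x + min (μ l) (μ j))) →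
      ∑ i, μ i ≤ C₀ → (∀ i, |μ i| ≤ B * x) →
      μ ⟨k, by omega⟩ - μ ⟨k - 1, by omega⟩ < δ * x := by
  classical
  obtain ⟨c₁, hc₁, m, hm⟩ := exists_le_abs_rat_combination α halg hli
  have hαz : α z ≠ 0 := hli.ne_zero z
  set L := Matrix.updateRow (1 : Matrix (Fin (k + p)) (Fin (k + p)) ℝ) z α with hL
  have hLdet : L.det ≠ 0 := by
    have h1 := Matrix.cramer_transpose_apply (1 : Matrix (Fin (k + p)) (Fin (k + p)) ℝ) α z
    rw [Matrix.transpose_one, Matrix.cramer_one] at h1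
    rw [hL, ← h1]
    exact hαz
  have hLalg : ∀ i j, IsAlgebraic ℚ (L i j) := by
    intro i j
    by_cases hi : i = z
    · subst hi; simpa [hL] using halg j
    · rw [hL, Matrix.updateRow_ne hi, Matrix.one_apply]
      split_ifs
      · exact isAlgebraic_one
      · exact isAlgebraic_zero
  have hLz : ∀ v : Fin (k + p) → ℤ, ∑ i, L z i * v i = ∑ i, α i * v i := fun v => by simp [hL]
  have hLn : ∀ i, i ≠ z → ∀ v : Fin (k + p) → ℤ, ∑ q, L i q * v q = v i := fun i hi v => by
    simp [hL, Matrix.updateRow_ne hi, Matrix.one_apply]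
  set c : ℝ := 1 / (2 * (m + 1)) with hcdef
  have hc : 0 < c := by positivity
  set e : Fin (k + p) → ℝ := fun i => if i = z then -((k + p : ℕ) - 1 : ℝ) else 1 with he
  have hesum : ∑ i, e i = 0 := by
    rw [he, Finset.sum_ite, Finset.filter_eq' Finset.univ z, if_pos (Finset.mem_univ z),
      Finset.filter_ne', Finset.sum_singleton, Finset.sum_const, Finset.card_erase_of_mem (Finset.mem_univ _),
      Finset.card_univ, Fintype.card_fin, nsmul_eq_mul, Nat.cast_sub (by omega)]
    simp
  set C₁ : ℝ := (1 + (1 + ∑ i, |α i|) / |α z|) * C with hC₁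
  have hnn : 0 ≤ (1 + ∑ i, |α i|) / |α z| := by positivity
  have hC₁C : C ≤ C₁ := by
    have := mul_nonneg hnn (by linarith : 0 ≤ C)
    rw [hC₁]; linarith
  set K : ℝ := (k + p).factorial * C₁ ^ (k + p) * Real.exp (max C₀ 0) with hK
  have hlarge : ∀ᶠ x : ℝ in Filter.atTop, K * Real.exp (-x / 2) < c₁ := by
    have h1 : Filter.Tendsto (fun x : ℝ => K * Real.exp (-x / 2)) Filter.atTop (nhds (K * 0)) := by
      refine Filter.Tendsto.const_mul _ (Real.tendsto_exp_atBot.comp ?_)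
      exact (Filter.tendsto_neg_atTop_atBot).atBot_div_const (by norm_num)
    rw [mul_zero] at h1
    exact h1.eventually (gt_mem_nhds hc₁)
  filter_upwards [log_height_minor_ratio_lt hk hp L hLalg hLdet e hesum C C₀ B δ c hC hB hδ hc,
    hlarge, Filter.eventually_ge_atTop 0] with x hx hxl hx0 y π μ hy hμ hbd hsum hμB
  by_contra! hgap
  set yq := y.map (Int.cast : ℤ → ℚ) with hyq
  have hyqdet : yq.det ≠ 0 := by
    have h2 : yq.det = ((y.det : ℤ) : ℚ) := by
      simpa using (RingHom.map_det (Int.castRingHom ℚ) y).symm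
    rw [h2]
    exact_mod_cast hy
  have hY : yq⁻¹ * yq = 1 := Matrix.nonsing_inv_mul _ (isUnit_iff_ne_zero.2 hyqdet)
  obtain ⟨a, ha⟩ := exists_orderEmbedding_det_ne_zero (k := k) (p := p) yq⁻¹ (by
    rw [Matrix.det_nonsing_inv, Ring.inverse_eq_inv']
    exact inv_ne_zero hyqdet)
  obtain ⟨j, hj⟩ : ∃ j, j ∉ Set.range a := by
    by_contra! h
    have := Fintype.card_le_of_surjective a h
    simp at this
    omega
  have hheight := hx y π μ hμ hbd hsum hμB hgap yq⁻¹ hY a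
  have hrow : ∀ i j, |∑ q, L i q * y j q| ≤ C * Real.exp (e i * x + μ j) := by
    intro i j
    have h1 := hbd (π.symm i) j
    rw [Equiv.apply_symm_apply] at h1
    refine h1.trans (mul_le_mul_of_nonneg_left (Real.exp_le_exp.2 ?_) (by linarith))
    exact add_le_add le_rfl (min_le_right _ _)
  have hform : ∀ j, |∑ q, α q * y j q| ≤ C * Real.exp (-((k + p : ℕ) - 1 : ℝ) * x + μ j) := by
    intro j
    have h1 := hrow z j
    rw [hLz] at h1
    simpa only [he, if_true] using h1
  have hcoord : ∀ j i, |(y j i : ℝ)| ≤ C₁ * Real.exp (x + μ j) := by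
    intro j i
    rw [hC₁, mul_assoc]
    refine abs_coord_le_of_form_le α z hαz (fun q => (y j q : ℝ)) _ (by positivity) ?_ ?_ i
    · refine (hform j).trans (mul_le_mul_of_nonneg_left (Real.exp_le_exp.2 ?_) (by linarith))
      have h1 : (1 : ℝ) ≤ (k + p : ℕ) := by exact_mod_cast (by omega : 1 ≤ k + p)
      have h2 := mul_nonneg (by linarith : (0 : ℝ) ≤ (k + p : ℕ) - 1) hx0
      linarith
    · intro i hi
      have h1 := hrow i j
      rw [hLn i hi] at h1
      simpa only [he, if_neg hi, one_mul] using h1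
  obtain ⟨r, hr0, hrJ, hrb⟩ := exists_rat_vector_of_inverse y yq⁻¹ hY a ha α C₁ (Real.exp ((k + p : ℕ) * x))
    (hC.trans hC₁C) (Real.exp_pos _) (fun i => Real.exp (x + μ (Fin.castAdd p i)))
    (fun i j => hcoord _ j) (fun i => by
      refine (mul_le_mul_of_nonneg_left (hform _) (Real.exp_pos _).le).trans ?_
      rw [mul_left_comm, ← Real.exp_add]
      refine mul_le_mul hC₁C (Real.exp_le_exp.2 (by linarith)) (Real.exp_pos _).le (by linarith)) j hj
  have hexp1 : 1 ≤ Real.exp (c * x) := Real.one_le_exp (by positivity)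
  have hrB : ∀ i, max |((r i).num : ℝ)| ((r i).den : ℝ) ≤ Real.exp (c * x) := by
    intro i
    have hpos : ∀ t : ℚ, 0 < max |(t.num : ℝ)| (t.den : ℝ) := fun t =>
      lt_max_of_lt_right (by exact_mod_cast t.den_pos)
    rcases hrJ i with h | h | ⟨J, h | h⟩
    · rw [h]; simpa using hexp1
    · rw [h]; simpa using hexp1
    · exact ((Real.log_lt_iff_lt_exp (hpos _)).1 (hheight J ha _ h)).le
    · have h1 := ((Real.log_lt_iff_lt_exp (hpos _)).1 (hheight J ha (-r i) (by rw [h, neg_neg]))).le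
      simpa using h1
  have hlow := hm r hr0 _ hexp1 hrB
  have hprod : ∏ i : Fin k, Real.exp (x + μ (Fin.castAdd p i)) ≤ Real.exp (k * x) * Real.exp (max C₀ 0) := by
    rw [← Real.exp_sum, ← Real.exp_add, Real.exp_le_exp, Finset.sum_add_distrib]
    have h1 := sum_castAdd_le_of_monotone μ hμ C₀ hsum
    simp only [Finset.sum_const, Finset.card_univ, Fintype.card_fin, nsmul_eq_mul]
    linarith
  have hC₁0 : 0 ≤ C₁ := by linarith
  have hup : |∑ i, α i * r i| ≤ K * Real.exp (-x) := by
    have h1 := hrb.trans (mul_le_mul_of_nonneg_left hprod (by positivity))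
    have h2 : (k + p).factorial * C₁ ^ (k + p) * (Real.exp (k * x) * Real.exp (max C₀ 0))
        = K * Real.exp (k * x) := by rw [hK]; ring
    rw [h2] at h1
    have h3 : |∑ i, α i * r i| ≤ K * Real.exp (k * x) * Real.exp (-((k + p : ℕ) * x)) := by
      rw [Real.exp_neg, ← div_eq_mul_inv, le_div_iff₀ (Real.exp_pos _), mul_comm]
      exact h1
    refine h3.trans ?_
    rw [mul_assoc, ← Real.exp_add]
    refine mul_le_mul_of_nonneg_left (Real.exp_le_exp.2 ?_) (by positivity)
    have h4 : x ≤ p * x := le_mul_of_one_le_left hx0 (by exact_mod_cast hp)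
    push_cast
    linarith
  have hpow : Real.exp (c * x) ^ m ≤ Real.exp (x / 2) := by
    rw [← Real.exp_nat_mul, Real.exp_le_exp, hcdef]
    have h1 : (m : ℝ) * (1 / (2 * (m + 1)) * x) = (m / (m + 1)) * (x / 2) := by field_simp
    rw [h1]
    refine mul_le_of_le_one_left (by linarith) ?_
    rw [div_le_one (by positivity)]
    linarith
  have hcontra : c₁ ≤ K * Real.exp (-x / 2) := by
    calc c₁ ≤ _ := hlow
      _ ≤ Real.exp (x / 2) * (K * Real.exp (-x)) :=
        mul_le_mul hpow hup (abs_nonneg _) (Real.exp_pos _).le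
      _ = K * (Real.exp (x / 2) * Real.exp (-x)) := by ring
      _ = _ := by rw [← Real.exp_add]; congr 2; ring
  linarith

lemma eventually_gap_lt_of_lt {n k : ℕ} (hk : 0 < k) (hkn : k < n) (α : Fin n → ℝ)
    (halg : ∀ i, IsAlgebraic ℚ (α i)) (hli : LinearIndependent ℚ α) (z : Fin n)
    (C C₀ B δ : ℝ) (hC : 1 ≤ C) (hB : 0 ≤ B) (hδ : 0 < δ) :
    ∀ᶠ x : ℝ in Filter.atTop, ∀ (y : Matrix (Fin n) (Fin n) ℤ)
      (π : Equiv.Perm (Fin n)) (μ : Fin n → ℝ), y.det ≠ 0 → Monotone μ →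
      (∀ l j, |∑ i, (Matrix.updateRow (1 : Matrix (Fin n) (Fin n) ℝ) z α) (π l) i * y j i|
        ≤ C * Real.exp ((if π l = z then -((n : ℝ) - 1) else 1) * x + min (μ l) (μ j))) →
      ∑ i, μ i ≤ C₀ → (∀ i, |μ i| ≤ B * x) →
      μ ⟨k, hkn⟩ - μ ⟨k - 1, by omega⟩ < δ * x := by
  obtain ⟨p, rfl⟩ := Nat.exists_eq_add_of_lt hkn
  exact eventually_gap_lt (p := p + 1) hk (by omega) α halg hli z C C₀ B δ hC hB hδ

/-- A lower bound for a linear form with algebraic coefficients, in exponential normalization. -/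
lemma eventually_exp_lt_abs_form {n : ℕ} (hn : 2 ≤ n) (α : Fin n → ℝ)
    (halg : ∀ i, IsAlgebraic ℚ (α i)) (hli : LinearIndependent ℚ α) (δ : ℝ) (hδ : 0 < δ) :
    ∀ᶠ x : ℝ in Filter.atTop, ∀ X : Fin n → ℤ, X ≠ 0 →
      (∀ i, |(X i : ℝ)| ≤ Real.exp ((1 - δ) * x)) →
      Real.exp (-((n - 1) + δ) * x) < |∑ i, α i * X i| := by
  classical
  have hn0 : 0 < n := by omega
  let z : Fin n := ⟨0, hn0⟩
  have hαz : α z ≠ 0 := hli.ne_zero z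
  obtain ⟨C, hC, hred⟩ := exists_reduced_basis hn0
  set L := Matrix.updateRow (1 : Matrix (Fin n) (Fin n) ℝ) z α with hL
  have hLdet : L.det = α z := by
    have h1 := Matrix.cramer_transpose_apply (1 : Matrix (Fin n) (Fin n) ℝ) α z
    rw [Matrix.transpose_one, Matrix.cramer_one] at h1
    rw [hL, ← h1]
    rfl
  have hLz : ∀ v : Fin n → ℤ, ∑ i, L z i * v i = ∑ i, α i * v i := fun v => by simp [hL]
  have hLn : ∀ i, i ≠ z → ∀ v : Fin n → ℤ, ∑ q, L i q * v q = v i := fun i hi v => by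
    simp [hL, Matrix.updateRow_ne hi, Matrix.one_apply]
  set e : Fin n → ℝ := fun i => if i = z then -((n : ℝ) - 1) else 1 with he
  have hesum : ∑ i, e i = 0 := by
    rw [he, Finset.sum_ite, Finset.filter_eq' Finset.univ z, if_pos (Finset.mem_univ z),
      Finset.filter_ne', Finset.sum_singleton, Finset.sum_const, Finset.card_erase_of_mem (Finset.mem_univ _),
      Finset.card_univ, Fintype.card_fin, nsmul_eq_mul, Nat.cast_sub (by omega)]
    simp
  set C₁ : ℝ := (1 + (1 + ∑ i, |α i|) / |α z|) * C with hC₁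
  have hnn : 0 ≤ (1 + ∑ i, |α i|) / |α z| := by positivity
  have hC₁1 : 1 ≤ C₁ := by
    have := mul_nonneg hnn (by linarith : 0 ≤ C)
    rw [hC₁]; linarith
  have hnR : (2 : ℝ) ≤ n := by exact_mod_cast hn
  set C₀ := Real.log (C * |α z|) with hC₀
  set C₂ := Real.log (|α z| / C) with hC₂
  have hgap : ∀ᶠ x : ℝ in Filter.atTop, ∀ k ∈ Finset.Ico 1 n, ∀ hk : k ∈ Finset.Ico 1 n,
      ∀ (y : Matrix (Fin n) (Fin n) ℤ)
      (π : Equiv.Perm (Fin n)) (μ : Fin n → ℝ), y.det ≠ 0 → Monotone μ →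
      (∀ l j, |∑ i, L (π l) i * y j i| ≤ C * Real.exp (e (π l) * x + min (μ l) (μ j))) →
      ∑ i, μ i ≤ C₀ → (∀ i, |μ i| ≤ 2 * n * x) →
      μ ⟨k, (Finset.mem_Ico.1 hk).2⟩ - μ ⟨k - 1, by have := Finset.mem_Ico.1 hk; omega⟩
        < δ / (2 * n) * x := by
    rw [Filter.eventually_all_finset]
    intro k hk
    have hk' := Finset.mem_Ico.1 hk
    filter_upwards [eventually_gap_lt_of_lt (by omega) hk'.2 α halg hli z C C₀ (2 * n) (δ / (2 * n))
      hC (by positivity) (by positivity)] with x hx _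
    exact hx
  filter_upwards [hgap, Filter.eventually_ge_atTop 0, Filter.eventually_ge_atTop (Real.log C₁),
    Filter.eventually_ge_atTop C₀,
    Filter.eventually_gt_atTop (2 * |C₂| / δ)] with x hgx hx0 hxC₁ hxC₀ hxC₂ X hX hXb
  by_contra! hsmall
  let A : Matrix (Fin n) (Fin n) ℝ := Matrix.of fun i j => Real.exp (-(e i * x)) * L i j
  have hAform : ∀ i (v : Fin n → ℤ), ∑ q, A i q * v q = Real.exp (-(e i * x)) * ∑ q, L i q * v q := by
    intro i v
    rw [Finset.mul_sum]
    exact Finset.sum_congr rfl fun q _ => by simp only [A, Matrix.of_apply]; ring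
  have hAdet : A.det = α z := by
    rw [Matrix.det_mul_column, hLdet, ← Real.exp_sum, Finset.sum_neg_distrib, ← Finset.sum_mul, hesum]
    simp
  obtain ⟨y, π, lam, hy, hlm, hlpos, hlmin, hbd, hprod1, hprod2⟩ := hred A (by rw [hAdet]; exact hαz)
  rw [hAdet] at hprod1 hprod2
  set μ : Fin n → ℝ := fun j => Real.log (lam j) with hμ
  have hexpμ : ∀ j, Real.exp (μ j) = lam j := fun j => Real.exp_log (hlpos j)
  have hμm : Monotone μ := fun i j hij => Real.log_le_log (hlpos i) (hlm hij)
  have hμsum : ∑ j, μ j = Real.log (∏ j, lam j) := (Real.log_prod fun j _ => (hlpos j).ne').symm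
  have hprodpos : 0 < ∏ j, lam j := Finset.prod_pos fun j _ => hlpos j
  have hsum1 : ∑ j, μ j ≤ C₀ := by
    rw [hμsum]; exact Real.log_le_log hprodpos hprod1
  have hsum2 : C₂ ≤ ∑ j, μ j := by
    rw [hμsum]
    refine Real.log_le_log (by positivity) ?_
    rw [div_le_iff₀ (by linarith)]
    linarith
  have hbd' : ∀ l j, |∑ i, L (π l) i * y j i| ≤ C * Real.exp (e (π l) * x + min (μ l) (μ j)) := by
    intro l j
    have h1 := hbd l j
    rw [hAform, abs_mul, abs_of_pos (Real.exp_pos _), ← hexpμ l, ← hexpμ j,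
      ← Real.exp_monotone.map_min, Real.exp_neg, inv_mul_le_iff₀ (Real.exp_pos _)] at h1
    rw [Real.exp_add]
    linarith
  have hμ0 : ∀ j, -(2 * x) ≤ μ j := by
    intro j
    have hrow : ∀ i, |∑ q, L i q * y j q| ≤ C * Real.exp (e i * x + μ j) := by
      intro i
      have h1 := hbd' (π.symm i) j
      rw [Equiv.apply_symm_apply] at h1
      refine h1.trans (mul_le_mul_of_nonneg_left (Real.exp_le_exp.2 ?_) (by linarith))
      exact add_le_add le_rfl (min_le_right _ _)
    obtain ⟨i, hi⟩ : ∃ i, y j i ≠ 0 := by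
      by_contra! h
      exact hy (Matrix.det_eq_zero_of_row_eq_zero j h)
    have h2 : |(y j i : ℝ)| ≤ C₁ * Real.exp (x + μ j) := by
      rw [hC₁, mul_assoc]
      refine abs_coord_le_of_form_le α z hαz (fun q => (y j q : ℝ)) _ (by positivity) ?_ ?_ i
      · have h3 := hrow z
        rw [hLz] at h3
        refine h3.trans (mul_le_mul_of_nonneg_left (Real.exp_le_exp.2 ?_) (by linarith))
        simp only [he, if_true]
        have h4 := mul_nonneg (by linarith : (0 : ℝ) ≤ n - 1) hx0
        linarith
      · intro i hi
        have h1 := hrow i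
        rw [hLn i hi] at h1
        simpa only [he, if_neg hi, one_mul] using h1
    have h3 : (1 : ℝ) ≤ |(y j i : ℝ)| := by exact_mod_cast Int.one_le_abs hi
    have h4 := Real.log_nonneg (h3.trans h2)
    rw [Real.log_mul (by positivity) (by positivity), Real.log_exp] at h4
    linarith
  have hμB : ∀ i, |μ i| ≤ 2 * n * x := by
    intro i
    have h5 : 2 * x ≤ 2 * n * x := mul_le_mul_of_nonneg_right (by linarith) hx0
    refine abs_le.2 ⟨by linarith [hμ0 i], ?_⟩
    have h1 : ∑ j ∈ Finset.univ.erase i, (-(2 * x)) ≤ ∑ j ∈ Finset.univ.erase i, μ j :=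
      Finset.sum_le_sum fun j _ => hμ0 j
    rw [Finset.sum_const, Finset.card_erase_of_mem (Finset.mem_univ _), Finset.card_univ,
      Fintype.card_fin, nsmul_eq_mul, Nat.cast_sub (by omega)] at h1
    rw [← Finset.add_sum_erase _ _ (Finset.mem_univ i)] at hsum1
    push_cast at h1
    have h6 : ((n : ℝ) - 1) * -(2 * x) = -(2 * n * x) + 2 * x := by ring
    rw [h6] at h1
    linarith
  have hlam0 : μ ⟨0, hn0⟩ ≤ -(δ * x) := by
    obtain ⟨i, hi⟩ := hlmin X hX
    rw [hAform, abs_mul, abs_of_pos (Real.exp_pos _), ← hexpμ] at hi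
    rw [← Real.exp_le_exp]
    refine hi.trans ?_
    by_cases hiz : i = z
    · rw [hiz, hLz]
      refine (mul_le_mul_of_nonneg_left hsmall (Real.exp_pos _).le).trans ?_
      rw [← Real.exp_add, Real.exp_le_exp]
      simp only [he, if_true]
      linarith
    · rw [hLn i hiz]
      refine (mul_le_mul_of_nonneg_left (hXb i) (Real.exp_pos _).le).trans ?_
      rw [← Real.exp_add, Real.exp_le_exp]
      simp only [he, if_neg hiz]
      linarith
  have hstep : ∀ k : ℕ, ∀ hk : k < n, μ ⟨k, hk⟩ ≤ -(δ * x) + k * (δ / (2 * n) * x) := by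
    intro k
    induction k with
    | zero => intro hk; simpa using hlam0
    | succ k ih =>
      intro hk
      have hmem : k + 1 ∈ Finset.Ico 1 n := Finset.mem_Ico.2 ⟨by omega, hk⟩
      have h1 := hgx (k + 1) hmem hmem y π μ hy hμm hbd' hsum1 hμB
      have h2 := ih (by omega)
      simp only [Nat.add_sub_cancel] at h1
      push_cast
      linarith
  have hall : ∀ j, μ j ≤ -(δ / 2 * x) := by
    intro j
    have h1 := hstep j j.2
    have h2 : ((j : ℕ) : ℝ) * (δ / (2 * n) * x) ≤ n * (δ / (2 * n) * x) := by
      refine mul_le_mul_of_nonneg_right ?_ (by positivity)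
      exact_mod_cast j.2.le
    have h3 : (n : ℝ) * (δ / (2 * n) * x) = δ / 2 * x := by field_simp
    have h1' : μ j ≤ -(δ * x) + (j : ℕ) * (δ / (2 * n) * x) := h1
    linarith
  have hfin : C₂ ≤ -(n * (δ / 2 * x)) := by
    refine hsum2.trans ((Finset.sum_le_sum fun j _ => hall j).trans ?_)
    simp
  have hxC₂' : 2 * |C₂| < δ * x := by
    rw [div_lt_iff₀ hδ] at hxC₂
    linarith
  have h7 : 2 * (δ / 2 * x) ≤ n * (δ / 2 * x) := mul_le_mul_of_nonneg_right hnR (by positivity)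
  have h8 := neg_abs_le C₂
  have h9 : 0 ≤ |C₂| := abs_nonneg _
  linarith

/-- Schmidt's theorem on a single linear form with real algebraic coefficients. -/
theorem eventually_exp_neg_lt_abs_form {n : ℕ} (hn : 2 ≤ n) (α : Fin n → ℝ)
    (halg : ∀ i, IsAlgebraic ℚ (α i)) (hli : LinearIndependent ℚ α) (δ : ℝ) (hδ : 0 < δ) :
    ∀ᶠ h : ℝ in Filter.atTop, ∀ X : Fin n → ℤ, X ≠ 0 → (∀ i, |(X i : ℝ)| ≤ Real.exp h) →
      Real.exp (-((n - 1) + δ) * h) < |∑ i, α i * X i| := by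
  have hnR : (2 : ℝ) ≤ n := by exact_mod_cast hn
  have h1 := eventually_exp_lt_abs_form hn α halg hli (δ / (n + δ)) (by positivity)
  have h2 : Filter.Tendsto (fun h : ℝ => (n + δ) / n * h) Filter.atTop Filter.atTop :=
    Filter.tendsto_id.const_mul_atTop (by positivity)
  filter_upwards [h2.eventually h1] with h hh X hX hXb
  have h3 := hh X hX (fun i => by
    convert hXb i using 2
    field_simp
    ring)
  convert h3 using 2
  field_simp
  ring

section Growth

variable {ε s κ M : ℝ} {l : ℕ → ℝ}

lemma exists_tail_bound (hε : 0 < ε) (hs : 1 < s * (1 + ε)) (hmono : Monotone l)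
    (hgrow : ∀ n : ℕ, (1 + ε) * Real.log (n + 1) ≤ l n) :
    Summable (fun n => Real.exp (-(s * l n))) ∧ ∃ C t : ℝ, 1 ≤ C ∧ 0 < t ∧
      ∀ N, ∑' n, Real.exp (-(s * l (n + N))) ≤ C * Real.exp (-(t * l N)) := by
  obtain ⟨ρ, hρ1, hρ2⟩ : ∃ ρ, 1 < ρ * (1 + ε) ∧ ρ < s := by
    refine ⟨(s + 1 / (1 + ε)) / 2, ?_, ?_⟩
    · field_simp; linarith
    · have : 1 / (1 + ε) < s := by rw [div_lt_iff₀ (by linarith)]; exact hs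
      linarith
  have hρ0 : 0 < ρ := pos_of_mul_pos_left (lt_trans one_pos hρ1) (by linarith)
  have hsum : Summable (fun n : ℕ => ((n : ℝ) + 1) ^ (-(ρ * (1 + ε)))) := by
    have h1 : Summable (fun n : ℕ => (n : ℝ) ^ (-(ρ * (1 + ε)))) :=
      Real.summable_nat_rpow.2 (by linarith)
    simpa using (summable_nat_add_iff 1).2 h1
  set C₀ := ∑' n : ℕ, ((n : ℝ) + 1) ^ (-(ρ * (1 + ε))) with hC₀
  have hbd : ∀ N n : ℕ, Real.exp (-(s * l (n + N)))
      ≤ ((n : ℝ) + 1) ^ (-(ρ * (1 + ε))) * Real.exp (-((s - ρ) * l N)) := by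
    intro N n
    have h0 : (0 : ℝ) < (n : ℝ) + 1 := by positivity
    rw [Real.rpow_def_of_pos h0, ← Real.exp_add, Real.exp_le_exp]
    have h1 : l N ≤ l (n + N) := hmono (by omega)
    have h2 : (1 + ε) * Real.log (n + 1) ≤ l (n + N) := (hgrow n).trans (hmono (by omega))
    have h3 := mul_le_mul_of_nonneg_left h2 hρ0.le
    have h4 := mul_le_mul_of_nonneg_left h1 (by linarith : 0 ≤ s - ρ)
    linarith
  have hsum' : ∀ N, Summable (fun n => Real.exp (-(s * l (n + N)))) := fun N =>
    Summable.of_nonneg_of_le (fun _ => (Real.exp_pos _).le) (hbd N) (hsum.mul_right _)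
  refine ⟨by simpa using hsum' 0, max 1 C₀, s - ρ, le_max_left _ _, by linarith, fun N => ?_⟩
  calc ∑' n, Real.exp (-(s * l (n + N)))
      ≤ ∑' n : ℕ, ((n : ℝ) + 1) ^ (-(ρ * (1 + ε))) * Real.exp (-((s - ρ) * l N)) :=
        (hsum' N).tsum_le_tsum (hbd N) (hsum.mul_right _)
    _ = C₀ * Real.exp (-((s - ρ) * l N)) := tsum_mul_right
    _ ≤ _ := mul_le_mul_of_nonneg_right (le_max_right _ _) (Real.exp_pos _).le

/-- A sequence of large numbers with super-exponentially growing logarithms has infinitely many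
large gaps, in the sense that a tail of the series of reciprocal powers is small compared with the
product of the preceding terms. -/
lemma frequently_tail_le (hε : 0 < ε) (hs : 1 < s * (1 + ε)) (hκ : 0 < κ) (hM : κ / s + 1 < M)
    (hmono : Monotone l) (hgrow : ∀ n : ℕ, (1 + ε) * Real.log (n + 1) ≤ l n)
    (hunb : ∀ C : ℝ, ∃ᶠ n in Filter.atTop, C * M ^ n < l n) :
    ∃ᶠ N in Filter.atTop, ∑' n, Real.exp (-(s * l (n + N)))
      ≤ Real.exp (-(κ * ∑ i ∈ Finset.range N, l i)) := by
  obtain ⟨hsum, C, t, hC, ht, htail⟩ := exists_tail_bound hε hs hmono hgrow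
  have hs0 : 0 < s := pos_of_mul_pos_left (lt_trans one_pos hs) (by linarith)
  have hM1 : 1 < M := by have := div_pos hκ hs0; linarith
  have hM0 : 0 < M := by linarith
  have hl0 : ∀ n, 0 ≤ l n := fun n =>
    le_trans (mul_nonneg (by linarith) (Real.log_nonneg (by linarith [n.cast_nonneg (α := ℝ)]))) (hgrow n)
  set q : ℕ → ℝ := fun N => ∑ i ∈ Finset.range N, l i with hq
  have hq0 : ∀ N, 0 ≤ q N := fun N => Finset.sum_nonneg fun i _ => hl0 i
  set s₁ := κ / (M - 1) with hs₁
  have hs₁0 : 0 < s₁ := div_pos hκ (by linarith)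
  have hs₁s : s₁ < s := by
    rw [hs₁, div_lt_iff₀ (by linarith), mul_comm, ← div_lt_iff₀ hs0]
    linarith
  have hs₁M : κ = s₁ * (M - 1) := (div_mul_cancel₀ κ (sub_pos.2 hM1).ne').symm
  set η := s - s₁ with hη
  have hη0 : 0 < η := by linarith
  by_contra hcon
  rw [Filter.not_frequently] at hcon
  obtain ⟨N₀, hN₀⟩ := Filter.eventually_atTop.1 hcon
  have hbad : ∀ N, N₀ ≤ N → Real.exp (-(κ * q N)) < ∑' n, Real.exp (-(s * l (n + N))) :=
    fun N hN => not_le.1 (hN₀ N hN)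
  set c := Real.log (2 * C) with hc
  have hc0 : 0 ≤ c := Real.log_nonneg (by linarith)
  have hexpc : Real.exp c = 2 * C := Real.exp_log (by linarith)
  have hstep1 : ∀ N, N₀ ≤ N → t * l N ≤ κ * q N + c := by
    intro N hN
    have h1 := (hbad N hN).le.trans (htail N)
    have h2 : C * Real.exp (-(t * l N)) ≤ Real.exp (c + -(t * l N)) := by
      rw [Real.exp_add, hexpc]
      exact mul_le_mul_of_nonneg_right (by linarith) (Real.exp_pos _).le
    have h3 := Real.exp_le_exp.1 (h1.trans h2)
    linarith
  have hjump : ∀ N, N₀ ≤ N → κ * q N ≤ s₁ * l N → ∃ n', N < n' ∧ Real.exp (η * l N) ≤ 2 * n' ∧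
      ∀ i < n', t * l i ≤ s₁ * l N + c := by
    intro N hN hj
    set m := ⌊Real.exp (η * l N) / 2⌋₊ with hm
    refine ⟨N + m + 1, by omega, ?_, ?_⟩
    · have h1 := (Nat.lt_floor_add_one (Real.exp (η * l N) / 2)).le
      rw [← hm] at h1
      push_cast
      linarith [N.cast_nonneg (α := ℝ)]
    · intro i hi
      have hm1 : (m : ℝ) ≤ Real.exp (η * l N) / 2 := Nat.floor_le (by positivity)
      have hsumN : Summable (fun n => Real.exp (-(s * l (n + N)))) := (summable_nat_add_iff N).2 hsum
      have h1 := hsumN.sum_add_tsum_nat_add m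
      have h2 : ∑ i ∈ Finset.range m, Real.exp (-(s * l (i + N))) ≤ Real.exp (-(s₁ * l N)) / 2 := by
        calc _ ≤ ∑ i ∈ Finset.range m, Real.exp (-(s * l N)) := Finset.sum_le_sum fun i _ => by
              rw [Real.exp_le_exp]
              have := mul_le_mul_of_nonneg_left (hmono (by omega : N ≤ i + N)) hs0.le
              linarith
          _ = m * Real.exp (-(s * l N)) := by simp
          _ ≤ Real.exp (η * l N) / 2 * Real.exp (-(s * l N)) :=
              mul_le_mul_of_nonneg_right hm1 (Real.exp_pos _).le
          _ = Real.exp (-(s₁ * l N)) / 2 := by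
              rw [div_mul_eq_mul_div, ← Real.exp_add]
              congr 2
              rw [hη]; ring
      have h3 := hbad N hN
      have h4 : Real.exp (-(s₁ * l N)) ≤ Real.exp (-(κ * q N)) := Real.exp_le_exp.2 (by linarith)
      have h5 := htail (m + N)
      simp only [← add_assoc] at h5
      have h6 : Real.exp (-(s₁ * l N)) / 2 ≤ C * Real.exp (-(t * l (m + N))) := by linarith
      have h7 : Real.exp (-(s₁ * l N)) ≤ Real.exp (c + -(t * l (m + N))) := by
        rw [Real.exp_add, hexpc]; linarith
      have h8 := Real.exp_le_exp.1 h7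
      have h9 := mul_le_mul_of_nonneg_left (hmono (by omega : i ≤ m + N)) ht.le
      linarith
  obtain ⟨C₅, hC₅⟩ : ∃ C₅ : ℝ, ∀ n : ℕ, (n : ℝ) ^ 2 ≤ C₅ * M ^ n := by
    obtain ⟨C₅, hC₅⟩ := (tendsto_pow_const_div_const_pow_of_one_lt 2 hM1).bddAbove_range
    refine ⟨C₅, fun n => ?_⟩
    have := hC₅ ⟨n, rfl⟩
    exact (div_le_iff₀ (by positivity)).1 this
  set C₄ := (s₁ * 2 / η + c) / t with hC₄
  have hC₄0 : 0 ≤ C₄ := by positivity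
  set G := max (max (C₄ * C₅) (q N₀)) 0 with hG
  have hG0 : 0 ≤ G := le_max_right _ _
  set R := max (M * G) ((s₁ * ((κ * G + c) / t) + c) / t) with hR
  have hR0 : 0 ≤ R := le_max_of_le_left (by positivity)
  have hpow1 : ∀ n : ℕ, 1 ≤ M ^ n := fun n => one_le_pow₀ hM1.le
  have hnext : ∀ N, N₀ ≤ N → q N ≤ G * M ^ N → ∃ n', N < n' ∧ q n' ≤ G * M ^ n' ∧
      ∀ i, N ≤ i → i < n' → l i ≤ R * M ^ i := by
    intro N hN hgood
    by_cases hj : κ * q N ≤ s₁ * l N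
    · obtain ⟨n', hn', hlarge, hl⟩ := hjump N hN hj
      have hn'1 : (1 : ℝ) ≤ n' := by exact_mod_cast (by omega : 1 ≤ n')
      refine ⟨n', hn', ?_, ?_⟩
      · have h1 : η * l N ≤ 2 * n' := by
          have := Real.add_one_le_exp (η * l N)
          linarith
        have h2 : l N ≤ 2 * n' / η := by rw [le_div_iff₀ hη0]; linarith
        have h3 : ∀ i < n', l i ≤ C₄ * n' := by
          intro i hi
          have h4 := hl i hi
          have h5 := mul_le_mul_of_nonneg_left h2 hs₁0.le
          have h6 : c ≤ c * n' := le_mul_of_one_le_right hc0 hn'1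
          have h7 : t * l i ≤ (s₁ * 2 / η + c) * n' := by
            have h8 : s₁ * (2 * n' / η) = s₁ * 2 / η * n' := by ring
            rw [h8] at h5
            linarith
          rw [hC₄, div_mul_eq_mul_div, le_div_iff₀ ht]
          linarith
        calc q n' ≤ ∑ i ∈ Finset.range n', C₄ * n' :=
              Finset.sum_le_sum fun i hi => h3 i (Finset.mem_range.1 hi)
          _ = C₄ * (n' : ℝ) ^ 2 := by simp; ring
          _ ≤ C₄ * (C₅ * M ^ n') := mul_le_mul_of_nonneg_left (hC₅ n') hC₄0
          _ = C₄ * C₅ * M ^ n' := by ring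
          _ ≤ G * M ^ n' := mul_le_mul_of_nonneg_right ((le_max_left _ _).trans (le_max_left _ _))
              (by positivity)
      · intro i hi hin
        have h1 := hl i hin
        have h2 : l N ≤ (κ * G + c) / t * M ^ N := by
          rw [div_mul_eq_mul_div, le_div_iff₀ ht]
          have h3 := hstep1 N hN
          have h4 := mul_le_mul_of_nonneg_left hgood hκ.le
          have h5 : c ≤ c * M ^ N := le_mul_of_one_le_right hc0 (hpow1 N)
          linarith
        have h3 : l i ≤ (s₁ * ((κ * G + c) / t) + c) / t * M ^ N := by
          rw [div_mul_eq_mul_div, le_div_iff₀ ht]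
          have h4 := mul_le_mul_of_nonneg_left h2 hs₁0.le
          have h5 : c ≤ c * M ^ N := le_mul_of_one_le_right hc0 (hpow1 N)
          linarith
        calc l i ≤ _ := h3
          _ ≤ R * M ^ N := mul_le_mul_of_nonneg_right (le_max_right _ _) (by positivity)
          _ ≤ R * M ^ i := mul_le_mul_of_nonneg_left (pow_le_pow_right₀ hM1.le hi) hR0
    · push Not at hj
      have h1 : l N ≤ (M - 1) * q N := by
        rw [hs₁M, mul_assoc] at hj
        exact (lt_of_mul_lt_mul_left hj hs₁0.le).le
      refine ⟨N + 1, by omega, ?_, ?_⟩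
      · have h2 : q (N + 1) = q N + l N := Finset.sum_range_succ _ _
        have h3 := mul_le_mul_of_nonneg_left hgood hM0.le
        rw [h2, pow_succ]
        linarith
      · intro i hi hin
        obtain rfl : i = N := by omega
        have h3 := mul_le_mul_of_nonneg_left hgood hM0.le
        have h4 : M * G * M ^ i ≤ R * M ^ i := mul_le_mul_of_nonneg_right (le_max_left _ _) (by positivity)
        have h5 := hq0 i
        linarith
  have hfinal : ∀ i, N₀ ≤ i → l i ≤ R * M ^ i := by
    intro i hi
    classical
    let S := (Finset.Icc N₀ i).filter fun N => q N ≤ G * M ^ N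
    have hS : S.Nonempty := ⟨N₀, by
      simp only [S, Finset.mem_filter, Finset.mem_Icc]
      refine ⟨⟨le_rfl, hi⟩, ?_⟩
      have h1 : q N₀ ≤ G := (le_max_right _ _).trans (le_max_left _ _)
      exact h1.trans (le_mul_of_one_le_right hG0 (hpow1 _))⟩
    obtain ⟨hN1, hN2⟩ := Finset.mem_filter.1 (S.max'_mem hS)
    obtain ⟨n', hn', hgood, hl⟩ := hnext _ (Finset.mem_Icc.1 hN1).1 hN2
    refine hl i (Finset.mem_Icc.1 hN1).2 ?_
    by_contra hle
    have hmem : n' ∈ S := Finset.mem_filter.2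
      ⟨Finset.mem_Icc.2 ⟨(Finset.mem_Icc.1 hN1).1.trans hn'.le, by omega⟩, hgood⟩
    have := S.le_max' _ hmem
    omega
  exact (hunb R) (Filter.eventually_atTop.2 ⟨N₀, fun i hi => not_lt.2 (hfinal i hi)⟩)

end Growth

lemma exists_isAlgebraic_notMem (F : IntermediateField ℚ ℝ) [FiniteDimensional ℚ F] :
    ∃ t : ℝ, IsAlgebraic ℚ t ∧ t ∉ F := by
  obtain ⟨p, hp, hprime⟩ := Nat.exists_infinite_primes (Module.finrank ℚ F + 1)
  have hirr : Irreducible (Polynomial.X ^ p - Polynomial.C (2 : ℚ)) := by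
    refine X_pow_sub_C_irreducible_of_prime hprime fun b hb => ?_
    have hb0 : b ≠ 0 := by
      rintro rfl
      rw [zero_pow hprime.ne_zero] at hb
      norm_num at hb
    have h1 := congrArg (padicValRat 2) hb
    rw [padicValRat.pow] at h1
    have h2 : padicValRat 2 (2 : ℚ) = 1 := by exact_mod_cast padicValRat.self (p := 2) (by norm_num)
    rw [h2] at h1
    have h3 : (p : ℤ) ∣ 1 := ⟨_, h1.symm⟩
    have h4 := Int.le_of_dvd one_pos h3
    have := hprime.two_le
    omega
  set t : ℝ := (2 : ℝ) ^ ((p : ℝ)⁻¹) with ht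
  have htp : t ^ p = 2 := Real.rpow_inv_natCast_pow (by norm_num) hprime.ne_zero
  have hroot : Polynomial.aeval t (Polynomial.X ^ p - Polynomial.C (2 : ℚ)) = 0 := by
    simp [htp]
  have halg : IsAlgebraic ℚ t := ⟨_, hirr.ne_zero, hroot⟩
  refine ⟨t, halg, fun hmem => ?_⟩
  have hmin := minpoly.eq_of_irreducible_of_monic hirr hroot
    (Polynomial.monic_X_pow_sub_C _ hprime.ne_zero)
  have h1 : (minpoly ℚ (⟨t, hmem⟩ : F)).natDegree ≤ Module.finrank ℚ F := minpoly.natDegree_le _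
  have h2 : minpoly ℚ (⟨t, hmem⟩ : F) = minpoly ℚ t :=
    (minpoly.algebraMap_eq (algebraMap F ℝ).injective (⟨t, hmem⟩ : F)).symm
  rw [h2, ← hmin, Polynomial.natDegree_X_pow_sub_C] at h1
  omega

lemma isAlgebraic_re_im (w : ℂ) (hw : IsAlgebraic ℚ w) :
    IsAlgebraic ℚ w.re ∧ IsAlgebraic ℚ w.im := by
  have hconj : IsAlgebraic ℚ ((starRingEnd ℂ) w) :=
    hw.algHom (Complex.conjAe.toAlgHom.restrictScalars ℚ)
  have hI : IsAlgebraic ℚ Complex.I :=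
    (IsIntegral.of_pow (n := 2) (by norm_num) (by
      rw [Complex.I_sq]; exact isIntegral_one.neg)).isAlgebraic
  have h2 : IsAlgebraic ℚ (2 : ℂ)⁻¹ := by
    simpa using (isAlgebraic_algebraMap (A := ℂ) ((2 : ℚ)⁻¹))
  have hinj : Function.Injective (algebraMap ℝ ℂ) := (algebraMap ℝ ℂ).injective
  constructor
  · rw [← isAlgebraic_algebraMap_iff (A := ℂ) hinj]
    have h3 : (algebraMap ℝ ℂ) w.re = (w + (starRingEnd ℂ) w) * (2 : ℂ)⁻¹ := by
      rw [Complex.add_conj]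
      simp only [Complex.coe_algebraMap, Complex.ofReal_mul, Complex.ofReal_ofNat]
      ring
    rw [h3]
    exact (hw.add hconj).mul h2
  · rw [← isAlgebraic_algebraMap_iff (A := ℂ) hinj]
    have h3 : (algebraMap ℝ ℂ) w.im = (w - (starRingEnd ℂ) w) * (2 : ℂ)⁻¹ * Complex.I⁻¹ := by
      rw [Complex.sub_conj]
      rw [Complex.inv_I]
      simp only [Complex.coe_algebraMap, Complex.ofReal_mul, Complex.ofReal_ofNat]
      ring_nf
      rw [Complex.I_sq]
      ring
    rw [h3]
    exact ((hw.sub hconj).mul h2).mul hI.inv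

/-- A linear form with complex algebraic coefficients that are linearly independent over `ℚ` is not
too small at integer points. -/
theorem eventually_exp_neg_lt_norm_form {n : ℕ} (hn : 2 ≤ n) (w : Fin n → ℂ)
    (halg : ∀ i, IsAlgebraic ℚ (w i)) (hli : LinearIndependent ℚ w) (δ : ℝ) (hδ : 0 < δ) :
    ∀ᶠ h : ℝ in Filter.atTop, ∀ X : Fin n → ℤ, X ≠ 0 → (∀ i, |(X i : ℝ)| ≤ Real.exp h) →
      Real.exp (-((n - 1) + δ) * h) < ‖∑ i, w i * X i‖ := by
  let S : Set ℝ := Set.range (fun i => (w i).re) ∪ Set.range (fun i => (w i).im)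
  let F := IntermediateField.adjoin ℚ S
  have hSfin : Finite S := ((Set.finite_range _).union (Set.finite_range _)).to_subtype
  have hfin : FiniteDimensional ℚ F := IntermediateField.finiteDimensional_adjoin (S := S) (by
    rintro _ (⟨i, rfl⟩ | ⟨i, rfl⟩)
    · exact (isAlgebraic_re_im _ (halg i)).1.isIntegral
    · exact (isAlgebraic_re_im _ (halg i)).2.isIntegral)
  obtain ⟨t, htalg, htF⟩ := exists_isAlgebraic_notMem F
  let α : Fin n → ℝ := fun i => (w i).re - t * (w i).im
  have hα : ∀ i, IsAlgebraic ℚ (α i) := fun i =>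
    (isAlgebraic_re_im _ (halg i)).1.sub (htalg.mul (isAlgebraic_re_im _ (halg i)).2)
  have hαli : LinearIndependent ℚ α := by
    rw [Fintype.linearIndependent_iff] at hli ⊢
    intro g hg
    apply hli g
    have h1 : (∑ i, g i • (w i).re) - t * ∑ i, g i • (w i).im = 0 := by
      rw [← hg, Finset.mul_sum, ← Finset.sum_sub_distrib]
      refine Finset.sum_congr rfl fun i _ => ?_
      simp only [α, Rat.smul_def]
      ring
    have hre : ∑ i, g i • (w i).re ∈ F := sum_mem fun i _ =>
      F.smul_mem (IntermediateField.subset_adjoin ℚ S (Or.inl ⟨i, rfl⟩))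
    have him : ∑ i, g i • (w i).im ∈ F := sum_mem fun i _ =>
      F.smul_mem (IntermediateField.subset_adjoin ℚ S (Or.inr ⟨i, rfl⟩))
    have him0 : ∑ i, g i • (w i).im = 0 := by
      by_contra h0
      apply htF
      have h2 : t = (∑ i, g i • (w i).re) / ∑ i, g i • (w i).im := by
        rw [eq_div_iff h0]; linarith
      rw [h2]
      exact F.div_mem hre him
    have hre0 : ∑ i, g i • (w i).re = 0 := by
      rw [him0, mul_zero, sub_zero] at h1; exact h1
    apply Complex.ext
    · rw [Complex.re_sum, Complex.zero_re, ← hre0]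
      exact Finset.sum_congr rfl fun i _ => by simp [Rat.smul_def]
    · rw [Complex.im_sum, Complex.zero_im, ← him0]
      exact Finset.sum_congr rfl fun i _ => by simp [Rat.smul_def]
  filter_upwards [eventually_exp_neg_lt_abs_form hn α hα hαli (δ / 2) (by positivity),
    Filter.eventually_ge_atTop (2 / δ * |t|)] with h hh hT X hX hXb
  have h1 := hh X hX hXb
  set u := ∑ i, w i * X i with hu
  have h2 : ∑ i, α i * X i = u.re - t * u.im := by
    rw [hu, Complex.re_sum, Complex.im_sum, Finset.mul_sum, ← Finset.sum_sub_distrib]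
    refine Finset.sum_congr rfl fun i _ => ?_
    simp [α]
    ring
  have h3 : |u.re - t * u.im| ≤ (1 + |t|) * ‖u‖ := by
    refine (abs_sub _ _).trans ?_
    rw [abs_mul, add_mul, one_mul]
    exact add_le_add (Complex.abs_re_le_norm u)
      (mul_le_mul_of_nonneg_left (Complex.abs_im_le_norm u) (abs_nonneg t))
  rw [h2] at h1
  have h4 : 1 + |t| ≤ Real.exp (δ / 2 * h) := by
    refine le_trans ?_ (Real.add_one_le_exp _)
    have h5 := mul_le_mul_of_nonneg_left hT (by positivity : 0 ≤ δ / 2)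
    have h6 : δ / 2 * (2 / δ * |t|) = |t| := by field_simp
    linarith
  have h7 := h1.trans_le (h3.trans (mul_le_mul_of_nonneg_right h4 (norm_nonneg u)))
  have h8 : Real.exp (-((n - 1) + δ / 2) * h)
      = Real.exp (δ / 2 * h) * Real.exp (-((n - 1) + δ) * h) := by
    rw [← Real.exp_add]
    congr 1
    ring
  rw [h8] at h7
  exact lt_of_mul_lt_mul_left h7 (Real.exp_pos _).le

lemma norm_embedding_le_house {K : IntermediateField ℚ ℂ} [FiniteDimensional ℚ K] (x : K)
    (σ : K →+* ℂ) : ‖σ x‖ ≤ house (x : ℂ) := by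
  have hInt : IsIntegral ℚ (x : ℂ) := (IsIntegral.of_finite ℚ x).map (IsScalarTower.toAlgHom ℚ K ℂ)
  refine le_csSup ?_ ⟨σ x, ?_, rfl⟩
  · have hfin : Set.Finite {z : ℂ | Polynomial.aeval z (minpoly ℚ (x : ℂ)) = 0} := by
      refine ((minpoly ℚ (x : ℂ)).rootSet_finite ℂ).subset fun z hz => ?_
      exact Polynomial.mem_rootSet.2 ⟨minpoly.ne_zero hInt, hz⟩
    refine ((hfin.image fun z => ‖z‖).subset ?_).bddAbove
    rintro _ ⟨z, hz, rfl⟩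
    exact ⟨z, hz, rfl⟩
  · have h2 : minpoly ℚ (x : ℂ) = minpoly ℚ x :=
      minpoly.algebraMap_eq (algebraMap K ℂ).injective x
    have h3 := Polynomial.aeval_algHom_apply σ.toRatAlgHom x (minpoly ℚ x)
    rw [minpoly.aeval, map_zero] at h3
    rw [h2]
    exact h3

lemma exists_nat_eq_norm_conjNorm (t : ℂ) (ht : IsIntegral ℤ t) (ht0 : t ≠ 0) :
    ∃ m : ℕ, 0 < m ∧ ‖conjNorm t‖ = m ∧ IsIntegral ℤ ((m : ℂ) / t) := by
  set P := minpoly ℤ t with hP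
  have hPm : P.Monic := minpoly.monic ht
  have hPQ : minpoly ℚ t = P.map (algebraMap ℤ ℚ) := minpoly.isIntegrallyClosed_eq_field_fractions' ℚ ht
  have hP0 : Polynomial.aeval t P = 0 := minpoly.aeval ℤ t
  have hc0 : P.coeff 0 ≠ 0 := by
    intro h0
    have hQ : IsIntegral ℚ t := ht.tower_top
    apply minpoly.coeff_zero_ne_zero hQ ht0
    rw [hPQ, Polynomial.coeff_map, h0, map_zero]
  have hdiv : (P.coeff 0 : ℂ) = -(t * Polynomial.aeval t P.divX) := by
    have h1 := hP0
    rw [← P.divX_mul_X_add] at h1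
    simp only [map_add, map_mul, Polynomial.aeval_X, Polynomial.aeval_C] at h1
    have h2 : (algebraMap ℤ ℂ) (P.coeff 0) = (P.coeff 0 : ℂ) := by simp
    rw [h2] at h1
    linear_combination h1
  have hnorm : ‖conjNorm t‖ = (P.coeff 0).natAbs := by
    have hPC : (minpoly ℚ t).map (algebraMap ℚ ℂ) = P.map (algebraMap ℤ ℂ) := by
      rw [hPQ, Polynomial.map_map]
      congr 1
    rw [conjNorm, Polynomial.aroots, hPC]
    have h1 := (IsAlgClosed.splits (P.map (algebraMap ℤ ℂ))).coeff_zero_eq_prod_roots_of_monic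
      (hPm.map _)
    rw [Polynomial.coeff_map] at h1
    have h2 := congrArg norm h1
    rw [norm_mul, norm_pow, norm_neg, norm_one, one_pow, one_mul] at h2
    rw [← h2]
    simp
  have hInt : IsIntegral ℤ ((P.coeff 0 : ℂ) / t) := by
    rw [hdiv, neg_div, mul_div_cancel_left₀ _ ht0]
    refine IsIntegral.neg ?_
    have h1 : Algebra.adjoin ℤ {t} ≤ integralClosure ℤ ℂ :=
      Algebra.adjoin_le (Set.singleton_subset_iff.2 ht)
    exact h1 (Polynomial.aeval_mem_adjoin_singleton ℤ t)
  refine ⟨(P.coeff 0).natAbs, Int.natAbs_pos.2 hc0, hnorm, ?_⟩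
  have h3 : (((P.coeff 0).natAbs : ℕ) : ℂ) = ((|P.coeff 0| : ℤ) : ℂ) := by
    rw [← Int.natCast_natAbs, Int.cast_natCast]
  rw [h3]
  rcases abs_choice (P.coeff 0) with h | h
  · rw [h]; exact hInt
  · rw [h, Int.cast_neg, neg_div]; exact hInt.neg

lemma exists_integral_coordinates (K : IntermediateField ℚ ℂ) [FiniteDimensional ℚ K] (d : ℕ)
    (hd : Module.finrank ℚ K = d) :
    ∃ (w : Fin d → ℂ) (C : ℝ), (∀ i, w i ∈ K) ∧ LinearIndependent ℚ w ∧ 0 ≤ C ∧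
      ∀ u : K, IsIntegral ℤ (u : ℂ) → ∀ B : ℝ, (∀ σ : K →+* ℂ, ‖σ u‖ ≤ B) →
        ∃ X : Fin d → ℤ, (u : ℂ) = ∑ i, X i * w i ∧ ∀ i, |(X i : ℝ)| ≤ C * B := by
  classical
  have hNF : NumberField K := { to_charZero := inferInstance, to_finiteDimensional := inferInstance }
  obtain ⟨C, hC⟩ : ∃ C : ℝ, ∀ (u : NumberField.RingOfIntegers K) (i : K →+* ℂ),
      ‖(((NumberField.integralBasis K).reindex (NumberField.equivReindex K).symm).repr u i : ℂ)‖
        ≤ C * NumberField.house (algebraMap (NumberField.RingOfIntegers K) K u) :=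
    ⟨_, NumberField.house.basis_repr_norm_le_const_mul_house K⟩
  set bb := NumberField.integralBasis K with hbb
  have hcard : Fintype.card (Module.Free.ChooseBasisIndex ℤ (NumberField.RingOfIntegers K)) = d := by
    rw [← Module.finrank_eq_card_basis bb, hd]
  let e := Fintype.equivFinOfCardEq hcard
  have hli : LinearIndependent ℚ fun i : Fin d => ((bb (e.symm i) : K) : ℂ) := by
    have h1 : LinearIndependent ℚ (bb ∘ e.symm) := bb.linearIndependent.comp _ e.symm.injective
    exact h1.map' (IsScalarTower.toAlgHom ℚ K ℂ).toLinearMap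
      (LinearMap.ker_eq_bot.2 (algebraMap K ℂ).injective)
  refine ⟨fun i => ((bb (e.symm i) : K) : ℂ), max C 0, fun i => (bb (e.symm i)).2, hli,
    le_max_right _ _, ?_⟩
  intro u hu B hB
  have huK : IsIntegral ℤ u := (isIntegral_algebraMap_iff (algebraMap K ℂ).injective).1 hu
  let v : NumberField.RingOfIntegers K := ⟨u, huK⟩
  have hv : algebraMap (NumberField.RingOfIntegers K) K v = u := rfl
  let X : Fin d → ℤ := fun i => (NumberField.RingOfIntegers.basis K).repr v (e.symm i)
  have hX : ∀ i, bb.repr u (e.symm i) = (X i : ℚ) := by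
    intro i
    rw [← hv, hbb, NumberField.integralBasis_repr_apply]
    rfl
  have hhouse : NumberField.house u ≤ B := by
    rw [NumberField.house_eq_sup']
    obtain ⟨σ, -, hσ⟩ := Finset.exists_mem_eq_sup' Finset.univ_nonempty
      (fun φ : K →+* ℂ => ‖φ u‖₊)
    rw [hσ]
    exact hB σ
  refine ⟨X, ?_, fun i => ?_⟩
  · have h1 : u = ∑ i : Fin d, (X i : ℚ) • bb (e.symm i) := by
      conv_lhs => rw [← bb.sum_repr u]
      rw [← Equiv.sum_comp e.symm]
      exact Finset.sum_congr rfl fun i _ => by rw [hX]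
    have h2 := congrArg (algebraMap K ℂ) h1
    rw [map_sum] at h2
    refine h2.trans (Finset.sum_congr rfl fun i _ => ?_)
    rw [Algebra.smul_def, map_mul]
    simp
  · have h1 := hC v ((NumberField.equivReindex K).symm (e.symm i))
    rw [hv] at h1
    have h2 : (bb.reindex (NumberField.equivReindex K).symm).repr u
        ((NumberField.equivReindex K).symm (e.symm i)) = (X i : ℚ) := by
      rw [Module.Basis.repr_reindex_apply, Equiv.symm_symm, Equiv.apply_symm_apply, hX]
    have h3 : ‖(((X i : ℤ) : ℚ) : ℂ)‖ ≤ C * NumberField.house u := by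
      rw [← h2]
      exact h1
    have h4 : ‖(((X i : ℤ) : ℚ) : ℂ)‖ = |(X i : ℝ)| := by
      rw [Rat.cast_intCast, Complex.norm_intCast]
    rw [← h4]
    have h5 := NumberField.house_nonneg u
    calc _ ≤ C * NumberField.house u := h3
      _ ≤ max C 0 * NumberField.house u := mul_le_mul_of_nonneg_right (le_max_left _ _) h5
      _ ≤ max C 0 * B := mul_le_mul_of_nonneg_left hhouse (le_max_right _ _)

/-- A product `∏ (1 + x n)` with `‖x n‖` dominated by a summable sequence converges, with error
controlled by the tails of that sequence. -/
lemma exists_tendsto_prod_one_add {x : ℕ → ℂ} {e : ℕ → ℝ} {c : ℝ} (hc : 0 < c) (he : Summable e)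
    (he0 : ∀ n, 0 ≤ e n) (hx : ∀ n, ‖x n‖ ≤ c * e n) :
    ∃ L : ℂ, Filter.Tendsto (fun N => ∏ n ∈ Finset.range N, (1 + x n)) Filter.atTop (nhds L) ∧
      ∃ C : ℝ, 0 < C ∧ ∀ N, ‖L - ∏ n ∈ Finset.range N, (1 + x n)‖ ≤ C * ∑' n, e (n + N) := by
  have hsx : Summable fun n => ‖x n‖ :=
    Summable.of_nonneg_of_le (fun n => norm_nonneg _) hx (he.mul_left c)
  obtain ⟨L, hL⟩ := multipliable_one_add_of_summable hsx
  have hLt := hL.tendsto_prod_nat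
  set T : ℝ := c * ∑' n, e n with hT
  have htail : ∀ N, 0 ≤ ∑' n, e (n + N) := fun N => tsum_nonneg fun n => he0 _
  have hsum : ∀ N M, ∑ i ∈ Finset.range M, ‖x (N + i)‖ ≤ c * ∑' n, e (n + N) := by
    intro N M
    calc ∑ i ∈ Finset.range M, ‖x (N + i)‖ ≤ ∑ i ∈ Finset.range M, c * e (i + N) :=
          Finset.sum_le_sum fun i _ => by rw [add_comm N i]; exact hx _
      _ = c * ∑ i ∈ Finset.range M, e (i + N) := by rw [Finset.mul_sum]
      _ ≤ c * ∑' n, e (n + N) := by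
          refine mul_le_mul_of_nonneg_left ?_ hc.le
          exact Summable.sum_le_tsum _ (fun i _ => he0 _) ((summable_nat_add_iff N).2 he)
  have htail_le : ∀ N, c * ∑' n, e (n + N) ≤ T := by
    intro N
    refine mul_le_mul_of_nonneg_left ?_ hc.le
    rw [← he.sum_add_tsum_nat_add N]
    have := Finset.sum_nonneg fun i (_ : i ∈ Finset.range N) => he0 i
    linarith
  have hP : ∀ N, ‖∏ n ∈ Finset.range N, (1 + x n)‖ ≤ Real.exp T := by
    intro N
    rw [norm_prod]
    calc ∏ n ∈ Finset.range N, ‖1 + x n‖ ≤ ∏ n ∈ Finset.range N, Real.exp ‖x n‖ := by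
          refine Finset.prod_le_prod (fun i _ => norm_nonneg _) fun i _ => ?_
          calc ‖1 + x i‖ ≤ ‖(1 : ℂ)‖ + ‖x i‖ := norm_add_le _ _
            _ = ‖x i‖ + 1 := by rw [norm_one, add_comm]
            _ ≤ _ := Real.add_one_le_exp _
      _ = Real.exp (∑ n ∈ Finset.range N, ‖x n‖) := (Real.exp_sum _ _).symm
      _ ≤ Real.exp T := by
          refine Real.exp_le_exp.2 ?_
          have := hsum 0 N
          simpa [hT] using this
  refine ⟨L, hLt, Real.exp T * Real.exp T * c, by positivity, fun N => ?_⟩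
  have hlim : Filter.Tendsto (fun M => ‖∏ n ∈ Finset.range (N + M), (1 + x n) -
      ∏ n ∈ Finset.range N, (1 + x n)‖) Filter.atTop
      (nhds ‖L - ∏ n ∈ Finset.range N, (1 + x n)‖) := by
    have h1 : Filter.Tendsto (fun M : ℕ => N + M) Filter.atTop Filter.atTop :=
      Filter.tendsto_atTop_mono (fun M => Nat.le_add_left M N) Filter.tendsto_id
    exact ((hLt.comp h1).sub_const _).norm
  refine le_of_tendsto hlim (Filter.Eventually.of_forall fun M => ?_)
  rw [Finset.prod_range_add]
  set t := ∑ i ∈ Finset.range M, ‖x (N + i)‖ with ht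
  have ht0 : 0 ≤ t := Finset.sum_nonneg fun i _ => norm_nonneg _
  have h1 : ‖∏ i ∈ Finset.range M, (1 + x (N + i)) - 1‖ ≤ Real.exp t - 1 :=
    Finset.norm_prod_one_add_sub_one_le _ _
  have h2 : Real.exp t - 1 ≤ t * Real.exp t := by
    have h3 := Real.add_one_le_exp (-t)
    have h4 : Real.exp (-t) * Real.exp t = 1 := by rw [← Real.exp_add]; simp
    nlinarith [Real.exp_pos t]
  have h3 : Real.exp t ≤ Real.exp T := Real.exp_le_exp.2 ((hsum N M).trans (htail_le N))
  have h4 : t * Real.exp t ≤ (c * ∑' n, e (n + N)) * Real.exp T :=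
    mul_le_mul (hsum N M) h3 (Real.exp_pos _).le (mul_nonneg hc.le (htail N))
  calc ‖(∏ n ∈ Finset.range N, (1 + x n)) * ∏ i ∈ Finset.range M, (1 + x (N + i)) -
        ∏ n ∈ Finset.range N, (1 + x n)‖
      = ‖∏ n ∈ Finset.range N, (1 + x n)‖ * ‖∏ i ∈ Finset.range M, (1 + x (N + i)) - 1‖ := by
        rw [← norm_mul]; congr 1; ring
    _ ≤ Real.exp T * ((c * ∑' n, e (n + N)) * Real.exp T) :=
        mul_le_mul (hP N) (h1.trans (h2.trans h4)) (norm_nonneg _) (Real.exp_pos _).le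
    _ = _ := by ring

/-- The factor `2 ^ (log₂ x) ^ α` is at least `1` and subpolynomial. -/
lemma one_le_two_rpow_logb_rpow {α x : ℝ} (hx : 1 ≤ x) : 1 ≤ (2 : ℝ) ^ (Real.logb 2 x ^ α) :=
  Real.one_le_rpow one_le_two (Real.rpow_nonneg (Real.logb_nonneg one_lt_two hx) _)

lemma exists_two_rpow_logb_rpow_le {α : ℝ} (hα : 0 < α) (hα1 : α < 1) {η : ℝ} (hη : 0 < η) :
    ∃ C : ℝ, 0 < C ∧ ∀ x : ℝ, 1 ≤ x →
      (2 : ℝ) ^ (Real.logb 2 x ^ α) ≤ C * Real.exp (η * Real.log x) := by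
  have hlim := tendsto_rpow_neg_atTop (show 0 < 1 - α by linarith)
  obtain ⟨T, hT1, hT2⟩ := ((hlim.eventually (gt_mem_nhds hη)).and
    (Filter.eventually_gt_atTop (0 : ℝ))).exists
  refine ⟨2 ^ (T ^ α), by positivity, fun x hx => ?_⟩
  set t := Real.logb 2 x with ht
  have ht0 : 0 ≤ t := Real.logb_nonneg one_lt_two hx
  have hlog2 : 0 < Real.log 2 := Real.log_pos one_lt_two
  have htx : Real.log x = t * Real.log 2 := by
    rw [ht, Real.logb, div_mul_cancel₀ _ hlog2.ne']
  have hE : Real.exp (η * Real.log x) = 2 ^ (η * t) := by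
    rw [htx, Real.rpow_def_of_pos two_pos]; congr 1; ring
  rw [hE, ← Real.rpow_add two_pos]
  refine Real.rpow_le_rpow_of_exponent_le one_le_two ?_
  have hT0 : 0 ≤ T ^ α := Real.rpow_nonneg hT2.le _
  rcases le_total t T with h | h
  · have := Real.rpow_le_rpow ht0 h hα.le
    have h2 : 0 ≤ η * t := by positivity
    linarith
  · have htpos : 0 < t := hT2.trans_le h
    have h1 : t ^ α = t * t ^ (-(1 - α)) := by
      rw [← Real.rpow_one_add' ht0 (by intro h0; linarith)]
      congr 1; ring
    have h2 : t ^ (-(1 - α)) ≤ T ^ (-(1 - α)) :=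
      Real.rpow_le_rpow_of_nonpos hT2 h (by linarith)
    have h3 : t * t ^ (-(1 - α)) ≤ t * η := mul_le_mul_of_nonneg_left (h2.trans hT1.le) ht0
    rw [h1]
    linarith

/-- Bounds `f n ≤ C exp ((c + η) l n)`, valid for every `η > 0`, survive taking products. -/
lemma exists_prod_le_exp_sum {f l : ℕ → ℝ} {c : ℝ} (hf : ∀ n, 0 ≤ f n)
    (hl : Filter.Tendsto l Filter.atTop Filter.atTop)
    (h : ∀ η : ℝ, 0 < η → ∃ C : ℝ, 0 < C ∧ ∀ n, f n ≤ C * Real.exp ((c + η) * l n))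
    {η : ℝ} (hη : 0 < η) :
    ∃ C : ℝ, 0 < C ∧ ∀ N, ∏ i ∈ Finset.range N, f i ≤
      C * Real.exp ((c + η) * ∑ i ∈ Finset.range N, l i) := by
  obtain ⟨C, hC, hCf⟩ := h (η / 2) (half_pos hη)
  have hlarge : ∀ᶠ n in Filter.atTop, C ≤ Real.exp (η / 2 * l n) :=
    (Real.tendsto_exp_atTop.comp (hl.const_mul_atTop (half_pos hη))).eventually_ge_atTop C
  obtain ⟨N₀, hN₀⟩ := Filter.eventually_atTop.1 hlarge
  let g : ℕ → ℝ := fun i => max 1 (f i * Real.exp (-((c + η) * l i)))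
  have hg1 : ∀ i, 1 ≤ g i := fun i => le_max_left _ _
  have hfg : ∀ i, f i ≤ g i * Real.exp ((c + η) * l i) := by
    intro i
    have h1 : f i = f i * Real.exp (-((c + η) * l i)) * Real.exp ((c + η) * l i) := by
      rw [mul_assoc, ← Real.exp_add]; simp
    calc f i = _ := h1
      _ ≤ _ := mul_le_mul_of_nonneg_right (le_max_right _ _) (Real.exp_pos _).le
  have hglarge : ∀ i, N₀ ≤ i → g i = 1 := by
    intro i hi
    refine max_eq_left ?_
    have h1 : f i ≤ Real.exp ((c + η) * l i) := by
      calc f i ≤ C * Real.exp ((c + η / 2) * l i) := hCf i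
        _ ≤ Real.exp (η / 2 * l i) * Real.exp ((c + η / 2) * l i) :=
            mul_le_mul_of_nonneg_right (hN₀ i hi) (Real.exp_pos _).le
        _ = Real.exp ((c + η) * l i) := by rw [← Real.exp_add]; congr 1; ring
    calc f i * Real.exp (-((c + η) * l i))
        ≤ Real.exp ((c + η) * l i) * Real.exp (-((c + η) * l i)) :=
          mul_le_mul_of_nonneg_right h1 (Real.exp_pos _).le
      _ = 1 := by rw [← Real.exp_add]; simp
  have hpos : ∀ N, 0 < ∏ i ∈ Finset.range N, g i := fun N =>
    Finset.prod_pos fun i _ => zero_lt_one.trans_le (hg1 i)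
  have hmono : Monotone fun N => ∏ i ∈ Finset.range N, g i := by
    refine monotone_nat_of_le_succ fun N => ?_
    rw [Finset.prod_range_succ]
    exact le_mul_of_one_le_right (hpos N).le (hg1 N)
  refine ⟨∏ i ∈ Finset.range N₀, g i, hpos N₀, fun N => ?_⟩
  have hgN : ∏ i ∈ Finset.range N, g i ≤ ∏ i ∈ Finset.range N₀, g i := by
    calc ∏ i ∈ Finset.range N, g i ≤ ∏ i ∈ Finset.range (N₀ + N), g i :=
          hmono (Nat.le_add_left N N₀)
      _ = ∏ i ∈ Finset.range N₀, g i := by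
          rw [Finset.prod_range_add, Finset.prod_eq_one (s := Finset.range N)
            fun i _ => hglarge _ (Nat.le_add_right _ _), mul_one]
  calc ∏ i ∈ Finset.range N, f i ≤ ∏ i ∈ Finset.range N, g i * Real.exp ((c + η) * l i) :=
        Finset.prod_le_prod (fun i _ => hf i) fun i _ => hfg i
    _ = (∏ i ∈ Finset.range N, g i) * Real.exp ((c + η) * ∑ i ∈ Finset.range N, l i) := by
        rw [Finset.prod_mul_distrib, ← Real.exp_sum, Finset.mul_sum]
    _ ≤ _ := mul_le_mul_of_nonneg_right hgN (Real.exp_pos _).le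

/-- An algebraic number outside `K` cannot be approximated too well by quotients `u N / D N` with
`u N` an integer of `K` and `D N` a positive integer. -/
lemma not_frequently_norm_sub_le (K : IntermediateField ℚ ℂ) [FiniteDimensional ℚ K] (d : ℕ)
    (hd : Module.finrank ℚ K = d) {L : ℂ} (halg : IsAlgebraic ℚ L) (hL : L ∉ K)
    {D : ℕ → ℕ} (hD : ∀ N, 0 < D N) {u : ℕ → K} (hu : ∀ N, IsIntegral ℤ (u N : ℂ)) {P : ℕ → ℂ}
    (hP : ∀ N, (u N : ℂ) = D N * P N) {q : ℕ → ℝ}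
    (hq : Filter.Tendsto q Filter.atTop Filter.atTop) {w z δ C : ℝ} (hz : 0 < z) (hzw : z ≤ w)
    (hδ : 0 < δ)
    (hDb : ∀ η : ℝ, 0 < η → ∃ C : ℝ, 0 < C ∧ ∀ N, (D N : ℝ) ≤ C * Real.exp ((z + η) * q N))
    (hub : ∀ η : ℝ, 0 < η → ∃ C : ℝ, 0 < C ∧ ∀ (N : ℕ) (σ : K →+* ℂ),
      ‖σ (u N)‖ ≤ C * Real.exp ((w + η) * q N)) :
    ¬ ∃ᶠ N in Filter.atTop, ‖L - P N‖ ≤ C * Real.exp (-((d * w + z + δ) * q N)) := by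
  intro hfreq
  obtain ⟨ω, C₀, hωK, hωli, hC₀, hcoord⟩ := exists_integral_coordinates K d hd
  have hdpos : 1 ≤ d := by rw [← hd]; exact Module.finrank_pos
  have hdR : (1 : ℝ) ≤ d := by exact_mod_cast hdpos
  set η : ℝ := δ / (8 * (d + 1)) with hηdef
  have hη : 0 < η := by positivity
  have hηd : (d + 1) * η = δ / 8 := by rw [hηdef]; field_simp
  obtain ⟨C₁, hC₁, hDb⟩ := hDb η hη
  obtain ⟨C₂, hC₂, hub⟩ := hub η hη
  have hw : 0 < w := hz.trans_le hzw
  have hwη : 0 < w + 2 * η := by positivity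
  have hli : LinearIndependent ℚ (Fin.cons L ω : Fin (d + 1) → ℂ) := by
    refine linearIndependent_finCons.2 ⟨hωli, fun hmem => hL ?_⟩
    have hle : Submodule.span ℚ (Set.range ω) ≤ Subalgebra.toSubmodule K.toSubalgebra :=
      Submodule.span_le.2 (by rintro _ ⟨i, rfl⟩; exact hωK i)
    exact hle hmem
  have hωalg : ∀ i, IsAlgebraic ℚ ((Fin.cons L ω : Fin (d + 1) → ℂ) i) := by
    intro i
    refine Fin.cases ?_ (fun j => ?_) i
    · exact halg
    · have h1 : IsAlgebraic ℚ (⟨ω j, hωK j⟩ : K) := Algebra.IsAlgebraic.isAlgebraic _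
      exact h1.algebraMap (A := ℂ)
  have hschmidt := eventually_exp_neg_lt_norm_form (by omega) _ hωalg hli
    (δ / 2 / (w + 2 * η)) (by positivity)
  have hev := (hq.const_mul_atTop hwη).eventually hschmidt
  have hlarge : ∀ (A c : ℝ), 0 < c → ∀ᶠ N in Filter.atTop, A ≤ Real.exp (c * q N) := fun A c hc =>
    (Real.tendsto_exp_atTop.comp (hq.const_mul_atTop hc)).eventually_ge_atTop A
  obtain ⟨N, hN, hform, hA1, hA2, hA3, hq0⟩ := (hfreq.and_eventually (hev.and
    ((hlarge C₁ η hη).and ((hlarge (C₀ * C₂) η hη).and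
      ((hlarge (C₁ * C) (δ / 4) (by positivity)).and (hq.eventually_ge_atTop 0)))))).exists
  obtain ⟨X, hX, hXb⟩ := hcoord (u N) (hu N) _ (hub N)
  have hDpos : (0 : ℝ) < D N := by exact_mod_cast hD N
  have key := hform (Fin.cons (D N : ℤ) fun i => -X i) (fun h => by
      have h0 := congrFun h 0
      rw [Fin.cons_zero, Pi.zero_apply] at h0
      have := hD N
      omega) (fun i => by
      refine Fin.cases ?_ (fun j => ?_) i
      · rw [Fin.cons_zero, Int.cast_natCast, abs_of_pos hDpos]
        calc (D N : ℝ) ≤ C₁ * Real.exp ((z + η) * q N) := hDb N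
          _ ≤ Real.exp (η * q N) * Real.exp ((w + η) * q N) := by
              refine mul_le_mul hA1 (Real.exp_le_exp.2 ?_) (Real.exp_pos _).le (Real.exp_pos _).le
              exact mul_le_mul_of_nonneg_right (by linarith) hq0
          _ = _ := by rw [← Real.exp_add]; congr 1; ring
      · rw [Fin.cons_succ, Int.cast_neg, abs_neg]
        calc |(X j : ℝ)| ≤ C₀ * (C₂ * Real.exp ((w + η) * q N)) := hXb j
          _ = (C₀ * C₂) * Real.exp ((w + η) * q N) := by ring
          _ ≤ Real.exp (η * q N) * Real.exp ((w + η) * q N) :=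
              mul_le_mul_of_nonneg_right hA2 (Real.exp_pos _).le
          _ = _ := by rw [← Real.exp_add]; congr 1; ring)
  have hsum : ∑ i, (Fin.cons L ω : Fin (d + 1) → ℂ) i *
      ((Fin.cons (D N : ℤ) fun i => -X i : Fin (d + 1) → ℤ) i : ℂ) = D N * (L - P N) := by
    rw [Fin.sum_univ_succ]
    simp only [Fin.cons_zero, Fin.cons_succ, Int.cast_natCast, Int.cast_neg]
    have h1 : ∑ i, ω i * -(X i : ℂ) = -(D N * P N) := by
      rw [← hP, hX, ← Finset.sum_neg_distrib]
      exact Finset.sum_congr rfl fun i _ => by ring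
    rw [h1]; ring
  rw [hsum, norm_mul, Complex.norm_natCast] at key
  refine absurd key (not_lt.2 ?_)
  calc (D N : ℝ) * ‖L - P N‖
      ≤ (C₁ * Real.exp ((z + η) * q N)) * (C * Real.exp (-((d * w + z + δ) * q N))) :=
        mul_le_mul (hDb N) hN (norm_nonneg _) (by positivity)
    _ = (C₁ * C) * Real.exp (-((d * w + δ - η) * q N)) := by
        rw [show -((d * w + δ - η) * q N) = (z + η) * q N + -((d * w + z + δ) * q N) by ring,
          Real.exp_add]
        ring
    _ ≤ Real.exp (δ / 4 * q N) * Real.exp (-((d * w + δ - η) * q N)) :=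
        mul_le_mul_of_nonneg_right hA3 (Real.exp_pos _).le
    _ = Real.exp (-((d * w + 3 * δ / 4 - η) * q N)) := by rw [← Real.exp_add]; congr 1; ring
    _ ≤ _ := by
        refine Real.exp_le_exp.2 ?_
        have h1 : -(((d + 1 : ℕ) : ℝ) - 1 + δ / 2 / (w + 2 * η)) * ((w + 2 * η) * q N) =
            -((d * w + 2 * d * η + δ / 2) * q N) := by
          push_cast
          field_simp
          ring
        rw [h1]
        refine neg_le_neg (mul_le_mul_of_nonneg_right ?_ hq0)
        linarith

lemma frequently_mul_pow_lt_log {A : ℕ → ℝ} {M : ℝ} (hM : 1 < M) (hA : ∀ n, 1 ≤ n → 1 ≤ A n)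
    (hlimsup : Filter.limsup (fun n : ℕ => ((A n ^ (M ^ (-(n : ℝ))) : ℝ) : EReal))
      Filter.atTop = ⊤) (C : ℝ) :
    ∃ᶠ n in Filter.atTop, C * M ^ n < Real.log (A (n + 1)) := by
  by_contra hnot
  rw [Filter.not_frequently] at hnot
  obtain ⟨N, hN⟩ := Filter.eventually_atTop.1 hnot
  have hbound : ∀ᶠ n : ℕ in Filter.atTop,
      ((A n ^ (M ^ (-(n : ℝ))) : ℝ) : EReal) ≤ (Real.exp |C| : ℝ) := by
    filter_upwards [Filter.eventually_ge_atTop (N + 1)] with n hn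
    obtain ⟨k, rfl⟩ : ∃ k, n = k + 1 := ⟨n - 1, by omega⟩
    have h1 : Real.log (A (k + 1)) ≤ C * M ^ k := not_lt.1 (hN k (by omega))
    have hM0 : 0 < M := zero_lt_one.trans hM
    have h2 : C * M ^ k ≤ |C| * M ^ (k + 1) :=
      mul_le_mul (le_abs_self C) (pow_le_pow_right₀ hM.le (Nat.le_succ k)) (by positivity)
        (abs_nonneg C)
    have hA1 := hA (k + 1) (by omega)
    rw [EReal.coe_le_coe_iff, Real.rpow_def_of_pos (by linarith), Real.rpow_neg hM0.le,
      Real.rpow_natCast]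
    refine Real.exp_le_exp.2 ?_
    rw [← div_eq_mul_inv, div_le_iff₀ (by positivity)]
    exact h1.trans h2
  have h3 := Filter.limsup_le_of_le (h := hbound)
  rw [hlimsup, top_le_iff] at h3
  exact EReal.coe_ne_top _ h3

/-- Theorem `main an algebraic`: the product is transcendental or lies in K. -/
theorem stmt_10 (K : IntermediateField ℚ ℂ) [FiniteDimensional ℚ K] (d : ℕ)
    (hd : Module.finrank ℚ K = d)
    (α δ ε β y z1 z2 : ℝ)
    (hα : 0 < α ∧ α < 1) (hδ : 0 < δ) (hε : 0 < ε) (hβ : 0 ≤ β ∧ β < ε / (1 + ε))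
    (hy : β ≤ y) (hz1 : -y ≤ z1) (hz2 : 0 < z2)
    (a b : ℕ → ℂ) (r : ℕ → ℕ)
    (haK : ∀ n : ℕ, 1 ≤ n → a n ∈ K ∧ IsIntegral ℤ (a n) ∧ a n ≠ 0)
    (hbK : ∀ n : ℕ, 1 ≤ n → b n ∈ K ∧ IsIntegral ℤ (b n) ∧ b n ≠ 0)
    (hgrow : ∀ n : ℕ, 1 ≤ n → (n : ℝ) ^ (1 + ε) ≤ ‖a n‖ ∧
      ‖a n‖ ≤ ‖a (n + 1)‖)
    (hbn : ∀ n : ℕ, 1 ≤ n → ‖b n‖ < ‖a n‖ ^ (β) * 2 ^ (Real.logb 2 (‖a n‖) ^ α))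
    (hhouseb : ∀ n : ℕ, 1 ≤ n → house (b n) ≤ ‖a n‖ ^ (y) * 2 ^ (Real.logb 2 (‖a n‖) ^ α))
    (hinv : ∀ n : ℕ, 1 ≤ n → house ((a n)⁻¹) ≤ ‖a n‖ ^ (z1) * 2 ^ (Real.logb 2 (‖a n‖) ^ α))
    (hr : ∀ n : ℕ, 1 ≤ n → 0 < r n ∧
      (∃ t : ℂ, t ∈ K ∧ IsIntegral ℤ t ∧ a n = (r n : ℂ) * t) ∧
      (r n : ℝ) * ‖conjNorm (a n / (r n : ℂ))‖ ≤ ‖a n‖ ^ (z2) * 2 ^ (Real.logb 2 (‖a n‖) ^ α))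
    (hlimsup : Filter.limsup (fun n : ℕ =>
      ((‖a n‖ ^ ((((d : ℝ) * (y + z1 + z2) + z2 + δ) / (1 - β) + 1) ^ (-(n : ℝ))) : ℝ) : EReal)) Filter.atTop = ⊤) :
    ∃ L : ℂ,
      Tendsto (fun N => ∏ n ∈ Finset.Icc 1 N, (1 + b n / a n)) atTop (nhds L) ∧
      (Transcendental ℚ L ∨ L ∈ K) := by
  obtain ⟨hα0, hα1⟩ := hα
  obtain ⟨hβ0, hβε⟩ := hβ
  have hε1 : 0 < 1 + ε := by linarith
  set w : ℝ := y + z1 + z2 with hw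
  have hzw : z2 ≤ w := by rw [hw]; linarith
  have hw0 : 0 < w := hz2.trans_le hzw
  set κ : ℝ := d * w + z2 + δ / 2 with hκdef
  have hdw : 0 ≤ (d : ℝ) * w := by positivity
  have hκ : 0 < κ := by rw [hκdef]; positivity
  have hβ1 : 1 / (1 + ε) < 1 - β := by
    have h1 : ε / (1 + ε) = 1 - 1 / (1 + ε) := by field_simp; ring
    linarith
  have hβpos : 0 < 1 - β := lt_trans (by positivity) hβ1
  set M : ℝ := ((d : ℝ) * w + z2 + δ) / (1 - β) + 1 with hM
  have hM1 : 1 < M := by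
    have : 0 < ((d : ℝ) * w + z2 + δ) / (1 - β) := by positivity
    linarith
  -- an exponent `s < 1 - β` for which the estimates still hold
  obtain ⟨s, hs1, hsβ, hsM⟩ : ∃ s : ℝ, 1 < s * (1 + ε) ∧ s < 1 - β ∧ κ / s + 1 < M := by
    have hlow : κ / (((d : ℝ) * w + z2 + δ) / (1 - β)) < 1 - β := by
      rw [div_div_eq_mul_div, div_lt_iff₀ (by positivity), mul_comm κ]
      exact mul_lt_mul_of_pos_left (by rw [hκdef]; linarith) hβpos
    obtain ⟨s, h1, h2⟩ := exists_between (max_lt hβ1 hlow)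
    have h3 := (le_max_left _ _).trans_lt h1
    have h4 := (le_max_right _ _).trans_lt h1
    have hs0 : 0 < s := lt_trans (by positivity) h3
    refine ⟨s, (div_lt_iff₀ hε1).1 h3, h2, ?_⟩
    rw [div_lt_iff₀ (by positivity)] at h4
    have h5 : κ / s < ((d : ℝ) * w + z2 + δ) / (1 - β) := by
      rw [div_lt_iff₀ hs0, mul_comm]; exact h4
    linarith
  have hA1 : ∀ n, 1 ≤ n → 1 ≤ ‖a n‖ := fun n hn =>
    (Real.one_le_rpow (by exact_mod_cast hn) hε1.le).trans (hgrow n hn).1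
  set l : ℕ → ℝ := fun n => Real.log ‖a (n + 1)‖ with hl
  have hApos : ∀ n, 0 < ‖a (n + 1)‖ := fun n => zero_lt_one.trans_le (hA1 _ (by omega))
  have hlmono : Monotone l := monotone_nat_of_le_succ fun n =>
    Real.log_le_log (hApos n) (hgrow (n + 1) (by omega)).2
  have hlgrow : ∀ n : ℕ, (1 + ε) * Real.log (n + 1) ≤ l n := by
    intro n
    have h1 := (hgrow (n + 1) (by omega)).1
    rw [← Real.log_rpow (by positivity)]
    refine Real.log_le_log (by positivity) ?_
    exact_mod_cast h1
  have hl0 : ∀ n, 0 ≤ l n := fun n => Real.log_nonneg (hA1 _ (by omega))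
  have hltop : Tendsto l atTop atTop := by
    have h1 : Tendsto (fun n : ℕ => (1 + ε) * Real.log ((n : ℝ) + 1)) atTop atTop :=
      (Real.tendsto_log_atTop.comp
        (tendsto_atTop_add_const_right _ 1 tendsto_natCast_atTop_atTop)).const_mul_atTop hε1
    exact tendsto_atTop_mono hlgrow h1
  have hrpow : ∀ (n : ℕ) (t : ℝ), ‖a (n + 1)‖ ^ t = Real.exp (t * l n) := by
    intro n t
    rw [Real.rpow_def_of_pos (hApos n), mul_comm]
  set E : ℕ → ℝ := fun n => 2 ^ (Real.logb 2 ‖a (n + 1)‖ ^ α) with hE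
  have hE1 : ∀ n, 1 ≤ E n := fun n => one_le_two_rpow_logb_rpow (hA1 _ (by omega))
  have hEle : ∀ η : ℝ, 0 < η → ∃ C : ℝ, 0 < C ∧ ∀ n, E n ≤ C * Real.exp (η * l n) := by
    intro η hη
    obtain ⟨C, hC, h⟩ := exists_two_rpow_logb_rpow_le hα0 hα1 hη
    exact ⟨C, hC, fun n => h _ (hA1 _ (by omega))⟩
  have hunb := frequently_mul_pow_lt_log hM1 hA1 hlimsup
  -- convergence
  set x : ℕ → ℂ := fun n => b (n + 1) / a (n + 1) with hx
  obtain ⟨C₃, hC₃, hC₃E⟩ := hEle (1 - β - s) (by linarith)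
  have hxb : ∀ n, ‖x n‖ ≤ C₃ * Real.exp (-(s * l n)) := by
    intro n
    have h1 := (hbn (n + 1) (by omega)).le
    rw [hrpow] at h1
    have h2 : ‖a (n + 1)‖ = Real.exp (l n) := (Real.exp_log (hApos n)).symm
    rw [hx]
    simp only
    rw [norm_div, div_le_iff₀ (hApos n), h2]
    calc ‖b (n + 1)‖ ≤ Real.exp (β * l n) * E n := h1
      _ ≤ Real.exp (β * l n) * (C₃ * Real.exp ((1 - β - s) * l n)) :=
          mul_le_mul_of_nonneg_left (hC₃E n) (Real.exp_pos _).le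
      _ = C₃ * (Real.exp (β * l n) * Real.exp ((1 - β - s) * l n)) := by ring
      _ = C₃ * (Real.exp (-(s * l n)) * Real.exp (l n)) := by
          rw [← Real.exp_add, ← Real.exp_add]; congr 2; ring
      _ = _ := by ring
  obtain ⟨L, hLt, C₄, hC₄, hLP⟩ := exists_tendsto_prod_one_add hC₃
    (exists_tail_bound hε hs1 hlmono hlgrow).1 (fun n => (Real.exp_pos _).le) hxb
  refine ⟨L, ?_, ?_⟩
  · refine hLt.congr fun N => ?_
    rw [Finset.range_eq_Ico, Finset.prod_Ico_add' (fun n => 1 + b n / a n) 0 N 1]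
    rfl
  by_contra hcon
  push Not at hcon
  obtain ⟨hnt, hLK⟩ := hcon
  have hLalg : IsAlgebraic ℚ L := not_not.1 hnt
  -- denominators
  have hden : ∀ n, ∃ D : ℕ, 0 < D ∧ IsIntegral ℤ ((D : ℂ) / a (n + 1)) ∧
      (D : ℝ) ≤ Real.exp (z2 * l n) * E n := by
    intro n
    obtain ⟨hr0, ⟨t, -, htint, hat⟩, hrb⟩ := hr (n + 1) (by omega)
    have ha0 := (haK (n + 1) (by omega)).2.2
    have hrC : (r (n + 1) : ℂ) ≠ 0 := by exact_mod_cast hr0.ne'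
    have ht0 : t ≠ 0 := by
      rintro rfl
      exact ha0 (by rw [hat, mul_zero])
    have hdiv : a (n + 1) / (r (n + 1) : ℂ) = t := by rw [hat, mul_div_cancel_left₀ _ hrC]
    obtain ⟨m, hm0, hm, hmint⟩ := exists_nat_eq_norm_conjNorm t htint ht0
    refine ⟨r (n + 1) * m, Nat.mul_pos hr0 hm0, ?_, ?_⟩
    · rw [hat, Nat.cast_mul, mul_div_mul_left _ _ hrC]
      exact hmint
    · rw [hdiv, hm, hrpow] at hrb
      rw [Nat.cast_mul]
      exact hrb
  choose D hD0 hDint hDle using hden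
  have haKn : ∀ n, a (n + 1) ∈ K := fun n => (haK _ (by omega)).1
  have hbKn : ∀ n, b (n + 1) ∈ K := fun n => (hbK _ (by omega)).1
  let A' : ℕ → K := fun n => ⟨a (n + 1), haKn n⟩
  let B' : ℕ → K := fun n => ⟨b (n + 1), hbKn n⟩
  let c : ℕ → K := fun n => D n * (1 + B' n * (A' n)⁻¹)
  have hccoe : ∀ n, (c n : ℂ) = D n * (1 + x n) := by
    intro n
    simp [c, A', B', hx, div_eq_mul_inv]
  have hcint : ∀ n, IsIntegral ℤ (c n : ℂ) := by
    intro n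
    have h1 : (c n : ℂ) = D n + b (n + 1) * (D n / a (n + 1)) := by
      rw [hccoe, hx]; ring
    rw [h1]
    have h2 : IsIntegral ℤ (D n : ℂ) := by
      have := isIntegral_algebraMap (R := ℤ) (A := ℂ) (x := (D n : ℤ))
      simpa using this
    exact h2.add ((hbK _ (by omega)).2.1.mul (hDint n))
  have hσc : ∀ n (σ : K →+* ℂ), ‖σ (c n)‖ ≤ 2 * Real.exp (w * l n) * E n ^ 3 := by
    intro n σ
    have h1 : ‖σ (B' n)‖ ≤ Real.exp (y * l n) * E n := by
      have h2 := hhouseb (n + 1) (by omega)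
      rw [hrpow] at h2
      exact (norm_embedding_le_house (B' n) σ).trans h2
    have h3 : ‖σ ((A' n)⁻¹)‖ ≤ Real.exp (z1 * l n) * E n := by
      have h2 := hinv (n + 1) (by omega)
      rw [hrpow] at h2
      exact (norm_embedding_le_house ((A' n)⁻¹) σ).trans h2
    have hEn := hE1 n
    have h4 : ‖1 + σ (B' n) * σ ((A' n)⁻¹)‖ ≤ 2 * (Real.exp ((y + z1) * l n) * E n ^ 2) := by
      have h5 : ‖σ (B' n) * σ ((A' n)⁻¹)‖ ≤ Real.exp ((y + z1) * l n) * E n ^ 2 := by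
        rw [norm_mul]
        calc _ ≤ (Real.exp (y * l n) * E n) * (Real.exp (z1 * l n) * E n) :=
              mul_le_mul h1 h3 (norm_nonneg _) (by positivity)
          _ = (Real.exp (y * l n) * Real.exp (z1 * l n)) * E n ^ 2 := by ring
          _ = _ := by rw [← Real.exp_add, add_mul]
      have h6 : 1 ≤ Real.exp ((y + z1) * l n) * E n ^ 2 := by
        have h7 : 1 ≤ Real.exp ((y + z1) * l n) :=
          Real.one_le_exp (mul_nonneg (by linarith) (hl0 n))
        have h8 : 1 ≤ E n ^ 2 := one_le_pow₀ hEn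
        exact one_le_mul_of_one_le_of_one_le h7 h8
      have h9 := norm_add_le 1 (σ (B' n) * σ ((A' n)⁻¹))
      rw [norm_one] at h9
      linarith
    have h10 : σ (c n) = D n * (1 + σ (B' n) * σ ((A' n)⁻¹)) := by
      simp only [c, map_mul, map_add, map_one, map_natCast]
    rw [h10, norm_mul, Complex.norm_natCast]
    calc _ ≤ (Real.exp (z2 * l n) * E n) * (2 * (Real.exp ((y + z1) * l n) * E n ^ 2)) :=
          mul_le_mul (hDle n) h4 (norm_nonneg _) (by positivity)
      _ = 2 * (Real.exp (z2 * l n) * Real.exp ((y + z1) * l n)) * E n ^ 3 := by ring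
      _ = _ := by
          rw [← Real.exp_add]
          congr 3
          rw [hw]; ring
  set q : ℕ → ℝ := fun N => ∑ i ∈ Finset.range N, l i with hq
  have hqtop : Tendsto q atTop atTop := by
    rw [← tendsto_add_atTop_iff_nat 1]
    refine tendsto_atTop_mono (fun N => ?_) hltop
    rw [hq]
    simp only
    rw [Finset.sum_range_succ]
    have := Finset.sum_nonneg fun i (_ : i ∈ Finset.range N) => hl0 i
    linarith
  have hfreq := frequently_tail_le hε hs1 hκ hsM hlmono hlgrow hunb
  refine not_frequently_norm_sub_le K d hd hLalg hLK (D := fun N => ∏ i ∈ Finset.range N, D i)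
    (u := fun N => ∏ i ∈ Finset.range N, c i) (P := fun N => ∏ i ∈ Finset.range N, (1 + x i))
    (q := q) (w := w) (z := z2) (δ := δ / 2) (C := C₄) (fun N => Finset.prod_pos fun i _ => hD0 i)
    (fun N => ?_) (fun N => ?_) hqtop hz2 hzw (half_pos hδ) ?_ ?_ ?_
  · rw [show ((∏ i ∈ Finset.range N, c i : K) : ℂ) = ∏ i ∈ Finset.range N, (c i : ℂ) from
      map_prod (algebraMap K ℂ) _ _]
    exact IsIntegral.prod _ fun i _ => hcint i
  · rw [show ((∏ i ∈ Finset.range N, c i : K) : ℂ) = ∏ i ∈ Finset.range N, (c i : ℂ) from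
      map_prod (algebraMap K ℂ) _ _]
    rw [Nat.cast_prod, ← Finset.prod_mul_distrib]
    exact Finset.prod_congr rfl fun i _ => hccoe i
  · intro η hη
    have h := exists_prod_le_exp_sum (f := fun n => Real.exp (z2 * l n) * E n) (l := l) (c := z2)
      (fun n => mul_nonneg (Real.exp_pos _).le (zero_le_one.trans (hE1 n))) hltop
      (fun η hη => ?_) hη
    · obtain ⟨C, hC, hCb⟩ := h
      refine ⟨C, hC, fun N => le_trans ?_ (hCb N)⟩
      rw [Nat.cast_prod]
      exact Finset.prod_le_prod (fun i _ => Nat.cast_nonneg _) fun i _ => hDle i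
    · obtain ⟨C, hC, hCb⟩ := hEle η hη
      refine ⟨C, hC, fun n => ?_⟩
      calc _ ≤ Real.exp (z2 * l n) * (C * Real.exp (η * l n)) :=
            mul_le_mul_of_nonneg_left (hCb n) (Real.exp_pos _).le
        _ = C * (Real.exp (z2 * l n) * Real.exp (η * l n)) := by ring
        _ = _ := by rw [← Real.exp_add, add_mul]
  · intro η hη
    have h := exists_prod_le_exp_sum (f := fun n => 2 * Real.exp (w * l n) * E n ^ 3) (l := l)
      (c := w) (fun n => mul_nonneg (mul_pos two_pos (Real.exp_pos _)).le
        (pow_nonneg (zero_le_one.trans (hE1 n)) 3)) hltop (fun η hη => ?_) hη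
    · obtain ⟨C, hC, hCb⟩ := h
      refine ⟨C, hC, fun N σ => le_trans ?_ (hCb N)⟩
      rw [map_prod, norm_prod]
      exact Finset.prod_le_prod (fun i _ => norm_nonneg _) fun i _ => hσc i σ
    · obtain ⟨C, hC, hCb⟩ := hEle (η / 3) (by positivity)
      refine ⟨2 * C ^ 3, by positivity, fun n => ?_⟩
      calc _ ≤ 2 * Real.exp (w * l n) * (C * Real.exp (η / 3 * l n)) ^ 3 :=
            mul_le_mul_of_nonneg_left (pow_le_pow_left₀ (zero_le_one.trans (hE1 n)) (hCb n) 3)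
              (mul_pos two_pos (Real.exp_pos _)).le
        _ = 2 * C ^ 3 * (Real.exp (w * l n) * Real.exp (η / 3 * l n) ^ 3) := by ring
        _ = _ := by
            rw [← Real.exp_nat_mul, ← Real.exp_add]
            congr 2
            push_cast
            ring
  · refine hfreq.mono fun N hN => ?_
    exact (hLP N).trans (mul_le_mul_of_nonneg_left hN hC₄.le)
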